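/- Suppose that for every n ≥ 1 and every pair of irreducible homogeneous polynomials f, g ∈ ℂ[z₁,…,zₙ], the existence of a bi-Lipschitz homeomorphism φ : (ℂⁿ, V(f), 0) → (ℂⁿ, V(g), 0) implies deg f = deg g. Then for every n ≥ 1 and every pair of holomorphic functions f, g defined on neighborhoods of 0 ∈ ℂⁿ, not identically zero, vanishing at 0, and reduced at 0, the existence of a bi-Lipschitz homeomorphism φ : (ℂⁿ, V(f), 0) → (ℂⁿ, V(g), 0) implies m(V(f), 0) = m(V(g), 0), i.e., the orders of vanishing of f and g at 0 coincide. (Theorem: a positive answer to the multiplicity question for irreducible homogeneous polynomials implies a positive answer for all reduced analytic hypersurface germs.) -/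

import Mathlib

open scoped Topology

noncomputable section

/-- `ℂⁿ` with the Euclidean metric. -/
abbrev En (n : ℕ) := EuclideanSpace ℂ (Fin n)

/-- The zero set `V(p) ⊆ ℂⁿ` of a polynomial `p ∈ ℂ[z₁,…,zₙ]`. -/
def pV {n : ℕ} (p : MvPolynomial (Fin n) ℂ) : Set (En n) :=
  {x | MvPolynomial.eval (x : Fin n → ℂ) p = 0}

/-- A bi-Lipschitz homeomorphism of germs `φ : (ℂⁿ, X, 0) → (ℂⁿ, Y, 0)`:
a bijection `φ : U → U'` between open neighborhoods of `0` with `φ 0 = 0`,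
`φ` and its inverse Lipschitz, and `φ (X ∩ U) = Y ∩ U'`. -/
def BiLipGermHomeo {n : ℕ} (X Y : Set (En n)) : Prop :=
  ∃ (U U' : Set (En n)) (φ ψ : En n → En n) (K : NNReal),
    IsOpen U ∧ IsOpen U' ∧ (0 : En n) ∈ U ∧ (0 : En n) ∈ U' ∧
    φ 0 = 0 ∧
    Set.MapsTo φ U U' ∧ Set.MapsTo ψ U' U ∧
    Set.LeftInvOn ψ φ U ∧ Set.RightInvOn ψ φ U' ∧
    LipschitzOnWith K φ U ∧ LipschitzOnWith K ψ U' ∧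
    φ '' (X ∩ U) = Y ∩ U'

/-- The order of vanishing at `0` of a function `f : ℂⁿ → ℂ`: the least `k`
such that the `k`-th derivative of `f` at `0` is nonzero. For `f` holomorphic
near `0`, not identically zero, this is the order `m` of the lowest nonzero
homogeneous term of the Taylor expansion, i.e. the multiplicity `m(V(f),0)`
when `f` is reduced. -/
def vanishingOrder {n : ℕ} (f : En n → ℂ) : ℕ :=
  sInf {k | iteratedFDeriv ℂ k f 0 ≠ 0}


/-! winding numbers -/

def IsWind (c : Circle → ℂ) (a : ℤ) : Prop :=
  ∃ h : Circle → ℂ, Continuous h ∧ ∀ θ : Circle, c θ = (θ : ℂ) ^ a * Complex.exp (h θ)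

lemma IsWind.exists_of {c : Circle → ℂ} (hc : Continuous c) (h0 : ∀ θ, c θ ≠ 0) :
    ∃ a, IsWind c a := by
  -- lift on the line
  have hcont : Continuous fun t : ℝ => c (Circle.exp t) := by fun_prop
  obtain ⟨L, ⟨-, hL⟩, -⟩ := Complex.isCoveringMapOn_exp.existsUnique_continuousMap_lifts
    (f := (⟨fun t : ℝ => c (Circle.exp t), hcont⟩ : C(ℝ, ℂ))) (a₀ := 0)
    (e₀ := Complex.log (c (Circle.exp 0))) (by simp [Complex.exp_log (h0 1)])
    (fun x => by simpa using h0 _)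
  have hL' : ∀ t : ℝ, Complex.exp (L t) = c (Circle.exp t) := fun t => congrFun hL t
  have hper : ∀ t : ℝ, ∃ k : ℤ, L (t + 2 * Real.pi) - L t = 2 * Real.pi * Complex.I * k := by
    intro t
    have : Complex.exp (L (t + 2 * Real.pi)) = Complex.exp (L t) := by
      rw [hL', hL']; congr 1; exact Circle.periodic_exp t
    obtain ⟨k, hk⟩ := Complex.exp_eq_exp_iff_exists_int.1 this
    exact ⟨k, by rw [hk]; ring⟩
  choose k hk using hper
  have hkc : ∀ t, k t = k 0 := by
    have hc1 : Continuous fun t : ℝ => ((k t : ℤ) : ℝ) := by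
      have : (fun t : ℝ => ((k t : ℤ) : ℝ)) = fun t =>
          ((L (t + 2 * Real.pi) - L t) / (2 * Real.pi * Complex.I)).re := by
        funext t
        rw [hk]
        have : (2 * (Real.pi:ℂ) * Complex.I) ≠ 0 := by simp [Real.pi_ne_zero]
        rw [mul_div_cancel_left₀ _ this]; simp
      rw [this]
      have := L.continuous
      fun_prop
    have hc2 : Continuous k := by
      rw [Int.isClosedEmbedding_coe_real.isInducing.continuous_iff]; exact hc1
    intro t
    exact PreconnectedSpace.constant inferInstance hc2
  set a := k 0 with ha
  have hk' : ∀ t : ℝ, L (t + 2 * Real.pi) = L t + 2 * Real.pi * Complex.I * a := by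
    intro t; have := hk t; rw [hkc t] at this; rw [← this]; ring
  -- the corrected periodic function
  let H : ℝ → ℂ := fun t => L t - a * t * Complex.I
  have hHc : Continuous H := by have := L.continuous; fun_prop
  have hHper : Function.Periodic H (2 * Real.pi) := by
    intro t; simp only [H]; rw [hk' t]; push_cast; ring
  let h : Circle → ℂ := fun θ => H (Complex.arg θ)
  have hh : ∀ t : ℝ, h (Circle.exp t) = H t := by
    intro t
    have : Circle.exp (Complex.arg (Circle.exp t)) = Circle.exp t := Circle.exp_arg _
    obtain ⟨m, hm⟩ := Circle.exp_eq_exp.1 this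
    simp only [h]
    rw [hm]
    exact hHper.int_mul m t
  refine ⟨a, h, ?_, ?_⟩
  · have hq : IsOpenQuotientMap Circle.exp := by
      exact ⟨fun z => ⟨_, Circle.exp_arg z⟩, Circle.exp.continuous, Circle.isCoveringMap_exp.isLocalHomeomorph.isOpenMap⟩
    rw [hq.isQuotientMap.continuous_iff]
    have : h ∘ Circle.exp = H := funext hh
    rw [this]; exact hHc
  · intro θ
    obtain ⟨t, rfl⟩ : ∃ t, Circle.exp t = θ := ⟨_, Circle.exp_arg θ⟩
    rw [hh, ← hL', Circle.coe_exp, ← Complex.exp_int_mul, ← Complex.exp_add]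
    congr 1; simp only [H]; ring

lemma IsWind.zero_of {a : ℤ} {h : Circle → ℂ} (hc : Continuous h)
    (hh : ∀ θ : Circle, (θ : ℂ) ^ a = Complex.exp (h θ)) : a = 0 := by
  have hper : ∀ t : ℝ, ∃ k : ℤ, h (Circle.exp t) - a * t * Complex.I = 2 * Real.pi * Complex.I * k := by
    intro t
    have : Complex.exp (h (Circle.exp t)) = Complex.exp (a * t * Complex.I) := by
      rw [← hh, Circle.coe_exp, ← Complex.exp_int_mul]; congr 1; ring
    obtain ⟨k, hk⟩ := Complex.exp_eq_exp_iff_exists_int.1 this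
    exact ⟨k, by rw [hk]; ring⟩
  choose k hk using hper
  have hkc : ∀ t, k t = k 0 := by
    have hc1 : Continuous fun t : ℝ => ((k t : ℤ) : ℝ) := by
      have : (fun t : ℝ => ((k t : ℤ) : ℝ)) = fun t : ℝ =>
          ((h (Circle.exp t) - a * t * Complex.I) / (2 * Real.pi * Complex.I)).re := by
        funext t
        rw [hk]
        have : (2 * (Real.pi:ℂ) * Complex.I) ≠ 0 := by simp [Real.pi_ne_zero]
        rw [mul_div_cancel_left₀ _ this]; simp
      rw [this]
      fun_prop
    have hc2 : Continuous k := by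
      rw [Int.isClosedEmbedding_coe_real.isInducing.continuous_iff]; exact hc1
    intro t
    exact PreconnectedSpace.constant inferInstance hc2
  have h1 := hk (0 + 2 * Real.pi)
  have h2 := hk 0
  rw [hkc] at h1
  have h3 : Circle.exp (0 + 2 * Real.pi) = Circle.exp 0 := Circle.periodic_exp 0
  rw [h3] at h1
  have : (a : ℂ) * (2 * Real.pi * Complex.I) = 0 := by
    push_cast at h1 h2
    linear_combination h2 - h1
  have h4 : (2 * (Real.pi:ℂ) * Complex.I) ≠ 0 := by simp [Real.pi_ne_zero]
  have := (mul_eq_zero.1 this).resolve_right h4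
  exact_mod_cast this

lemma IsWind.unique {c : Circle → ℂ} {a b : ℤ} (ha : IsWind c a) (hb : IsWind c b) : a = b := by
  obtain ⟨h, hc, hh⟩ := ha
  obtain ⟨h', hc', hh'⟩ := hb
  have : a - b = 0 := by
    refine IsWind.zero_of (h := fun θ => h' θ - h θ) (by fun_prop) fun θ => ?_
    have h1 := hh θ
    rw [hh'] at h1
    rw [zpow_sub₀ (Circle.coe_ne_zero θ), Complex.exp_sub, div_eq_div_iff
      (zpow_ne_zero _ (Circle.coe_ne_zero θ)) (Complex.exp_ne_zero _), ← h1]; ring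
  omega

lemma IsWind.mul {c c' : Circle → ℂ} {a b : ℤ} (ha : IsWind c a) (hb : IsWind c' b) :
    IsWind (fun θ => c θ * c' θ) (a + b) := by
  obtain ⟨h, hc, hh⟩ := ha
  obtain ⟨h', hc', hh'⟩ := hb
  refine ⟨fun θ => h θ + h' θ, by fun_prop, fun θ => ?_⟩
  show c θ * c' θ = _
  rw [hh, hh', zpow_add₀ (Circle.coe_ne_zero θ), Complex.exp_add]; ring

lemma IsWind.inv {c : Circle → ℂ} {a : ℤ} (ha : IsWind c a) :
    IsWind (fun θ => (c θ)⁻¹) (-a) := by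
  obtain ⟨h, hc, hh⟩ := ha
  refine ⟨fun θ => - h θ, by fun_prop, fun θ => ?_⟩
  show (c θ)⁻¹ = _
  rw [hh, zpow_neg, Complex.exp_neg, mul_inv]

lemma IsWind.const {z : ℂ} (hz : z ≠ 0) : IsWind (fun _ => z) 0 :=
  ⟨fun _ => Complex.log z, continuous_const, fun θ => by simp [Complex.exp_log hz]⟩

lemma IsWind.id : IsWind (fun θ => (θ : ℂ)) 1 :=
  ⟨fun _ => 0, continuous_const, fun θ => by simp⟩

lemma IsWind.const_mul {z : ℂ} (hz : z ≠ 0) {c : Circle → ℂ} {a : ℤ} (ha : IsWind c a) :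
    IsWind (fun θ => z * c θ) a := by
  simpa using (IsWind.const hz).mul ha

lemma IsWind.prod {ι : Type*} (s : Finset ι) {c : ι → Circle → ℂ} {a : ι → ℤ}
    (ha : ∀ i ∈ s, IsWind (c i) (a i)) : IsWind (fun θ => ∏ i ∈ s, c i θ) (∑ i ∈ s, a i) := by
  classical
  induction s using Finset.induction_on with
  | empty => simpa using IsWind.const one_ne_zero
  | insert i s hi ih =>
    simp only [Finset.prod_insert hi, Finset.sum_insert hi]
    exact (ha i (by simp)).mul (ih fun j hj => ha j (by simp [hj]))

lemma IsWind.npow {c : Circle → ℂ} {a : ℤ} (ha : IsWind c a) (k : ℕ) :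
    IsWind (fun θ => c θ ^ k) (k * a) := by
  have := IsWind.prod (Finset.range k) (c := fun _ => c) (a := fun _ => a) (fun _ _ => ha)
  simpa using this

lemma IsWind.zpow {c : Circle → ℂ} {a : ℤ} (ha : IsWind c a) (k : ℤ) :
    IsWind (fun θ => c θ ^ k) (k * a) := by
  cases k with
  | ofNat k => simpa using ha.npow k
  | negSucc k =>
    have := (ha.npow (k+1)).inv
    simp only [zpow_negSucc]
    convert this using 1
    rw [Int.negSucc_eq]; push_cast; ring

lemma IsWind.comp_zpow {c : Circle → ℂ} {a : ℤ} (ha : IsWind c a) (b : ℤ) :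
    IsWind (fun θ => c (θ ^ b)) (b * a) := by
  obtain ⟨h, hc, hh⟩ := ha
  refine ⟨fun θ => h (θ ^ b), hc.comp (continuous_zpow b), fun θ => ?_⟩
  show c (θ ^ b) = _
  rw [hh, Circle.coe_zpow, zpow_mul]

lemma IsWind.ne_zero {c : Circle → ℂ} {a : ℤ} (ha : IsWind c a) (θ : Circle) : c θ ≠ 0 := by
  obtain ⟨h, hc, hh⟩ := ha
  rw [hh]; exact mul_ne_zero (zpow_ne_zero _ (Circle.coe_ne_zero θ)) (Complex.exp_ne_zero _)

lemma IsWind.continuous {c : Circle → ℂ} {a : ℤ} (ha : IsWind c a) : Continuous c := by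
  obtain ⟨h, hc, hh⟩ := ha
  rw [funext hh]
  refine Continuous.mul ?_ (by fun_prop)
  exact Continuous.zpow₀ (by fun_prop) _ fun θ => Or.inl (Circle.coe_ne_zero θ)

/-- closeness -/
lemma IsWind.of_close {c c' : Circle → ℂ} {a : ℤ} (ha : IsWind c a) (hc' : Continuous c')
    (hcl : ∀ θ, ‖c' θ - c θ‖ < ‖c θ‖) : IsWind c' a := by
  have h1 : ∀ θ, c' θ / c θ ∈ Complex.slitPlane := by
    intro θ
    have h0 := ha.ne_zero θ
    have : ‖c' θ / c θ - 1‖ < 1 := by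
      rw [div_sub_one h0, norm_div, div_lt_one (norm_pos_iff.2 h0)]; exact hcl θ
    left
    have h2 := Complex.abs_re_le_norm (c' θ / c θ - 1)
    have h3 := abs_lt.1 (h2.trans_lt this)
    simp at h3; linarith [h3.1]
  have hw : IsWind (fun θ => c' θ / c θ) 0 := by
    refine ⟨fun θ => Complex.log (c' θ / c θ), ?_, fun θ => ?_⟩
    · exact Continuous.clog (hc'.div ha.continuous ha.ne_zero) h1
    · simp only [zpow_zero, one_mul]
      rw [Complex.exp_log (Complex.slitPlane_ne_zero (h1 θ))]
  have := ha.mul hw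
  simp only [add_zero] at this
  convert this using 1
  funext θ
  rw [mul_div_cancel₀ _ (ha.ne_zero θ)]

lemma compact_ev {X Y : Type*} [TopologicalSpace Y] {l : Filter X} {K : Set Y} (hK : IsCompact K)
    {P : X → Y → Prop} (hP : ∀ y ∈ K, ∀ᶠ z : X × Y in l ×ˢ 𝓝 y, P z.1 z.2) :
    ∀ᶠ x in l, ∀ y ∈ K, P x y := by
  have : ∀ᶠ z : X × Y in l ×ˢ 𝓝ˢ K, P z.1 z.2 := hK.mem_prod_nhdsSet_of_forall hP
  exact this.curry.mono fun _ h => h.self_of_nhdsSet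

/-- local constancy -/
lemma IsWind.eventually {X : Type*} [TopologicalSpace X] {s : Set X} {F : X → Circle → ℂ}
    (hF : ContinuousOn (fun p : X × Circle => F p.1 p.2) (s ×ˢ Set.univ))
    {x : X} (hx : x ∈ s) {a : ℤ} (ha : IsWind (F x) a) : ∀ᶠ y in 𝓝[s] x, IsWind (F y) a := by
  have h0 : ∀ θ, 0 < ‖F x θ‖ := fun θ => norm_pos_iff.2 (ha.ne_zero θ)
  have hcx := ha.continuous
  have key : ∀ᶠ y in 𝓝[s] x, ∀ θ ∈ (Set.univ : Set Circle), ‖F y θ - F x θ‖ < ‖F x θ‖ := by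
    refine compact_ev isCompact_univ ?_
    intro θ _
    have h1 : Filter.Tendsto (fun p : X × Circle => ‖F p.1 p.2 - F x p.2‖ - ‖F x p.2‖)
        (𝓝[s] x ×ˢ 𝓝 θ) (𝓝 (‖F x θ - F x θ‖ - ‖F x θ‖)) := by
      have h2 : Filter.Tendsto (fun p : X × Circle => F p.1 p.2) (𝓝[s] x ×ˢ 𝓝 θ) (𝓝 (F x θ)) := by
        have := hF (x, θ) (by simp [hx])
        rw [ContinuousWithinAt, nhdsWithin_prod_eq, nhdsWithin_univ] at this
        exact this
      have h3 : Filter.Tendsto (fun p : X × Circle => F x p.2) (𝓝[s] x ×ˢ 𝓝 θ) (𝓝 (F x θ)) :=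
        (hcx.tendsto θ).comp Filter.tendsto_snd
      exact ((h2.sub h3).norm).sub h3.norm
    have h4 := h1.eventually (gt_mem_nhds (show ‖F x θ - F x θ‖ - ‖F x θ‖ < 0 by simpa using ha.ne_zero θ))
    filter_upwards [h4] with p hp
    linarith
  filter_upwards [key, self_mem_nhdsWithin] with y hy hys
  refine ha.of_close ?_ fun θ => hy θ trivial
  have : ContinuousOn (fun θ : Circle => ((y, θ) : X × Circle)) Set.univ := by fun_prop
  have := hF.comp this (fun θ _ => by simp [hys])
  exact continuousOn_univ.1 this

lemma IsWind.of_family {X : Type*} [TopologicalSpace X] {s : Set X} (hs : IsPreconnected s)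
    {F : X → Circle → ℂ}
    (hF : ContinuousOn (fun p : X × Circle => F p.1 p.2) (s ×ˢ Set.univ))
    (h0 : ∀ x ∈ s, ∀ θ, F x θ ≠ 0) {x y : X} (hx : x ∈ s) (hy : y ∈ s) {a : ℤ}
    (ha : IsWind (F x) a) : IsWind (F y) a := by
  classical
  have hex : ∀ z : X, z ∈ s → ∃ b, IsWind (F z) b := by
    intro z hz
    refine IsWind.exists_of ?_ (h0 z hz)
    have : ContinuousOn (fun θ : Circle => ((z, θ) : X × Circle)) Set.univ := by fun_prop
    exact continuousOn_univ.1 (hF.comp this (fun θ _ => by simp [hz]))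
  choose! w hw using hex
  have hcont : ContinuousOn w s := by
    intro z hz
    have := IsWind.eventually hF hz (hw z hz)
    refine Filter.Tendsto.congr' ?_ (tendsto_const_nhds (x := w z))
    filter_upwards [this, self_mem_nhdsWithin] with y h1 h2
    exact h1.unique (hw y h2)
  have := hs.constant hcont hx hy
  have h1 := (hw x hx).unique ha
  rw [← h1, this]; exact hw y hy

/-- filling the disc -/
lemma IsWind.zero_of_disc {R : ℝ} (hR : 0 ≤ R) {u : ℂ → ℂ} (hu : ContinuousOn u (Metric.closedBall 0 R))
    (h0 : ∀ z ∈ Metric.closedBall (0:ℂ) R, u z ≠ 0) : IsWind (fun θ : Circle => u (R * θ)) 0 := by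
  have hmem : ∀ τ ∈ Set.Icc (0:ℝ) 1, ∀ θ : Circle, ((τ * R : ℝ) : ℂ) * θ ∈ Metric.closedBall (0:ℂ) R := by
    intro τ hτ θ
    rw [mem_closedBall_zero_iff, norm_mul, Circle.norm_coe, mul_one, Complex.norm_real,
      Real.norm_of_nonneg (mul_nonneg hτ.1 hR)]
    nlinarith [hτ.2]
  have := IsWind.of_family (isPreconnected_Icc (a := (0:ℝ)) (b := 1))
    (F := fun τ θ => u (((τ * R : ℝ) : ℂ) * θ)) (x := 0) (y := 1) (a := 0) ?_ ?_ (by simp) (by simp) ?_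
  · simpa using this
  · refine hu.comp (by fun_prop) ?_
    rintro ⟨τ, θ⟩ ⟨hτ, -⟩
    exact hmem τ hτ θ
  · intro τ hτ θ; exact h0 _ (hmem τ hτ θ)
  · simp only [zero_mul, Complex.ofReal_zero]
    exact IsWind.const (h0 0 (by simpa using hR))


def Ind1 (v : ℂ → ℂ) (s : ℂ) (a : ℤ) : Prop :=
  ∀ᶠ r : ℝ in 𝓝[>] 0, IsWind (fun θ : Circle => v (s + r * θ)) a

lemma Ind1.unique {v : ℂ → ℂ} {s : ℂ} {a b : ℤ} (ha : Ind1 v s a) (hb : Ind1 v s b) : a = b := by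
  obtain ⟨r, h1, h2⟩ := (ha.and hb).exists
  exact h1.unique h2

lemma Ind1.mul {v w : ℂ → ℂ} {s : ℂ} {a b : ℤ} (ha : Ind1 v s a) (hb : Ind1 w s b) :
    Ind1 (fun z => v z * w z) s (a + b) := by
  filter_upwards [ha, hb] with r h1 h2 using h1.mul h2

lemma Ind1.prod {ι : Type*} (T : Finset ι) {v : ι → ℂ → ℂ} {s : ℂ} {a : ι → ℤ}
    (ha : ∀ i ∈ T, Ind1 (v i) s (a i)) : Ind1 (fun z => ∏ i ∈ T, v i z) s (∑ i ∈ T, a i) := by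
  have : ∀ᶠ r : ℝ in 𝓝[>] 0, ∀ i ∈ T, IsWind (fun θ : Circle => v i (s + r * θ)) (a i) := by
    rw [Finset.eventually_all]; exact ha
  filter_upwards [this] with r h1 using IsWind.prod T h1

lemma Ind1.zpow {v : ℂ → ℂ} {s : ℂ} {a : ℤ} (ha : Ind1 v s a) (k : ℤ) :
    Ind1 (fun z => v z ^ k) s (k * a) := by
  filter_upwards [ha] with r h1 using h1.zpow k

lemma Ind1.npow {v : ℂ → ℂ} {s : ℂ} {a : ℤ} (ha : Ind1 v s a) (k : ℕ) :
    Ind1 (fun z => v z ^ k) s (k * a) := by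
  filter_upwards [ha] with r h1 using h1.npow k

lemma ev_circle {s : ℂ} {p : ℂ → Prop} (h : ∀ᶠ z in 𝓝 s, p z) :
    ∀ᶠ r : ℝ in 𝓝[>] 0, ∀ z ∈ Metric.closedBall s r, p z := by
  obtain ⟨ε, hε, h⟩ := Metric.eventually_nhds_iff_ball.1 h
  have : Set.Ioo (0:ℝ) ε ∈ 𝓝[>] (0:ℝ) := Ioo_mem_nhdsGT hε
  filter_upwards [this] with r hr z hz
  exact h z (Metric.closedBall_subset_ball hr.2 hz)

lemma circle_mem {s : ℂ} {r : ℝ} (hr : 0 ≤ r) (θ : Circle) : s + r * θ ∈ Metric.closedBall s r := by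
  simp [abs_of_nonneg hr, Circle.norm_coe]

lemma Ind1.congr {v w : ℂ → ℂ} {s : ℂ} {a : ℤ} (ha : Ind1 v s a) (h : ∀ᶠ z in 𝓝[≠] s, v z = w z) :
    Ind1 w s a := by
  rw [eventually_nhdsWithin_iff] at h
  filter_upwards [ha, ev_circle h, self_mem_nhdsWithin] with r h1 h2 h3
  have h3' : 0 < r := h3
  convert h1 using 1
  funext θ
  refine (h2 _ (circle_mem h3'.le θ) ?_).symm
  simp [h3'.ne']

lemma Ind1.of_ne {v : ℂ → ℂ} {s : ℂ} (hv : ∀ᶠ z in 𝓝 s, ContinuousAt v z) (h0 : v s ≠ 0) :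
    Ind1 v s 0 := by
  have h1 : ∀ᶠ z in 𝓝 s, v z ≠ 0 := hv.self_of_nhds.eventually_ne h0
  filter_upwards [ev_circle (hv.and h1), self_mem_nhdsWithin] with r h2 h3
  have h3' : 0 < r := h3
  have hm : ∀ z ∈ Metric.closedBall (0:ℂ) r, s + z ∈ Metric.closedBall s r := by
    intro z hz; simpa using hz
  refine IsWind.zero_of_disc (R := r) (u := fun z => v (s + z)) h3'.le ?_ ?_
  · intro z hz
    have := (h2 _ (hm z hz)).1
    exact (ContinuousAt.comp (f := fun z => s + z) this (by fun_prop)).continuousWithinAt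
  · intro z hz; exact (h2 _ (hm z hz)).2

lemma Ind1.sub (s : ℂ) : Ind1 (fun z => z - s) s 1 := by
  filter_upwards [self_mem_nhdsWithin] with r hr
  have hr' : 0 < r := hr
  have := IsWind.id.const_mul (z := (r:ℂ)) (by exact_mod_cast hr'.ne')
  simpa using this

lemma residue_zero {R : ℝ} (hR : 0 < R) (T : Finset ℂ) (u : ℂ → ℂ)
    (hT : ∀ s ∈ T, s ∈ Metric.ball (0:ℂ) R)
    (hu : ContinuousOn u (Metric.closedBall 0 R \ T))
    (h0 : ∀ z ∈ Metric.closedBall (0:ℂ) R \ T, u z ≠ 0)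
    (ha : ∀ s ∈ T, Ind1 u s 0) : IsWind (fun θ : Circle => u (R * θ)) 0 := by
  classical
  induction T using Finset.induction_on generalizing u with
  | empty =>
    refine IsWind.zero_of_disc hR.le (by simpa using hu) (by simpa using h0)
  | insert s T hs ih =>
    -- choose small radius
    have e1 : ∀ᶠ z in 𝓝 s, z ∈ Metric.ball (0:ℂ) R := Metric.isOpen_ball.mem_nhds (hT s (by simp))
    have e2 : ∀ᶠ z in 𝓝 s, z ∉ T := T.finite_toSet.isClosed.isOpen_compl.mem_nhds (by simpa using hs)
    obtain ⟨r, ⟨hr1, hr2⟩, hr3⟩ := ((((ha s (by simp)).and (ev_circle (e1.and e2))).and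
      self_mem_nhdsWithin)).exists
    have hr : 0 < r := hr3
    obtain ⟨h, hc, hh⟩ := hr1
    simp only [zpow_zero, one_mul] at hh
    -- the radial extension
    have hcirc : ∀ w : ℂ, w ≠ 0 → w / ‖w‖ ∈ Submonoid.unitSphere ℂ := by
      intro w hw
      simp [Submonoid.unitSphere, hw]
    let g : ℂ → Circle := fun w => if hw : w = 0 then 1 else ⟨w / ‖w‖, hcirc w hw⟩
    have hgc : ContinuousOn g {0}ᶜ := by
      rw [(show Topology.IsInducing (fun z : Circle => (z : ℂ)) from ⟨rfl⟩).continuousOn_iff]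
      have : ContinuousOn (fun w : ℂ => w / (‖w‖ : ℂ)) {0}ᶜ := by
        refine ContinuousOn.div (by fun_prop) (by fun_prop) fun w hw => by simpa using hw
      refine this.congr fun w hw => ?_
      have hw' : w ≠ 0 := hw
      simp [g, hw']
    let Hf : ℂ → ℂ := fun w => ‖w‖ * h (g w)
    obtain ⟨M, hM⟩ : ∃ M, ∀ θ, ‖h θ‖ ≤ M := by
      obtain ⟨M, hM⟩ := (isCompact_range hc).isBounded.exists_norm_le
      exact ⟨M, fun θ => hM _ ⟨θ, rfl⟩⟩
    have hHc : Continuous Hf := by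
      rw [continuous_iff_continuousAt]
      intro w
      by_cases hw : w = 0
      · subst hw
        have h0' : Hf 0 = 0 := by simp [Hf]
        rw [ContinuousAt, h0']
        refine squeeze_zero_norm (a := fun w => ‖w‖ * M) (fun w => ?_) ?_
        · simp only [Hf, norm_mul, Complex.norm_real, norm_norm]
          exact mul_le_mul_of_nonneg_left (hM _) (norm_nonneg _)
        · have : Continuous fun w : ℂ => ‖w‖ * M := by fun_prop
          simpa using this.tendsto 0
      · have : ContinuousAt g w := hgc.continuousAt (isOpen_compl_singleton.mem_nhds hw)
        have h2 : ContinuousAt (fun w => h (g w)) w := hc.continuousAt.comp this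
        exact ContinuousAt.mul (by fun_prop) h2
    let u' : ℂ → ℂ := fun z => if z ∈ Metric.closedBall s r then Complex.exp (Hf ((z - s) / r)) else u z
    have hbd : ∀ z, ‖z - s‖ = r → u z = Complex.exp (Hf ((z - s) / r)) := by
      intro z hz
      have hne : (z - s) / r ≠ 0 := by
        intro h
        have h3 : ‖(z - s) / r‖ = 1 := by simp [hz, abs_of_pos hr, hr.ne']
        rw [h] at h3; simp at h3
      have hn : ‖(z - s) / r‖ = 1 := by simp [hz, abs_of_pos hr, hr.ne']
      have hgz : ((g ((z - s) / r) : Circle) : ℂ) = (z - s) / r := by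
        rw [show g ((z - s) / r) = ⟨_, hcirc _ hne⟩ from dif_neg hne]
        show (z - s) / r / (‖(z - s) / r‖ : ℂ) = _
        rw [hn]; simp
      have := hh (g ((z - s) / r))
      rw [hgz] at this
      have hrc : (r:ℂ) ≠ 0 := by exact_mod_cast hr.ne'
      rw [mul_div_cancel₀ _ hrc, add_sub_cancel] at this
      rw [this]; simp only [Hf]; rw [hn]; simp
    have hu'out : ∀ z, r ≤ ‖z - s‖ → u' z = u z := by
      intro z hz
      by_cases hz' : ‖z - s‖ = r
      · simp [u', dist_eq_norm, hz', hbd z hz']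
      · have : ¬ ‖z - s‖ ≤ r := fun h => hz' (le_antisymm h hz)
        simp [u', dist_eq_norm, this]
    have hball : ∀ θ : Circle, r ≤ ‖(R:ℂ) * θ - s‖ := by
      intro θ
      by_contra hlt
      push Not at hlt
      have := (hr2 ((R:ℂ) * θ) (by simpa [dist_eq_norm] using hlt.le)).1
      simp [abs_of_pos hR, Circle.norm_coe] at this
    have key := ih u' (fun t ht => hT t (by simp [ht])) ?_ ?_ ?_
    · have : (fun θ : Circle => u' (R * θ)) = fun θ : Circle => u (R * θ) :=
        funext fun θ => hu'out _ (hball θ)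
      rwa [this] at key
    · -- continuity
      have hset : Metric.closedBall (0:ℂ) R \ (T : Set ℂ) ⊆
          Metric.closedBall s r ∪ ((Metric.closedBall (0:ℂ) R \ (T : Set ℂ)) ∩ {z | r ≤ ‖z - s‖}) := by
        intro z hz
        rcases le_total ‖z - s‖ r with h1 | h1
        · left; simpa [dist_eq_norm] using h1
        · right; exact ⟨hz, h1⟩
      have c1 : ContinuousOn u' (Metric.closedBall s r) := by
        have : ContinuousOn (fun z => Complex.exp (Hf ((z - s) / r))) (Metric.closedBall s r) := by
          fun_prop
        refine this.congr fun z hz => ?_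
        simp only [u', if_pos hz]
      have c2 : ContinuousOn u' ((Metric.closedBall (0:ℂ) R \ (T : Set ℂ)) ∩ {z | r ≤ ‖z - s‖}) := by
        refine ContinuousOn.congr (hu.mono ?_) fun z hz => hu'out z hz.2
        rintro z ⟨⟨hz1, hz2⟩, hz3⟩
        refine ⟨hz1, ?_⟩
        simp only [Finset.coe_insert, Set.mem_insert_iff, not_or]
        refine ⟨?_, hz2⟩
        rintro rfl
        simp at hz3; linarith
      intro z hz
      have hcl1 : IsClosed (Metric.closedBall s r) := Metric.isClosed_closedBall
      have hcl2 : IsClosed {z : ℂ | r ≤ ‖z - s‖} := isClosed_le (by fun_prop) (by fun_prop)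
      have w1 : ContinuousWithinAt u' (Metric.closedBall s r) z := by
        by_cases h : z ∈ Metric.closedBall s r
        · exact c1 z h
        · have : 𝓝[Metric.closedBall s r] z = ⊥ := by
            rw [← notMem_closure_iff_nhdsWithin_eq_bot, hcl1.closure_eq]; exact h
          simp [ContinuousWithinAt, this]
      have w2 : ContinuousWithinAt u' ((Metric.closedBall (0:ℂ) R \ (T : Set ℂ)) ∩ {z | r ≤ ‖z - s‖}) z := by
        by_cases h : z ∈ {z : ℂ | r ≤ ‖z - s‖}
        · exact c2 z ⟨hz, h⟩
        · have : 𝓝[{z : ℂ | r ≤ ‖z - s‖}] z = ⊥ := by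
            rw [← notMem_closure_iff_nhdsWithin_eq_bot, hcl2.closure_eq]; exact h
          have h5 : 𝓝[(Metric.closedBall (0:ℂ) R \ (T : Set ℂ)) ∩ {z | r ≤ ‖z - s‖}] z = ⊥ :=
            le_bot_iff.1 (this ▸ nhdsWithin_mono z Set.inter_subset_right)
          simp [ContinuousWithinAt, h5]
      exact (w1.union w2).mono hset
    · intro z hz
      by_cases h : z ∈ Metric.closedBall s r
      · simp only [u', if_pos h]; exact Complex.exp_ne_zero _
      · simp only [u', if_neg h]
        refine h0 z ⟨hz.1, ?_⟩
        simp only [Finset.coe_insert, Set.mem_insert_iff, not_or]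
        refine ⟨?_, hz.2⟩
        rintro rfl
        exact h (by simp [hr.le])
    · intro t ht
      refine (ha t (by simp [ht])).congr ?_
      have : t ∉ Metric.closedBall s r := fun h => (hr2 t h).2 ht
      have h6 : ∀ᶠ z in 𝓝 t, z ∉ Metric.closedBall s r :=
        Metric.isClosed_closedBall.isOpen_compl.mem_nhds this
      filter_upwards [h6.filter_mono nhdsWithin_le_nhds] with z hz
      simp only [u', if_neg hz]

lemma residue {R : ℝ} (hR : 0 < R) (T : Finset ℂ) (u : ℂ → ℂ)
    (hT : ∀ s ∈ T, s ∈ Metric.ball (0:ℂ) R)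
    (hu : ContinuousOn u (Metric.closedBall 0 R \ T))
    (h0 : ∀ z ∈ Metric.closedBall (0:ℂ) R \ T, u z ≠ 0) (a : ℂ → ℤ)
    (ha : ∀ s ∈ T, Ind1 u s (a s)) : IsWind (fun θ : Circle => u (R * θ)) (∑ s ∈ T, a s) := by
  classical
  have hsub : ∀ s t : ℂ, t ≠ s → Ind1 (fun z => z - s) t 0 := fun s t hts =>
    Ind1.of_ne (Filter.Eventually.of_forall fun z => by fun_prop) (sub_ne_zero.2 hts)
  have hbd : ∀ s ∈ T, IsWind (fun θ : Circle => (R:ℂ) * θ - s) 1 := by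
    intro s hs
    have h1 := IsWind.id.const_mul (z := (R:ℂ)) (by exact_mod_cast hR.ne')
    refine h1.of_close (by fun_prop) fun θ => ?_
    have := hT s hs
    simpa [abs_of_pos hR, Circle.norm_coe] using this
  have h1 : IsWind (fun θ : Circle => u (R * θ) * ∏ s ∈ T, ((R:ℂ) * θ - s) ^ (-(a s))) 0 := by
    refine residue_zero hR T (fun z => u z * ∏ s ∈ T, (z - s) ^ (-(a s))) hT ?_ ?_ ?_
    · refine hu.mul (continuousOn_finsetProd _ fun s hs => ?_)
      refine ContinuousOn.zpow₀ (by fun_prop) _ fun z hz => Or.inl ?_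
      rw [sub_ne_zero]; rintro rfl; exact hz.2 hs
    · intro z hz
      refine mul_ne_zero (h0 z hz) (Finset.prod_ne_zero_iff.2 fun s hs => zpow_ne_zero _ ?_)
      rw [sub_ne_zero]; rintro rfl; exact hz.2 hs
    · intro s hs
      have h2 : Ind1 (fun z => ∏ t ∈ T, (z - t) ^ (-(a t))) s (∑ t ∈ T, if t = s then -(a s) else 0) := by
        refine Ind1.prod T fun t _ => ?_
        split_ifs with h
        · subst h; simpa using (Ind1.sub t).zpow (-(a t))
        · simpa using (hsub t s (Ne.symm h)).zpow (-(a t))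
      have := (ha s hs).mul h2
      simpa [Finset.sum_ite_eq', hs] using this
  have h2 : IsWind (fun θ : Circle => ∏ s ∈ T, ((R:ℂ) * θ - s) ^ (a s)) (∑ s ∈ T, a s) := by
    refine IsWind.prod T fun s hs => ?_
    simpa using (hbd s hs).zpow (a s)
  have h3 := h1.mul h2
  rw [zero_add] at h3
  convert h3 using 1
  funext θ
  rw [mul_assoc, ← Finset.prod_mul_distrib, Finset.prod_eq_one, mul_one]
  intro s hs
  rw [zpow_neg, inv_mul_cancel₀ (zpow_ne_zero _ ((hbd s hs).ne_zero θ))]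

lemma Ind1.of_analytic {v : ℂ → ℂ} {s : ℂ} (hv : AnalyticAt ℂ v s) (h0 : v s = 0)
    (hne : ¬ ∀ᶠ z in 𝓝 s, v z = 0) : ∃ k : ℤ, 1 ≤ k ∧ Ind1 v s k ∧ (deriv v s ≠ 0 → k = 1) := by
  obtain ⟨k, g, hg, hg0, hgv⟩ := (hv.exists_eventuallyEq_pow_smul_nonzero_iff).2 hne
  have hk : k ≠ 0 := by
    rintro rfl
    have := hgv.self_of_nhds
    simp [h0] at this
    exact hg0 this.symm
  refine ⟨k, by omega, ?_, ?_⟩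
  · have h1 := ((Ind1.sub s).npow k).mul (Ind1.of_ne
      (hg.eventually_analyticAt.mono fun z hz => hz.continuousAt) hg0)
    simp only [mul_one, add_zero] at h1
    refine h1.congr ?_
    filter_upwards [hgv.filter_mono nhdsWithin_le_nhds] with z hz
    rw [hz]; simp
  · intro hd
    by_contra hk1
    apply hd
    have hk2 : k ≠ 1 := fun h => hk1 (by exact_mod_cast h)
    rw [Filter.EventuallyEq.deriv_eq hgv]
    obtain ⟨j, rfl⟩ : ∃ j, k = j + 2 := ⟨k - 2, by omega⟩
    have h2 : HasDerivAt (fun z => (z - s) ^ (j+2) • g z) (((s - s) ^ (j+2)) • deriv g s +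
        ((j+2 : ℕ) * (s - s) ^ (j+2-1) * 1) • g s) s := by
      exact ((((hasDerivAt_id s).sub_const s).pow (j+2)).smul hg.differentiableAt.hasDerivAt)
    rw [h2.deriv]; simp

lemma holo_count {R : ℝ} (hR : 0 < R) {v : ℂ → ℂ} (hv : AnalyticOnNhd ℂ v (Metric.closedBall 0 R))
    (hb : ∀ θ : Circle, v (R * θ) ≠ 0) : ∃ (T : Finset ℂ) (μ : ℂ → ℤ),
      (∀ s, s ∈ T ↔ s ∈ Metric.ball (0:ℂ) R ∧ v s = 0) ∧ (∀ s ∈ T, 1 ≤ μ s ∧ Ind1 v s (μ s)) ∧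
      IsWind (fun θ : Circle => v (R * θ)) (∑ s ∈ T, μ s) := by
  classical
  have hnb : ∀ z ∈ Metric.closedBall (0:ℂ) R, v z = 0 → z ∈ Metric.ball (0:ℂ) R := by
    intro z hz hvz
    by_contra hz'
    have hn : ‖z‖ = R := le_antisymm (by simpa using hz) (by simpa using hz')
    have hR' : (R:ℂ) ≠ 0 := by exact_mod_cast hR.ne'
    have := hb ⟨z / R, by simp [Submonoid.unitSphere, hn, abs_of_pos hR, hR.ne']⟩
    apply this
    show v (R * (z / R)) = 0
    rw [mul_div_cancel₀ _ hR', hvz]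
  have hiso : ∀ z ∈ Metric.closedBall (0:ℂ) R, ¬ ∃ᶠ w in 𝓝[≠] z, v w = 0 := by
    intro z hz hf
    have := hv.eqOn_zero_of_preconnected_of_frequently_eq_zero
      (convex_closedBall (0:ℂ) R).isPreconnected hz hf
    refine hb 1 (this ?_)
    simp [abs_of_pos hR]
  have hfin : (Metric.closedBall (0:ℂ) R ∩ {z | v z = 0}).Finite := by
    by_contra hinf
    obtain ⟨z, hz, hacc⟩ := Set.Infinite.exists_accPt_of_subset_isCompact hinf
      (isCompact_closedBall (0:ℂ) R) Set.inter_subset_left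
    refine hiso z hz ?_
    rw [accPt_iff_frequently_nhdsNE] at hacc
    exact hacc.mono fun w hw => hw.2
  have hind : ∀ s, s ∈ hfin.toFinset → ∃ k : ℤ, 1 ≤ k ∧ Ind1 v s k := by
    intro s hs
    simp only [Set.Finite.mem_toFinset] at hs
    obtain ⟨k, h1, h2, -⟩ := Ind1.of_analytic (hv s hs.1) hs.2 (fun h => hiso s hs.1
      (h.filter_mono nhdsWithin_le_nhds).frequently)
    exact ⟨k, h1, h2⟩
  choose! μ hμ using hind
  refine ⟨hfin.toFinset, μ, ?_, hμ, ?_⟩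
  · intro s
    simp only [Set.Finite.mem_toFinset]
    exact ⟨fun h => ⟨hnb s h.1 h.2, h.2⟩, fun h => ⟨Metric.ball_subset_closedBall h.1, h.2⟩⟩
  · refine residue hR _ v ?_ ?_ ?_ μ fun s hs => (hμ s hs).2
    · intro s hs
      simp only [Set.Finite.mem_toFinset] at hs
      exact hnb s hs.1 hs.2
    · exact hv.continuousOn.mono Set.sdiff_subset
    · intro z hz h
      exact hz.2 (by simpa using ⟨by simpa using hz.1, h⟩)


section charts
variable {E : Type*} [NormedAddCommGroup E] [NormedSpace ℂ E]

def IndAt (u : E → ℂ) (q e : E) (a : ℤ) : Prop := Ind1 (fun s : ℂ => u (q + s • e)) 0 a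

lemma IndAt.iff {u : E → ℂ} {q e : E} {a : ℤ} : IndAt u q e a ↔
    ∀ᶠ r : ℝ in 𝓝[>] 0, IsWind (fun θ : Circle => u (q + ((r:ℂ) * θ) • e)) a := by
  simp [IndAt, Ind1]

lemma IndAt.unique {u : E → ℂ} {q e : E} {a b : ℤ} (ha : IndAt u q e a) (hb : IndAt u q e b) :
    a = b := Ind1.unique ha hb

structure Chart (Z : Set E) (q e : E) (ζ : E → ℂ) (δ : ℝ) : Prop where
  pos : 0 < δ
  mem : q ∈ Z
  cont : ContinuousOn ζ (Metric.ball q δ)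
  zero : ∀ x ∈ Metric.ball q δ, (x ∈ Z ↔ ζ x = 0)
  trans : ∀ x ∈ Metric.ball q δ, ∀ t : ℂ, x + t • e ∈ Metric.ball q δ → ζ (x + t • e) = ζ x + t

variable {Z : Set E} {q e : E} {ζ : E → ℂ} {δ : ℝ}

lemma ev_line (q e : E) {N : Set E} (hN : N ∈ 𝓝 q) :
    ∀ᶠ r : ℝ in 𝓝[>] 0, ∀ s ∈ Metric.closedBall (0:ℂ) r, q + s • e ∈ N := by
  refine ev_circle (s := 0) (p := fun s => q + s • e ∈ N) ?_
  have : Continuous fun s : ℂ => q + s • e := by fun_prop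
  exact this.continuousAt.preimage_mem_nhds (by simpa using hN)

lemma circle_mem0 {r : ℝ} (hr : 0 ≤ r) (θ : Circle) : (r:ℂ) * θ ∈ Metric.closedBall (0:ℂ) r := by
  simpa using circle_mem (s := 0) hr θ

lemma Chart.meridian (hC : Chart Z q e ζ δ) {N : Set E} (hN : IsOpen N)
    (hNδ : N ⊆ Metric.ball q δ) {q' : E} (hq' : q' ∈ N) (hqZ : q' ∈ Z) :
    ∀ᶠ r : ℝ in 𝓝[>] 0, (∀ θ : Circle, q' + ((r:ℂ) * θ) • e ∈ N \ Z) ∧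
      IsWind (fun θ : Circle => ζ (q' + ((r:ℂ) * θ) • e)) 1 := by
  filter_upwards [ev_line q' e (hN.mem_nhds hq'), self_mem_nhdsWithin] with r h1 h2
  have hr : 0 < r := h2
  have hm : ∀ θ : Circle, q' + ((r:ℂ) * θ) • e ∈ N := fun θ => h1 _ (circle_mem0 hr.le θ)
  have hz : ∀ θ : Circle, ζ (q' + ((r:ℂ) * θ) • e) = r * θ := by
    intro θ
    rw [hC.trans q' (hNδ hq') _ (hNδ (hm θ)), (hC.zero q' (hNδ hq')).1 hqZ, zero_add]
  refine ⟨fun θ => ⟨hm θ, fun h => ?_⟩, ?_⟩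
  · rw [hC.zero _ (hNδ (hm θ)), hz] at h
    simp [hr.ne'] at h
  · have := IsWind.id.const_mul (z := (r:ℂ)) (by exact_mod_cast hr.ne')
    rwa [show (fun θ : Circle => ζ (q' + ((r:ℂ) * θ) • e)) = fun θ : Circle => (r:ℂ) * θ from funext hz]

lemma Chart.loops (hC : Chart Z q e ζ δ) {N0 : Set E} (hN0 : N0 ∈ 𝓝 q) :
    ∃ N : Set E, IsOpen N ∧ q ∈ N ∧ N ⊆ N0 ∧ N ⊆ Metric.ball q δ ∧
      ∀ u : E → ℂ, ContinuousOn u (N0 \ Z) → (∀ x ∈ N0 \ Z, u x ≠ 0) →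
      ∃ a : ℤ, ∀ γ : Circle → E, Continuous γ → (∀ θ, γ θ ∈ N \ Z) →
        ∀ b : ℤ, IsWind (fun θ => ζ (γ θ)) b → IsWind (fun θ => u (γ θ)) (b * a) := by
  obtain ⟨δ0, hδ0, hb0⟩ := Metric.mem_nhds_iff.1 hN0
  set δ1 := min δ0 δ with hδ1
  have hδ1p : 0 < δ1 := lt_min hδ0 hC.pos
  have hb1 : Metric.ball q δ1 ⊆ N0 := (Metric.ball_subset_ball (min_le_left _ _)).trans hb0
  have hb1' : Metric.ball q δ1 ⊆ Metric.ball q δ := Metric.ball_subset_ball (min_le_right _ _)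
  have hζq : ζ q = 0 := (hC.zero q (Metric.mem_ball_self hC.pos)).1 hC.mem
  obtain ⟨ρ, hρ, hρe⟩ : ∃ ρ > 0, 2 * ρ * ‖e‖ < δ1 / 2 := by
    refine ⟨δ1 / (8 * (‖e‖ + 1)), by positivity, ?_⟩
    have : 0 < ‖e‖ + 1 := by positivity
    rw [show 2 * (δ1 / (8 * (‖e‖ + 1))) * ‖e‖ = (δ1 / 4) * (‖e‖ / (‖e‖ + 1)) by field_simp; ring]
    have h1 : ‖e‖ / (‖e‖ + 1) ≤ 1 := by rw [div_le_one this]; linarith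
    nlinarith
  obtain ⟨δ2, hδ2p, hδ2, hζ2⟩ : ∃ δ2 > 0, δ2 ≤ δ1 / 2 ∧ ∀ x ∈ Metric.ball q δ2, ‖ζ x‖ < ρ := by
    have hca : ContinuousAt ζ q := hC.cont.continuousAt (Metric.ball_mem_nhds _ hC.pos)
    have : ∀ᶠ x in 𝓝 q, ‖ζ x‖ < ρ := by
      have := hca.norm.eventually_lt (continuousAt_const (y := ρ)) (by simpa [hζq] using hρ)
      exact this
    obtain ⟨ε, hε, h⟩ := Metric.eventually_nhds_iff_ball.1 this
    exact ⟨min ε (δ1/2), by positivity, min_le_right _ _, fun x hx =>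
      h x (Metric.ball_subset_ball (min_le_left _ _) hx)⟩
  have hb2 : Metric.ball q δ2 ⊆ Metric.ball q δ1 := Metric.ball_subset_ball (by linarith)
  have hX : ∀ P ∈ Metric.ball q δ2, ∀ w : ℂ, ‖w‖ ≤ ρ → w ≠ 0 →
      P + (w - ζ P) • e ∈ Metric.ball q δ1 \ Z := by
    intro P hP w hw hw0
    have h1 : P + (w - ζ P) • e ∈ Metric.ball q δ1 := by
      rw [Metric.mem_ball, dist_eq_norm] at hP ⊢
      have h2 : ‖(w - ζ P) • e‖ ≤ 2 * ρ * ‖e‖ := by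
        rw [norm_smul]
        refine mul_le_mul_of_nonneg_right ?_ (norm_nonneg _)
        have h3 := hζ2 P (by rwa [Metric.mem_ball, dist_eq_norm])
        have := norm_sub_le w (ζ P)
        linarith
      calc ‖P + (w - ζ P) • e - q‖ = ‖(P - q) + (w - ζ P) • e‖ := by congr 1; abel
        _ ≤ ‖P - q‖ + ‖(w - ζ P) • e‖ := norm_add_le _ _
        _ < δ1 := by linarith
    refine ⟨h1, fun h => ?_⟩
    rw [hC.zero _ (hb1' h1), hC.trans P (hb1' (hb2 hP)) _ (hb1' h1)] at h
    exact hw0 (by simpa using h)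
  refine ⟨Metric.ball q δ2, Metric.isOpen_ball, Metric.mem_ball_self hδ2p, hb2.trans hb1,
    hb2.trans hb1', fun u hu hu0 => ?_⟩
  have hsub : Metric.ball q δ1 \ Z ⊆ N0 \ Z := Set.sdiff_subset_sdiff_left hb1
  have hqm : ∀ θ : Circle, q + ((ρ:ℂ) * θ) • e ∈ N0 \ Z := by
    intro θ
    have := hX q (Metric.mem_ball_self hδ2p) (ρ * θ) (by simp [Circle.norm_coe, abs_of_pos hρ])
      (by simp [hρ.ne'])
    rw [hζq, sub_zero] at this
    exact hsub this
  obtain ⟨a, ha⟩ : ∃ a, IsWind (fun θ : Circle => u (q + ((ρ:ℂ) * θ) • e)) a := by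
    refine IsWind.exists_of ?_ fun θ => hu0 _ (hqm θ)
    exact hu.comp_continuous (by fun_prop) hqm
  refine ⟨a, fun γ hγ hγN b hb => ?_⟩
  obtain ⟨h, hhc, hh⟩ := hb
  replace hh : ∀ θ : Circle, ζ (γ θ) = (θ:ℂ) ^ b * Complex.exp (h θ) := hh
  let W : ℝ → Circle → ℂ := fun τ θ =>
    (θ:ℂ) ^ b * Complex.exp (τ * h θ + (1 - τ) * Real.log ρ)
  let P : ℝ → Circle → E := fun τ θ => q + (τ:ℂ) • (γ θ - q)
  let Xf : ℝ → Circle → E := fun τ θ => P τ θ + (W τ θ - ζ (P τ θ)) • e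
  have hW0 : ∀ τ θ, W τ θ ≠ 0 := fun τ θ =>
    mul_ne_zero (zpow_ne_zero _ (Circle.coe_ne_zero θ)) (Complex.exp_ne_zero _)
  have hWn : ∀ τ ∈ Set.Icc (0:ℝ) 1, ∀ θ, ‖W τ θ‖ ≤ ρ := by
    intro τ hτ θ
    have h1 : ‖W τ θ‖ = Real.exp (τ * (h θ).re + (1 - τ) * Real.log ρ) := by
      simp only [W]
      rw [norm_mul, norm_zpow, Circle.norm_coe, one_zpow, one_mul, Complex.norm_exp]
      congr 1
      simp [Complex.add_re, Complex.mul_re]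
    have h2 : (h θ).re ≤ Real.log ρ := by
      have h3 := hζ2 (γ θ) (hγN θ).1
      rw [hh θ, norm_mul, norm_zpow, Circle.norm_coe, one_zpow, one_mul, Complex.norm_exp] at h3
      exact ((Real.lt_log_iff_exp_lt hρ).2 h3).le
    rw [h1, ← Real.le_log_iff_exp_le hρ]
    nlinarith [hτ.1, hτ.2]
  have hPm : ∀ τ ∈ Set.Icc (0:ℝ) 1, ∀ θ, P τ θ ∈ Metric.ball q δ2 := by
    intro τ hτ θ
    have h1 := (hγN θ).1
    rw [Metric.mem_ball, dist_eq_norm] at h1 ⊢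
    simp only [P, add_sub_cancel_left, norm_smul, Complex.norm_real, Real.norm_of_nonneg hτ.1]
    nlinarith [hτ.2, norm_nonneg (γ θ - q)]
  have hXm : ∀ τ ∈ Set.Icc (0:ℝ) 1, ∀ θ, Xf τ θ ∈ N0 \ Z := fun τ hτ θ =>
    hsub (hX _ (hPm τ hτ θ) _ (hWn τ hτ θ) (hW0 τ θ))
  have hPc : Continuous fun p : ℝ × Circle => P p.1 p.2 := by
    simp only [P]
    have : Continuous fun p : ℝ × Circle => (p.1 : ℂ) := by fun_prop
    exact continuous_const.add (this.smul ((hγ.comp continuous_snd).sub continuous_const))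
  have hWc : Continuous fun p : ℝ × Circle => W p.1 p.2 := by
    simp only [W]
    refine Continuous.mul ?_ (by fun_prop)
    exact Continuous.zpow₀ (by fun_prop) _ fun θ => Or.inl (Circle.coe_ne_zero θ.2)
  have key := IsWind.of_family (isPreconnected_Icc (a := (0:ℝ)) (b := 1))
    (F := fun τ θ => u (Xf τ θ)) (x := 0) (y := 1) (a := b * a) ?_
    (fun τ hτ θ => hu0 _ (hXm τ hτ θ)) (by simp) (by simp) ?_
  · convert key using 1
    funext θ
    simp [Xf, P, W, hh θ]
  · refine hu.comp ?_ ?_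
    · have hζc : ContinuousOn (fun p : ℝ × Circle => ζ (P p.1 p.2)) (Set.Icc (0:ℝ) 1 ×ˢ Set.univ) :=
        hC.cont.comp hPc.continuousOn fun p hp => hb1' (hb2 (hPm _ hp.1 _))
      exact hPc.continuousOn.add ((hWc.continuousOn.sub hζc).smul continuousOn_const)
    · intro p hp; exact hXm _ hp.1 _
  · have := ha.comp_zpow b
    convert this using 1
    funext θ
    have hρ' : Complex.exp (Complex.log (ρ:ℂ)) = ρ := by
      rw [Complex.exp_log]; exact_mod_cast hρ.ne'
    simp [Xf, P, W, hζq, Complex.ofReal_log hρ.le, hρ', Circle.coe_zpow, mul_comm]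

/-- local constancy of indices along a chart -/
lemma Chart.ind (hC : Chart Z q e ζ δ) {u : E → ℂ} {N0 : Set E} (hN0 : N0 ∈ 𝓝 q)
    (hu : ContinuousOn u (N0 \ Z)) (hu0 : ∀ x ∈ N0 \ Z, u x ≠ 0) :
    ∃ a, ∀ᶠ q' in 𝓝 q, q' ∈ Z → IndAt u q' e a := by
  obtain ⟨N, hNo, hqN, hNN0, hNδ, H⟩ := hC.loops hN0
  obtain ⟨a, ha⟩ := H u hu hu0
  refine ⟨a, ?_⟩
  filter_upwards [hNo.mem_nhds hqN] with q' hq' hZ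
  rw [IndAt.iff]
  filter_upwards [hC.meridian hNo hNδ hq' hZ] with r hr
  simpa using ha _ (by fun_prop) hr.1 1 hr.2

lemma Chart.inv {Z' : Set E} {q' e' : E} {ζ' : E → ℂ} {δ' : ℝ}
    (hC : Chart Z q e ζ δ) (hC' : Chart Z' q' e' ζ' δ') {φ ψ : E → E} {U U' : Set E}
    (hU : IsOpen U) (hU' : IsOpen U') (hqU : q ∈ U) (hqU' : q' ∈ U') (hφq : φ q = q')
    (hφ : ContinuousOn φ U) (hψ : ContinuousOn ψ U')
    (hm : Set.MapsTo φ U U') (hm' : Set.MapsTo ψ U' U)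
    (hl : Set.LeftInvOn ψ φ U) (hr : Set.RightInvOn ψ φ U')
    (hZ : ∀ x ∈ U, (x ∈ Z ↔ φ x ∈ Z')) {u : E → ℂ} {N0 : Set E} (hN0 : N0 ∈ 𝓝 q')
    (hu : ContinuousOn u (N0 \ Z')) (hu0 : ∀ x ∈ N0 \ Z', u x ≠ 0) {a' : ℤ}
    (ha' : IndAt u q' e' a') : ∃ c : ℤ, (c = 1 ∨ c = -1) ∧ IndAt (fun x => u (φ x)) q e (c * a') := by
  have hψq : ψ q' = q := by rw [← hφq]; exact hl hqU
  have hψa : ContinuousAt ψ q' := hψ.continuousAt (hU'.mem_nhds hqU')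
  have hφa : ContinuousAt φ q := hφ.continuousAt (hU.mem_nhds hqU)
  set M0 := N0 ∩ (U' ∩ ψ ⁻¹' (Metric.ball q δ)) with hM0
  have hM0n : M0 ∈ 𝓝 q' := Filter.inter_mem hN0 (Filter.inter_mem (hU'.mem_nhds hqU')
    (hψa.preimage_mem_nhds (by rw [hψq]; exact Metric.ball_mem_nhds _ hC.pos)))
  have hZ' : ∀ y ∈ U', (ψ y ∈ Z ↔ y ∈ Z') := fun y hy => by rw [hZ _ (hm' hy), hr hy]
  obtain ⟨N', hN'o, hqN', hN'M, hN'δ, H'⟩ := hC'.loops hM0n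
  obtain ⟨a1, ha1⟩ := H' u (hu.mono (Set.sdiff_subset_sdiff_left Set.inter_subset_left))
    (fun x hx => hu0 x ⟨hx.1.1, hx.2⟩)
  obtain ⟨a2, ha2⟩ := H' (fun y => ζ (ψ y))
    (hC.cont.comp (hψ.mono fun y hy => hy.1.2.1) fun y hy => hy.1.2.2)
    (fun y hy h => hy.2 ((hZ' y hy.1.2.1).1 ((hC.zero _ hy.1.2.2).2 h)))
  have e1 : a1 = a' := by
    refine IndAt.unique (u := u) (q := q') (e := e') ?_ ha'
    rw [IndAt.iff]
    filter_upwards [hC'.meridian hN'o hN'δ hqN' hC'.mem] with r hr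
    simpa using ha1 _ (by fun_prop) hr.1 1 hr.2
  set L0 := U ∩ (φ ⁻¹' N') with hL0
  have hL0n : L0 ∈ 𝓝 q := Filter.inter_mem (hU.mem_nhds hqU)
    (hφa.preimage_mem_nhds (by rw [hφq]; exact hN'o.mem_nhds hqN'))
  obtain ⟨N, hNo, hqN, hNL, hNδ, H⟩ := hC.loops hL0n
  obtain ⟨a3, ha3⟩ := H (fun x => ζ' (φ x))
    (hC'.cont.comp (hφ.mono fun y hy => hy.1.1) fun y hy => hN'δ hy.1.2)
    (fun x hx h => hx.2 ((hZ x hx.1.1).2 ((hC'.zero _ (hN'δ hx.1.2)).2 h)))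
  have hmer := hC.meridian hNo hNδ hqN hC.mem
  have hcont : ∀ r : ℝ, (∀ θ : Circle, q + ((r:ℂ) * θ) • e ∈ N \ Z) →
      Continuous fun θ : Circle => φ (q + ((r:ℂ) * θ) • e) := fun r h =>
    hφ.comp_continuous (by fun_prop) fun θ => (hNL (h θ).1).1
  have hin : ∀ r : ℝ, (∀ θ : Circle, q + ((r:ℂ) * θ) • e ∈ N \ Z) →
      ∀ θ : Circle, φ (q + ((r:ℂ) * θ) • e) ∈ N' \ Z' := fun r h θ =>
    ⟨(hNL (h θ).1).2, fun h' => (h θ).2 ((hZ _ (hNL (h θ).1).1).2 h')⟩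
  have e2 : a3 * a2 = 1 := by
    obtain ⟨r, hr1, hr2⟩ := hmer.exists
    have h3 := ha3 _ (by fun_prop) hr1 1 hr2
    have h4 := ha2 _ (hcont r hr1) (hin r hr1) _ h3
    have h5 : (fun θ : Circle => ζ (ψ (φ (q + ((r:ℂ) * θ) • e)))) =
        fun θ : Circle => ζ (q + ((r:ℂ) * θ) • e) := by
      funext θ; rw [hl (hNL (hr1 θ).1).1]
    rw [h5] at h4
    simpa using h4.unique hr2
  refine ⟨a3, Int.eq_one_or_neg_one_of_mul_eq_one e2, ?_⟩
  rw [IndAt.iff]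
  filter_upwards [hmer] with r hr
  have h3 := ha3 _ (by fun_prop) hr.1 1 hr.2
  have h4 := ha1 _ (hcont r hr.1) (hin r hr.1) _ h3
  rw [e1, one_mul] at h4
  exact h4

lemma Chart.of_unique {f : E → ℂ} {x0 e : E} {r : ℝ} (hr : 0 < r) (hx0 : f x0 = 0) {Z : Set E}
    (hZ : ∀ᶠ x in 𝓝 x0, (x ∈ Z ↔ f x = 0))
    (hf : ∀ᶠ p in 𝓝 x0, ∀ s : ℂ, ‖s‖ ≤ r → ContinuousAt f (p + s • e))
    (hu : ∀ᶠ p in 𝓝 x0, ∃ s : ℂ, ‖s‖ ≤ r ∧ f (p + s • e) = 0 ∧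
      ∀ s' : ℂ, ‖s'‖ ≤ r → f (p + s' • e) = 0 → s' = s) :
    ∃ ζ δ, Chart Z x0 e ζ δ := by
  have he : e ≠ 0 := by
    rintro rfl
    obtain ⟨s, h1, h2, h3⟩ := hu.self_of_nhds
    have h4 := h3 0 (by simpa using hr.le) (by simpa using hx0)
    have h5 := h3 r (by simp [abs_of_pos hr]) (by simpa using hx0)
    rw [← h4] at h5
    exact hr.ne' (by exact_mod_cast h5)
  obtain ⟨δ1, hδ1, H⟩ := Metric.eventually_nhds_iff_ball.1 ((hZ.and hf).and hu)
  have H3 : ∀ p, p ∈ Metric.ball x0 δ1 → ∃ s : ℂ, ‖s‖ ≤ r ∧ f (p + s • e) = 0 ∧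
      ∀ s' : ℂ, ‖s'‖ ≤ r → f (p + s' • e) = 0 → s' = s := fun p hp => (H p hp).2
  choose! σ hσ1 hσ2 hσ3 using H3
  have hσc : ContinuousOn σ (Metric.ball x0 δ1) := by
    intro p hp
    refine ContinuousAt.continuousWithinAt ?_
    rw [ContinuousAt, tendsto_nhds]
    intro V hV hpV
    have hK : IsCompact (Metric.closedBall (0:ℂ) r \ V) := (isCompact_closedBall 0 r).diff hV
    have h1 : ∀ᶠ p' in 𝓝 p, ∀ s ∈ Metric.closedBall (0:ℂ) r \ V, f (p' + s • e) ≠ 0 := by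
      refine compact_ev hK fun s hs => ?_
      have hs1 : ‖s‖ ≤ r := by simpa using hs.1
      have h2 : f (p + s • e) ≠ 0 := fun h => hs.2 (by rw [hσ3 p hp s hs1 h]; exact hpV)
      have h3 := (H p hp).1.2 s hs1
      have h4 : ContinuousAt (fun z : E × ℂ => f (z.1 + z.2 • e)) (p, s) :=
        ContinuousAt.comp (f := fun z : E × ℂ => z.1 + z.2 • e) h3 (by fun_prop)
      rw [← nhds_prod_eq]
      exact h4.eventually_ne h2
    filter_upwards [h1, Metric.isOpen_ball.mem_nhds hp] with p' h2 h3
    by_contra h4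
    exact h2 (σ p') ⟨by simpa using hσ1 p' h3, h4⟩ (hσ2 p' h3)
  have hσ0 : σ x0 = 0 := (hσ3 x0 (Metric.mem_ball_self hδ1) 0 (by simpa using hr.le)
    (by simpa using hx0)).symm
  have hsm : ∀ᶠ x in 𝓝 x0, ‖σ x‖ < r / 2 := by
    have hca : ContinuousAt σ x0 := hσc.continuousAt (Metric.ball_mem_nhds _ hδ1)
    exact hca.norm.eventually_lt (continuousAt_const (y := r/2)) (by simpa [hσ0] using hr)
  obtain ⟨δ2, hδ2, Hs⟩ := Metric.eventually_nhds_iff_ball.1 hsm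
  have hep : 0 < ‖e‖ := norm_pos_iff.2 he
  set δ := min (min δ1 δ2) (r / 4 * ‖e‖) with hδ
  have hb1 : Metric.ball x0 δ ⊆ Metric.ball x0 δ1 :=
    Metric.ball_subset_ball ((min_le_left _ _).trans (min_le_left _ _))
  have hb2 : Metric.ball x0 δ ⊆ Metric.ball x0 δ2 :=
    Metric.ball_subset_ball ((min_le_left _ _).trans (min_le_right _ _))
  have hδe : δ ≤ r / 4 * ‖e‖ := min_le_right _ _
  refine ⟨fun x => - σ x, δ, by positivity, (H x0 (Metric.mem_ball_self hδ1)).1.1.2 hx0,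
    (hσc.mono hb1).neg, ?_, ?_⟩
  · intro x hx
    rw [(H x (hb1 hx)).1.1, neg_eq_zero]
    constructor
    · intro h; exact (hσ3 x (hb1 hx) 0 (by simpa using hr.le) (by simpa using h)).symm
    · intro h; have := hσ2 x (hb1 hx); rwa [h, zero_smul, add_zero] at this
  · intro x hx t hxt
    have h1 := hσ2 _ (hb1 hxt)
    rw [add_assoc, ← add_smul] at h1
    have h2 : ‖t‖ ≤ r / 2 := by
      rw [Metric.mem_ball, dist_eq_norm] at hx hxt
      have h3 : ‖t • e‖ ≤ ‖x + t • e - x0‖ + ‖x - x0‖ := by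
        have := norm_sub_le (x + t • e - x0) (x - x0)
        rwa [show x + t • e - x0 - (x - x0) = t • e by abel] at this
      rw [norm_smul] at h3
      have : ‖t‖ * ‖e‖ ≤ r / 2 * ‖e‖ := by linarith
      exact le_of_mul_le_mul_right this hep
    have h3 := Hs _ (hb2 hxt)
    have h4 := hσ3 x (hb1 hx) (t + σ (x + t • e)) ((norm_add_le _ _).trans (by linarith)) h1
    show -σ (x + t • e) = -σ x + t
    rw [← h4]; ring

end charts


section ineq
variable {E : Type*} [NormedAddCommGroup E] [NormedSpace ℂ E]

lemma Ind1.shift {v : ℂ → ℂ} {s : ℂ} {a : ℤ} : Ind1 (fun z => v (s + z)) 0 a ↔ Ind1 v s a := by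
  simp [Ind1]

lemma IndAt.shift {u : E → ℂ} {p e : E} {s : ℂ} {a : ℤ} :
    IndAt u (p + s • e) e a ↔ Ind1 (fun z : ℂ => u (p + z • e)) s a := by
  rw [← Ind1.shift, IndAt]
  simp only [add_smul, add_assoc]

lemma impl_fun [CompleteSpace E] {F : E → ℂ} {x0 e : E} {s0 : ℂ} (hF : AnalyticAt ℂ F (x0 + s0 • e))
    (h0 : F (x0 + s0 • e) = 0) (hd : deriv (fun s : ℂ => F (x0 + s • e)) s0 ≠ 0) :
    ∃ σ : E → ℂ, AnalyticAt ℂ σ x0 ∧ σ x0 = s0 ∧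
      ∀ᶠ v : E × ℂ in 𝓝 (x0, s0), (F (v.1 + v.2 • e) = 0 ↔ σ v.1 = v.2) := by
  set G : E × ℂ → ℂ := fun v => F (v.1 + v.2 • e) with hG
  have hGa : AnalyticAt ℂ G (x0, s0) := by
    have h1 : AnalyticAt ℂ (fun v : E × ℂ => v.1 + v.2 • e) (x0, s0) :=
      analyticAt_fst.add (analyticAt_snd.smul analyticAt_const)
    exact AnalyticAt.comp (f := fun v : E × ℂ => v.1 + v.2 • e) hF h1
  have hGc : ContDiffAt ℂ ⊤ G (x0, s0) := hGa.contDiffAt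
  have hinv : (fderiv ℂ G (x0, s0) ∘L .inr ℂ E ℂ).IsInvertible := by
    have h2 : HasDerivAt (fun s : ℂ => F (x0 + s • e)) ((fderiv ℂ G (x0, s0)) (0, 1)) s0 := by
      have h3 : HasDerivAt (fun s : ℂ => ((x0, s) : E × ℂ)) (0, 1) s0 :=
        (hasDerivAt_const s0 x0).prodMk (hasDerivAt_id s0)
      exact (hGa.differentiableAt.hasFDerivAt).comp_hasDerivAt s0 h3
    rw [h2.deriv] at hd
    set c := (fderiv ℂ G (x0, s0)) (0, 1) with hc
    refine ⟨ContinuousLinearEquiv.unitsEquivAut ℂ (Units.mk0 c hd), ?_⟩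
    ext
    simp [hc]
  refine ⟨hGc.implicitFunction (by simp) hinv, ?_, ?_, ?_⟩
  · have := hGc.contDiffAt_implicitFunction (by simp) hinv
    exact this.analyticAt
  · exact hGc.implicitFunction_apply_self (by simp) hinv
  · have := hGc.eventually_apply_eq_iff_implicitFunction (by simp) hinv
    have h4 : G (x0, s0) = 0 := h0
    rw [h4] at this
    exact this

lemma Chart.of_simple [CompleteSpace E] {f : E → ℂ} {x e : E} (hf : AnalyticAt ℂ f x) (h0 : f x = 0)
    (hd : deriv (fun s : ℂ => f (x + s • e)) 0 ≠ 0) {Z : Set E}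
    (hZ : ∀ᶠ x in 𝓝 x, (x ∈ Z ↔ f x = 0)) : ∃ ζ δ, Chart Z x e ζ δ := by
  obtain ⟨σ, hσ, hσ0, hσe⟩ := impl_fun (s0 := 0) (x0 := x) (e := e) (by simpa using hf)
    (by simpa using h0) hd
  have hfe : ∀ᶠ v : E × ℂ in 𝓝 (x, 0), ContinuousAt f (v.1 + v.2 • e) := by
    have h1 : ContinuousAt (fun v : E × ℂ => v.1 + v.2 • e) (x, 0) := by fun_prop
    refine h1.eventually ?_
    simp only [zero_smul, add_zero]
    exact hf.eventually_analyticAt.mono fun y hy => hy.continuousAt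
  have h2 := hσe.and hfe
  rw [nhds_prod_eq] at h2
  obtain ⟨pa, hpa, pb, hpb, H⟩ := Filter.eventually_prod_iff.1 h2
  obtain ⟨r, hr, hrb⟩ := Metric.eventually_nhds_iff_ball.1 hpb
  have hrb' : ∀ s : ℂ, ‖s‖ ≤ r / 2 → pb s := fun s hs => hrb s (by simp; linarith)
  refine Chart.of_unique (half_pos hr) h0 hZ ?_ ?_
  · filter_upwards [hpa] with p hp s hs
    exact (H hp (hrb' s hs)).2
  · have h3 : ∀ᶠ p in 𝓝 x, ‖σ p‖ < r / 2 := by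
      exact hσ.continuousAt.norm.eventually_lt (continuousAt_const (y := r/2))
        (by simpa [hσ0] using hr)
    filter_upwards [hpa, h3] with p hp h3
    refine ⟨σ p, h3.le, (H hp (hrb' _ h3.le)).1.2 rfl, fun s' hs' h => ?_⟩
    exact ((H hp (hrb' _ hs')).1.1 h).symm

lemma IndAt.of_simple {f : E → ℂ} {x e : E} (hf : AnalyticAt ℂ f x) (h0 : f x = 0)
    (hd : deriv (fun s : ℂ => f (x + s • e)) 0 ≠ 0) : IndAt f x e 1 := by
  have ha : AnalyticAt ℂ (fun s : ℂ => f (x + s • e)) 0 := by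
    have h1 : AnalyticAt ℂ (fun s : ℂ => x + s • e) 0 :=
      analyticAt_const.add (analyticAt_id.smul analyticAt_const)
    exact AnalyticAt.fun_comp (f := fun s : ℂ => x + s • e) (by simpa using hf) h1
  obtain ⟨k, hk, h1, h2⟩ := Ind1.of_analytic ha (by simpa using h0) (fun h => hd (by
    have h5 : (fun s : ℂ => f (x + s • e)) =ᶠ[𝓝 0] fun _ => (0:ℂ) := h
    rw [h5.deriv_eq]; simp))
  rw [h2 hd] at h1
  exact h1

lemma IndAt.of_ne {u : E → ℂ} {x e : E} (hu : ∀ᶠ y in 𝓝 x, ContinuousAt u y) (h0 : u x ≠ 0) :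
    IndAt u x e 0 := by
  refine Ind1.of_ne ?_ (by simpa using h0)
  have h1 : ContinuousAt (fun s : ℂ => x + s • e) 0 := by fun_prop
  have h2 : ∀ᶠ s : ℂ in 𝓝 0, ContinuousAt u (x + s • e) := h1.eventually (by simpa using hu)
  filter_upwards [h2] with s hs
  exact ContinuousAt.comp (f := fun s : ℂ => x + s • e) hs (by fun_prop)

lemma exists_circle {R : ℝ} (hR : 0 < R) {z : ℂ} (hz : ‖z‖ = R) : ∃ θ : Circle, z = R * θ := by
  have hR' : (R:ℂ) ≠ 0 := by exact_mod_cast hR.ne'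
  refine ⟨⟨z / R, by simp [Submonoid.unitSphere, hz, abs_of_pos hR, hR.ne']⟩, ?_⟩
  show z = R * (z / R)
  rw [mul_div_cancel₀ _ hR']

lemma ev_disc {O : Set E} (hO : IsOpen O) {q e : E} {ε : ℝ}
    (hd : ∀ s ∈ Metric.closedBall (0:ℂ) ε, q + s • e ∈ O) :
    ∀ᶠ p in 𝓝 q, ∀ s ∈ Metric.closedBall (0:ℂ) ε, p + s • e ∈ O := by
  refine compact_ev (isCompact_closedBall 0 ε) fun s hs => ?_
  rw [← nhds_prod_eq]
  have : ContinuousAt (fun v : E × ℂ => v.1 + v.2 • e) (q, s) := by fun_prop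
  exact this.preimage_mem_nhds (hO.mem_nhds (hd s hs))

lemma wind_ev {O : Set E} (hO : IsOpen O) {u : E → ℂ} (hu : ContinuousOn u O) {q e : E} {c : ℂ}
    {r : ℝ} (hd : ∀ θ : Circle, q + (c + r * θ) • e ∈ O) {a : ℤ}
    (ha : IsWind (fun θ : Circle => u (q + (c + r * θ) • e)) a) :
    ∀ᶠ p in 𝓝 q, IsWind (fun θ : Circle => u (p + (c + r * θ) • e)) a := by
  have hD : {p : E | ∀ θ : Circle, p + (c + r * θ) • e ∈ O} ∈ 𝓝 q := by
    have : ∀ᶠ p in 𝓝 q, ∀ θ ∈ (Set.univ : Set Circle), p + (c + r * θ) • e ∈ O := by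
      refine compact_ev isCompact_univ fun s hs => ?_
      rw [← nhds_prod_eq]
      have : ContinuousAt (fun v : E × Circle => v.1 + (c + r * v.2) • e) (q, s) := by fun_prop
      exact this.preimage_mem_nhds (hO.mem_nhds (hd s))
    filter_upwards [this] with p hp θ using hp θ trivial
  have h1 := IsWind.eventually (s := {p : E | ∀ θ : Circle, p + (c + r * θ) • e ∈ O})
    (F := fun p θ => u (p + (c + r * θ) • e)) (hu.comp (by fun_prop) fun p hp => hp.1 p.2)
    (x := q) hd ha
  rwa [nhdsWithin_eq_nhds.2 hD] at h1

lemma analytic_line {f : E → ℂ} {p e : E} {s : ℂ} (h : AnalyticAt ℂ f (p + s • e)) :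
    AnalyticAt ℂ (fun z : ℂ => f (p + z • e)) s := by
  have h1 : AnalyticAt ℂ (fun s : ℂ => p + s • e) s :=
    analyticAt_const.add (analyticAt_id.smul analyticAt_const)
  exact AnalyticAt.fun_comp (f := fun s : ℂ => p + s • e) h h1

lemma wind_ineq {f u : E → ℂ} {O : Set E} (hO : IsOpen O) (hf : AnalyticOnNhd ℂ f O)
    (hu : ContinuousOn u O) (hZ : ∀ x ∈ O, (u x = 0 ↔ f x = 0)) {q e : E} {ε : ℝ} (hε : 0 < ε)
    (hd : ∀ s ∈ Metric.closedBall (0:ℂ) ε, q + s • e ∈ O) {k w : ℤ}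
    (hk : IsWind (fun θ : Circle => f (q + ((ε:ℂ) * θ) • e)) k)
    (hw : IsWind (fun θ : Circle => u (q + ((ε:ℂ) * θ) • e)) w)
    (hstar : ∀ x ∈ O, ∀ ζ δ, Chart {x | x ∈ O ∧ f x = 0} x e ζ δ →
      ∃ c : ℤ, (c = 1 ∨ c = -1) ∧ IndAt u x e c) : |w| ≤ k := by
  classical
  let G : E → Prop := fun p => (∀ s ∈ Metric.closedBall (0:ℂ) ε, p + s • e ∈ O) ∧
    IsWind (fun θ : Circle => f (p + ((ε:ℂ) * θ) • e)) k ∧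
    IsWind (fun θ : Circle => u (p + ((ε:ℂ) * θ) • e)) w
  have hGo : ∀ p, G p → ∀ᶠ p' in 𝓝 p, G p' := by
    intro p hp
    have hc := fun θ : Circle => hp.1 _ (circle_mem0 hε.le θ)
    have h1 := wind_ev (c := 0) (r := ε) hO hf.continuousOn (by simpa using hc) (a := k) (q := p)
      (by simpa using hp.2.1)
    have h2 := wind_ev (c := 0) (r := ε) hO hu (by simpa using hc) (a := w) (q := p)
      (by simpa using hp.2.2)
    simp only [zero_add] at h1 h2
    filter_upwards [ev_disc hO hp.1, h1, h2] with p' a b c using ⟨a, b, c⟩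
  have hcount : ∀ p, G p → ∃ (T : Finset ℂ) (μ : ℂ → ℤ),
      (∀ s, s ∈ T ↔ s ∈ Metric.ball (0:ℂ) ε ∧ f (p + s • e) = 0) ∧
      (∀ s ∈ T, 1 ≤ μ s ∧ Ind1 (fun z : ℂ => f (p + z • e)) s (μ s)) ∧ (T.card : ℤ) ≤ k := by
    intro p hp
    obtain ⟨T, μ, h1, h2, h3⟩ := holo_count hε (v := fun s : ℂ => f (p + s • e))
      (fun s hs => analytic_line (hf _ (hp.1 s hs))) (fun θ => hp.2.1.ne_zero θ)
    refine ⟨T, μ, h1, h2, ?_⟩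
    rw [hp.2.1.unique h3]
    calc (T.card : ℤ) = ∑ s ∈ T, 1 := by simp
      _ ≤ ∑ s ∈ T, μ s := Finset.sum_le_sum fun s hs => (h2 s hs).1
  let S : Set ℕ := {m | ∃ p, G p ∧ ∃ T : Finset ℂ,
    (∀ s, s ∈ T ↔ s ∈ Metric.ball (0:ℂ) ε ∧ f (p + s • e) = 0) ∧ T.card = m}
  have hGq : G q := ⟨hd, hk, hw⟩
  have hSne : S.Nonempty := by
    obtain ⟨T, μ, h1, h2, h3⟩ := hcount q hGq
    exact ⟨T.card, q, hGq, T, h1, rfl⟩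
  have hSb : BddAbove S := by
    refine ⟨k.toNat, ?_⟩
    rintro m ⟨p, hp, T, hT, rfl⟩
    obtain ⟨T', μ, h1, h2, h3⟩ := hcount p hp
    have : T = T' := by ext s; rw [hT, h1]
    rw [this]; omega
  obtain ⟨p, hp, T, hT, hTc⟩ := Nat.sSup_mem hSne hSb
  have hmax : ∀ p', G p' → ∀ T' : Finset ℂ,
      (∀ s, s ∈ T' ↔ s ∈ Metric.ball (0:ℂ) ε ∧ f (p' + s • e) = 0) → T'.card ≤ T.card := by
    intro p' hp' T' hT'
    rw [hTc]; exact le_csSup hSb ⟨p', hp', T', hT', rfl⟩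
  obtain ⟨T1, μ, h1, h2, h3⟩ := hcount p hp
  obtain rfl : T1 = T := by ext s; rw [hT, h1]
  clear h1
  -- radius
  have hr : ∀ᶠ r : ℝ in 𝓝[>] 0, ∀ s ∈ T1, Metric.closedBall s r ⊆ Metric.ball (0:ℂ) ε ∧
      IsWind (fun θ : Circle => f (p + (s + r * θ) • e)) (μ s) ∧
      ∀ t ∈ T1, t ≠ s → 2 * r < dist s t := by
    rw [Filter.eventually_all_finset]
    intro s hs
    have a1 : ∀ᶠ r : ℝ in 𝓝[>] 0, Metric.closedBall s r ⊆ Metric.ball (0:ℂ) ε :=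
      ev_circle (Metric.isOpen_ball.mem_nhds ((hT s).1 hs).1)
    have a2 : ∀ᶠ r : ℝ in 𝓝[>] 0, ∀ t ∈ T1, t ≠ s → 2 * r < dist s t := by
      rw [Filter.eventually_all_finset]
      intro t ht
      by_cases hts : t = s
      · simp [hts]
      · have h5 : 0 < dist s t := dist_pos.2 (Ne.symm hts)
        have : ∀ᶠ r : ℝ in 𝓝 0, 2 * r < dist s t :=
          (by fun_prop : ContinuousAt (fun r : ℝ => 2 * r) 0).eventually_lt
            (continuousAt_const (y := dist s t)) (by simpa using Ne.symm hts)
        filter_upwards [this.filter_mono nhdsWithin_le_nhds] with r hr _ using hr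
    filter_upwards [a1, (h2 s hs).2, a2] with r b1 b2 b3 using ⟨b1, b2, b3⟩
  obtain ⟨r, hr, hr0⟩ := (hr.and self_mem_nhdsWithin).exists
  replace hr0 : 0 < r := hr0
  have hpe : ∀ᶠ p' in 𝓝 p, G p' ∧ ∀ s ∈ T1,
      IsWind (fun θ : Circle => f (p' + (s + r * θ) • e)) (μ s) := by
    refine (hGo p hp).and ?_
    rw [Filter.eventually_all_finset]
    intro s hs
    refine wind_ev hO hf.continuousOn (fun θ => hp.1 _ ?_) (hr s hs).2.1
    exact Metric.ball_subset_closedBall ((hr s hs).1 (circle_mem hr0.le θ))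
  have huniq : ∀ᶠ p' in 𝓝 p, G p' ∧ ∀ s ∈ T1, ∃ z ∈ Metric.closedBall s r, f (p' + z • e) = 0 ∧
      ∀ z' ∈ Metric.closedBall s r, f (p' + z' • e) = 0 → z' = z := by
    filter_upwards [hpe] with p' hp'
    refine ⟨hp'.1, ?_⟩
    have hz : ∀ s, s ∈ T1 → ∃ z ∈ Metric.closedBall s r, f (p' + z • e) = 0 := by
      intro s hs
      by_contra hcon
      push Not at hcon
      have hm : ∀ y ∈ Metric.closedBall (0:ℂ) r, s + y ∈ Metric.closedBall s r := by
        intro y hy; simpa using hy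
      have := IsWind.zero_of_disc hr0.le (u := fun y => f (p' + (s + y) • e)) ?_ ?_
      · have h6 := this.unique (hp'.2 s hs)
        have := (h2 s hs).1
        omega
      · refine hf.continuousOn.comp (by fun_prop) fun y hy => hp'.1.1 _ ?_
        exact Metric.ball_subset_closedBall ((hr s hs).1 (hm y hy))
      · intro y hy; exact hcon _ (hm y hy)
    choose! z hz1 hz2 using hz
    obtain ⟨T', μ', g1, g2, g3⟩ := hcount p' hp'.1
    have hinj : ∀ s ∈ T1, ∀ t ∈ T1, ∀ y, y ∈ Metric.closedBall s r → y ∈ Metric.closedBall t r →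
        s = t := by
      intro s hs t ht y h7 h8
      by_contra hst
      have := (hr s hs).2.2 t ht (Ne.symm hst)
      have h9 := dist_triangle_left s t y
      rw [Metric.mem_closedBall] at h7 h8
      linarith
    have hsub : T1.image z ⊆ T' := by
      intro y hy
      obtain ⟨s, hs, rfl⟩ := Finset.mem_image.1 hy
      exact (g1 _).2 ⟨(hr s hs).1 (hz1 s hs), hz2 s hs⟩
    have hcard : (T1.image z).card = T1.card := Finset.card_image_of_injOn fun s hs t ht hst =>
      hinj s hs t ht (z s) (hz1 s hs) (by rw [hst]; exact hz1 t ht)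
    have heq := Finset.eq_of_subset_of_card_le hsub (by rw [hcard]; exact hmax p' hp'.1 T' g1)
    intro s hs
    refine ⟨z s, hz1 s hs, hz2 s hs, fun z' hz' h => ?_⟩
    have : z' ∈ T1.image z := by rw [heq]; exact (g1 _).2 ⟨(hr s hs).1 hz', h⟩
    obtain ⟨t, ht, rfl⟩ := Finset.mem_image.1 this
    rw [hinj t ht s hs _ (hz1 t ht) hz']
  have hind : ∀ s, s ∈ T1 → ∃ c : ℤ, (c = 1 ∨ c = -1) ∧ Ind1 (fun z : ℂ => u (p + z • e)) s c := by
    intro s hs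
    have hsb := Metric.ball_subset_closedBall ((hT s).1 hs).1
    have hsO := hp.1 s hsb
    have hev : ∀ᶠ y in 𝓝 (p + s • e), G (y - s • e) ∧ ∀ t ∈ T1, ∃ z ∈ Metric.closedBall t r,
        f (y - s • e + z • e) = 0 ∧
        ∀ z' ∈ Metric.closedBall t r, f (y - s • e + z' • e) = 0 → z' = z := by
      have hc : ContinuousAt (fun y : E => y - s • e) (p + s • e) := by fun_prop
      exact hc.eventually (p := fun p' => G p' ∧ ∀ t ∈ T1, ∃ z ∈ Metric.closedBall t r,
        f (p' + z • e) = 0 ∧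
        ∀ z' ∈ Metric.closedBall t r, f (p' + z' • e) = 0 → z' = z) (by simpa using huniq)
    have hrw : ∀ (y : E) (z : ℂ), y + z • e = y - s • e + (s + z) • e := by
      intro y z; rw [add_smul]; abel
    have hmm : ∀ z : ℂ, ‖z‖ ≤ r → s + z ∈ Metric.closedBall s r := by intro z hz; simpa using hz
    obtain ⟨ζ, δ, hC⟩ := Chart.of_unique (f := f) (e := e) (x0 := p + s • e) hr0
      ((hT s).1 hs).2 (Z := {x | x ∈ O ∧ f x = 0}) (by
        filter_upwards [hO.mem_nhds hsO] with x hx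
        simp [hx]) (by
        filter_upwards [hev] with y hy z hz
        rw [hrw]
        exact (hf _ (hy.1.1 _ (Metric.ball_subset_closedBall ((hr s hs).1 (hmm z hz))))).continuousAt) (by
        filter_upwards [hev] with y hy
        obtain ⟨z, hz1, hz2, hz3⟩ := hy.2 s hs
        refine ⟨z - s, by simpa [dist_eq_norm] using hz1, ?_, ?_⟩
        · rw [hrw]; simpa using hz2
        · intro s' hs' h
          rw [hrw] at h
          rw [← hz3 _ (hmm s' hs') h]; ring)
    obtain ⟨c, hc, hI⟩ := hstar _ hsO ζ δ hC
    exact ⟨c, hc, IndAt.shift.1 hI⟩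
  choose! c hc1 hc2 using hind
  have hres := residue hε T1 (fun z : ℂ => u (p + z • e)) (fun s hs => ((hT s).1 hs).1)
    (hu.comp (by fun_prop) fun z hz => hp.1 z hz.1) (by
      intro z hz h
      have h5 := (hZ _ (hp.1 z hz.1)).1 h
      by_cases hzb : z ∈ Metric.ball (0:ℂ) ε
      · exact hz.2 (by simpa using (hT z).2 ⟨hzb, h5⟩)
      · have hn : ‖z‖ = ε := le_antisymm (by simpa using hz.1) (by simpa using hzb)
        obtain ⟨θ, rfl⟩ := exists_circle hε hn
        exact hp.2.1.ne_zero θ h5) c hc2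
  rw [hp.2.2.unique hres]
  calc |∑ s ∈ T1, c s| ≤ ∑ s ∈ T1, |c s| := Finset.abs_sum_le_sum_abs _ _
    _ ≤ ∑ s ∈ T1, 1 := Finset.sum_le_sum fun s hs => by rcases hc1 s hs with h | h <;> simp [h]
    _ = T1.card := by simp
    _ ≤ k := h3

end ineq


section germs
variable {E : Type*} [NormedAddCommGroup E] [NormedSpace ℂ E]

structure GP (f g : E → ℂ) (φ ψ : E → E) (O O' : Set E) (K : NNReal) : Prop where
  hO : IsOpen O
  hO' : IsOpen O'
  h0 : (0:E) ∈ O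
  h0' : (0:E) ∈ O'
  φ0 : φ 0 = 0
  m : Set.MapsTo φ O O'
  m' : Set.MapsTo ψ O' O
  l : Set.LeftInvOn ψ φ O
  r : Set.RightInvOn ψ φ O'
  Lφ : LipschitzOnWith K φ O
  Lψ : LipschitzOnWith K ψ O'
  fa : AnalyticOnNhd ℂ f O
  ga : AnalyticOnNhd ℂ g O'
  zero : ∀ x ∈ O, (f x = 0 ↔ g (φ x) = 0)
  regf : ∀ x ∈ O, f x = 0 → ∀ N ∈ 𝓝 x, ∃ y ∈ N, y ∈ O ∧ f y = 0 ∧ fderiv ℂ f y ≠ 0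
  regg : ∀ x ∈ O', g x = 0 → ∀ N ∈ 𝓝 x, ∃ y ∈ N, y ∈ O' ∧ g y = 0 ∧ fderiv ℂ g y ≠ 0

variable {f g : E → ℂ} {φ ψ : E → E} {O O' : Set E} {K : NNReal}

lemma GP.symm (h : GP f g φ ψ O O' K) : GP g f ψ φ O' O K where
  hO := h.hO'
  hO' := h.hO
  h0 := h.h0'
  h0' := h.h0
  φ0 := by have := h.l h.h0; rwa [h.φ0] at this
  m := h.m'
  m' := h.m
  l := h.r
  r := h.l
  Lφ := h.Lψ
  Lψ := h.Lφ
  fa := h.ga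
  ga := h.fa
  zero := fun y hy => by rw [h.zero _ (h.m' hy), h.r hy]
  regf := h.regg
  regg := h.regf

lemma Chart.mono {Z : Set E} {q e : E} {ζ : E → ℂ} {δ : ℝ} (hC : Chart Z q e ζ δ) {q' : E}
    (hq' : q' ∈ Metric.ball q δ) (hZ : q' ∈ Z) : ∃ δ', Chart Z q' e ζ δ' := by
  obtain ⟨δ', h1, h2⟩ := Metric.isOpen_iff.1 Metric.isOpen_ball q' hq'
  exact ⟨δ', h1, hZ, hC.cont.mono h2, fun x hx => hC.zero x (h2 hx),
    fun x hx t ht => hC.trans x (h2 hx) t (h2 ht)⟩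

lemma exists_dir {g : E → ℂ} {y : E} (hg : AnalyticAt ℂ g y) (h : fderiv ℂ g y ≠ 0) :
    ∃ e : E, deriv (fun s : ℂ => g (y + s • e)) 0 ≠ 0 := by
  by_contra hcon
  push Not at hcon
  apply h
  ext e
  rw [zero_apply, ← hcon e]
  have h1 : HasDerivAt (fun s : ℂ => y + s • e) e 0 := by
    simpa using ((hasDerivAt_id (0:ℂ)).smul_const e).const_add y
  have h2 : HasFDerivAt g (fderiv ℂ g y) (y + (0:ℂ) • e) := by
    simpa using hg.differentiableAt.hasFDerivAt
  exact (h2.comp_hasDerivAt (0:ℂ) h1).deriv.symm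

lemma GP.star [CompleteSpace E] (h : GP f g φ ψ O O' K) {x e : E} (hx : x ∈ O) {ζ : E → ℂ} {δ : ℝ}
    (hC : Chart {x | x ∈ O ∧ f x = 0} x e ζ δ) :
    ∃ c : ℤ, (c = 1 ∨ c = -1) ∧ IndAt (fun x => g (φ x)) x e c := by
  have hφc := h.Lφ.continuousOn
  have hψc := h.Lψ.continuousOn
  have huc : ContinuousOn (fun x => g (φ x)) O := h.ga.continuousOn.comp hφc h.m
  obtain ⟨a, ha⟩ := hC.ind (u := fun x => g (φ x)) (h.hO.mem_nhds hx)
    (huc.mono Set.sdiff_subset) (fun y hy h0 => hy.2 ⟨hy.1, (h.zero y hy.1).2 h0⟩)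
  have hN := ha.and (Metric.isOpen_ball.mem_nhds (Metric.mem_ball_self hC.pos) : Metric.ball x δ ∈ 𝓝 x)
  have hψx : ψ (φ x) = x := h.l hx
  have hψa : ContinuousAt ψ (φ x) := hψc.continuousAt (h.hO'.mem_nhds (h.m hx))
  have hN' : ∀ᶠ y in 𝓝 (φ x), _ := hψa.eventually (by rw [hψx]; exact hN)
  obtain ⟨y, hyN, hyO, hy0, hyr⟩ := h.regg (φ x) (h.m hx) ((h.zero x hx).1 hC.mem.2) _ hN'
  have hyZ : ψ y ∈ {x | x ∈ O ∧ f x = 0} := ⟨h.m' hyO, (h.symm.zero y hyO).1 hy0⟩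
  have hI : IndAt (fun x => g (φ x)) (ψ y) e a := hyN.1 hyZ
  obtain ⟨δ', hC'⟩ := hC.mono hyN.2 hyZ
  obtain ⟨e', he'⟩ := exists_dir (h.ga y hyO) hyr
  obtain ⟨ζ1, δ1, hC1⟩ := Chart.of_simple (h.ga y hyO) hy0 he' (Z := {y | y ∈ O' ∧ g y = 0}) (by
    filter_upwards [h.hO'.mem_nhds hyO] with z hz
    simp [hz])
  have hI1 := IndAt.of_simple (h.ga y hyO) hy0 he'
  obtain ⟨c, hc, hI2⟩ := Chart.inv hC' hC1 h.hO h.hO' (h.m' hyO) hyO (h.r hyO) hφc hψc h.m h.m' h.l h.r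
    (fun z hz => by simp [hz, h.m hz, h.zero z hz]) (h.hO'.mem_nhds hyO)
    (h.ga.continuousOn.mono Set.sdiff_subset) (fun z hz h0 => hz.2 ⟨hz.1, h0⟩) hI1
  rw [mul_one] at hI2
  refine ⟨c, hc, ?_⟩
  rw [← hI.unique hI2]
  exact ha.self_of_nhds hC.mem

/-- blow-up limits -/
def BlowLim (𝒰 : Filter ℝ) (φ Φ : E → E) : Prop :=
  ∀ x, Filter.Tendsto (fun z : ℝ × E => (z.1:ℂ)⁻¹ • φ ((z.1:ℂ) • z.2)) (𝒰 ×ˢ 𝓝 x) (𝓝 (Φ x))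

def ConeLim (f P : E → ℂ) (m : ℕ) : Prop :=
  ∀ x, Filter.Tendsto (fun z : ℝ × E => f ((z.1:ℂ) • z.2) / (z.1:ℂ) ^ m) (𝓝[>] 0 ×ˢ 𝓝 x) (𝓝 (P x))

lemma ev_scale (hO : O ∈ 𝓝 (0:E)) (x : E) :
    ∀ᶠ z : ℝ × E in 𝓝[>] 0 ×ˢ 𝓝 x, (z.1:ℂ) • z.2 ∈ O := by
  have : ContinuousAt (fun z : ℝ × E => (z.1:ℂ) • z.2) (0, x) := by fun_prop
  have h1 : ∀ᶠ z : ℝ × E in 𝓝 0 ×ˢ 𝓝 x, (z.1:ℂ) • z.2 ∈ O := by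
    rw [← nhds_prod_eq]
    exact this.preimage_mem_nhds (by simpa using hO)
  exact h1.filter_mono (Filter.prod_mono_left _ nhdsWithin_le_nhds)

lemma ev_pos (x : E) : ∀ᶠ z : ℝ × E in 𝓝[>] 0 ×ˢ 𝓝 x, 0 < z.1 :=
  Filter.Tendsto.eventually (Filter.tendsto_fst) (self_mem_nhdsWithin)

lemma ev_fix {l : Filter ℝ} {x : E} {p : ℝ × E → Prop} (h : ∀ᶠ z in l ×ˢ 𝓝 x, p z) :
    ∀ᶠ t in l, p (t, x) := h.curry.mono fun _ h => h.self_of_nhds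

lemma blow [ProperSpace E] (hO : O ∈ 𝓝 (0:E)) (hL : LipschitzOnWith K φ O) (h0 : φ 0 = 0)
    (𝒰 : Ultrafilter ℝ) (hU : (𝒰 : Filter ℝ) ≤ 𝓝[>] 0) :
    ∃ Φ : E → E, LipschitzWith K Φ ∧ BlowLim (𝒰 : Filter ℝ) φ Φ := by
  have hest : ∀ t : ℝ, 0 < t → ∀ x y : E, (t:ℂ) • x ∈ O → (t:ℂ) • y ∈ O →
      ‖(t:ℂ)⁻¹ • φ ((t:ℂ) • x) - (t:ℂ)⁻¹ • φ ((t:ℂ) • y)‖ ≤ K * ‖x - y‖ := by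
    intro t ht x y hx hy
    have h1 := hL.norm_sub_le hx hy
    rw [← smul_sub, norm_smul] at h1
    rw [← smul_sub, norm_smul, norm_inv]
    simp only [Complex.norm_real, Real.norm_of_nonneg ht.le] at h1 ⊢
    rw [inv_mul_le_iff₀ ht]
    linarith
  have hzero : ∀ t : ℝ, (t:ℂ)⁻¹ • φ ((t:ℂ) • 0) = 0 := by intro t; simp [h0]
  have hex : ∀ x : E, ∃ y, Filter.Tendsto (fun t : ℝ => (t:ℂ)⁻¹ • φ ((t:ℂ) • x)) 𝒰 (𝓝 y) := by
    intro x
    have h1 : ∀ᶠ t : ℝ in (𝒰 : Filter ℝ), (t:ℂ)⁻¹ • φ ((t:ℂ) • x) ∈ Metric.closedBall (0:E) (K * ‖x‖) := by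
      filter_upwards [hU (ev_fix (ev_scale hO x)), hU self_mem_nhdsWithin] with t h2 h3
      have := hest t h3 x 0 h2 (by simpa using mem_of_mem_nhds hO)
      simpa [hzero, h0] using this
    obtain ⟨y, -, hy⟩ := (isCompact_closedBall (0:E) (K * ‖x‖)).ultrafilter_le_nhds
      (𝒰.map fun t : ℝ => (t:ℂ)⁻¹ • φ ((t:ℂ) • x)) (by
        rw [Filter.le_principal_iff]; exact h1)
    exact ⟨y, hy⟩
  choose Φ hΦ using hex
  refine ⟨Φ, ?_, ?_⟩
  · refine LipschitzWith.of_dist_le_mul fun x y => ?_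
    rw [dist_eq_norm, dist_eq_norm]
    refine le_of_tendsto ((hΦ x).sub (hΦ y)).norm ?_
    filter_upwards [hU (ev_fix (ev_scale hO x)), hU (ev_fix (ev_scale hO y)),
      hU self_mem_nhdsWithin] with t h1 h2 h3
    exact hest t h3 x y h1 h2
  · intro x
    rw [tendsto_iff_norm_sub_tendsto_zero]
    have h1 : Filter.Tendsto (fun z : ℝ × E => K * ‖z.2 - x‖ +
        ‖(z.1:ℂ)⁻¹ • φ ((z.1:ℂ) • x) - Φ x‖) ((𝒰 : Filter ℝ) ×ˢ 𝓝 x) (𝓝 0) := by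
      have h2 : Filter.Tendsto (fun z : ℝ × E => ‖(z.1:ℂ)⁻¹ • φ ((z.1:ℂ) • x) - Φ x‖)
          ((𝒰 : Filter ℝ) ×ˢ 𝓝 x) (𝓝 0) :=
        (tendsto_iff_norm_sub_tendsto_zero.1 (hΦ x)).comp Filter.tendsto_fst
      have h3 : Filter.Tendsto (fun z : ℝ × E => (K:ℝ) * ‖z.2 - x‖)
          ((𝒰 : Filter ℝ) ×ˢ 𝓝 x) (𝓝 0) := by
        have h4 : Filter.Tendsto (fun y : E => (K:ℝ) * ‖y - x‖) (𝓝 x) (𝓝 0) := by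
          have : ContinuousAt (fun y : E => (K:ℝ) * ‖y - x‖) x := by fun_prop
          simpa [ContinuousAt] using this
        exact h4.comp Filter.tendsto_snd
      simpa using h3.add h2
    refine squeeze_zero' (Filter.Eventually.of_forall fun _ => norm_nonneg _) ?_ h1
    have hle : (𝒰 : Filter ℝ) ×ˢ 𝓝 x ≤ 𝓝[>] 0 ×ˢ 𝓝 x := Filter.prod_mono_left _ hU
    have h5 : ∀ᶠ z : ℝ × E in (𝒰 : Filter ℝ) ×ˢ 𝓝 x, (z.1:ℂ) • x ∈ O :=
      Filter.tendsto_fst.eventually (hU (ev_fix (ev_scale hO x)))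
    filter_upwards [hle (ev_scale hO x), hle (ev_pos x), h5] with z h6 h7 h8
    have := hest z.1 h7 z.2 x h6 h8
    calc _ = ‖((z.1:ℂ)⁻¹ • φ ((z.1:ℂ) • z.2) - (z.1:ℂ)⁻¹ • φ ((z.1:ℂ) • x)) +
          ((z.1:ℂ)⁻¹ • φ ((z.1:ℂ) • x) - Φ x)‖ := by congr 1; abel
      _ ≤ _ := (norm_add_le _ _).trans (by linarith)

lemma BlowLim.comp {𝒰 : Filter ℝ} [𝒰.NeBot] (hU : 𝒰 ≤ 𝓝[>] 0) {Φ Ψ : E → E}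
    (h : GP f g φ ψ O O' K) (hΦ : BlowLim 𝒰 φ Φ) (hΨ : BlowLim 𝒰 ψ Ψ) (x : E) : Ψ (Φ x) = x := by
  have h1 : Filter.Tendsto (fun t : ℝ => (t, (t:ℂ)⁻¹ • φ ((t:ℂ) • x))) 𝒰 (𝒰 ×ˢ 𝓝 (Φ x)) := by
    have h0 : Filter.Tendsto (fun t : ℝ => (t, x)) 𝒰 (𝒰 ×ˢ 𝓝 x) :=
      Filter.tendsto_id.prodMk tendsto_const_nhds
    have h00 : Filter.Tendsto (fun t : ℝ => (t:ℂ)⁻¹ • φ ((t:ℂ) • x)) 𝒰 (𝓝 (Φ x)) := by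
      have h := hΦ x
      have h' := h.comp h0
      exact h'
    exact Filter.Tendsto.prodMk Filter.tendsto_id h00
  have h2 : Filter.Tendsto (fun t : ℝ => (t:ℂ)⁻¹ • ψ ((t:ℂ) • ((t:ℂ)⁻¹ • φ ((t:ℂ) • x)))) 𝒰
    (𝓝 (Ψ (Φ x))) := by
    have h := hΨ (Φ x)
    have h' := h.comp h1
    exact h'
  refine tendsto_nhds_unique h2 (tendsto_const_nhds.congr' ?_)
  filter_upwards [hU (ev_fix (ev_scale (h.hO.mem_nhds h.h0) x)), hU self_mem_nhdsWithin] with t h3 h4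
  have h5 : (t:ℂ) ≠ 0 := by exact_mod_cast (ne_of_gt h4)
  have h3' : (t:ℂ) • x ∈ O := h3
  rw [smul_smul, mul_inv_cancel₀ h5, one_smul, h.l h3', smul_smul, inv_mul_cancel₀ h5, one_smul]

lemma ConeLim.comp {𝒰 : Filter ℝ} (hU : 𝒰 ≤ 𝓝[>] 0) {Φ : E → E} {P' : E → ℂ} {m' : ℕ}
    (hΦ : BlowLim 𝒰 φ Φ) (hP' : ConeLim g P' m') (x : E) :
    Filter.Tendsto (fun z : ℝ × E => g (φ ((z.1:ℂ) • z.2)) / (z.1:ℂ) ^ m') (𝒰 ×ˢ 𝓝 x)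
      (𝓝 (P' (Φ x))) := by
  have h1 : Filter.Tendsto (fun z : ℝ × E => (z.1, (z.1:ℂ)⁻¹ • φ ((z.1:ℂ) • z.2))) (𝒰 ×ˢ 𝓝 x)
      (𝓝[>] 0 ×ˢ 𝓝 (Φ x)) :=
    (Filter.tendsto_fst.mono_right hU).prodMk (hΦ x)
  refine ((hP' (Φ x)).comp h1).congr' ?_
  have hle : 𝒰 ×ˢ 𝓝 x ≤ 𝓝[>] 0 ×ˢ 𝓝 x := Filter.prod_mono_left _ hU
  filter_upwards [hle (ev_pos x)] with z hz
  have h5 : (z.1:ℂ) ≠ 0 := by exact_mod_cast hz.ne'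
  simp only [Function.comp]
  rw [smul_smul, mul_inv_cancel₀ h5, one_smul]

/-- transfer of winding numbers to small scales -/
lemma wind_lim {𝒰 : Filter ℝ} (hU : 𝒰 ≤ 𝓝[>] 0) {v : E → ℂ} {H : E → ℂ} {m : ℕ}
    (hO : IsOpen O) (h0 : (0:E) ∈ O) (hv : ContinuousOn v O)
    (hH : ∀ x, Filter.Tendsto (fun z : ℝ × E => v ((z.1:ℂ) • z.2) / (z.1:ℂ) ^ m) (𝒰 ×ˢ 𝓝 x)
      (𝓝 (H x))) {γ : Circle → E} (hγ : Continuous γ) {a : ℤ} (ha : IsWind (fun θ => H (γ θ)) a) :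
    ∀ᶠ t : ℝ in 𝒰, (∀ θ, (t:ℂ) • γ θ ∈ O) ∧ IsWind (fun θ => v ((t:ℂ) • γ θ)) a := by
  have hle : ∀ x : E, 𝒰 ×ˢ 𝓝 x ≤ 𝓝[>] 0 ×ˢ 𝓝 x := fun x => Filter.prod_mono_left _ hU
  have hpull : ∀ θ : Circle, Filter.Tendsto (fun z : ℝ × Circle => (z.1, γ z.2)) (𝒰 ×ˢ 𝓝 θ)
      (𝒰 ×ˢ 𝓝 (γ θ)) := fun θ =>
    Filter.tendsto_fst.prodMk ((hγ.tendsto θ).comp Filter.tendsto_snd)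
  have h1 : ∀ᶠ t : ℝ in 𝒰, ∀ θ ∈ (Set.univ : Set Circle), (t:ℂ) • γ θ ∈ O := by
    refine compact_ev (P := fun (t : ℝ) θ => (t:ℂ) • γ θ ∈ O) isCompact_univ fun θ _ => ?_
    exact (hpull θ).eventually (hle _ (ev_scale (hO.mem_nhds h0) (γ θ)))
  have h2 : ∀ᶠ t : ℝ in 𝒰, ∀ θ ∈ (Set.univ : Set Circle),
      ‖v ((t:ℂ) • γ θ) / (t:ℂ) ^ m - H (γ θ)‖ < ‖H (γ θ)‖ := by
    refine compact_ev isCompact_univ fun θ _ => ?_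
    have h3 := (hH (γ θ)).comp (hpull θ)
    have h4 : Filter.Tendsto (fun z : ℝ × Circle => H (γ z.2)) (𝒰 ×ˢ 𝓝 θ) (𝓝 (H (γ θ))) :=
      (ha.continuous.tendsto θ).comp Filter.tendsto_snd
    have h5 := (h3.sub h4).norm
    rw [sub_self, norm_zero] at h5
    exact h5.eventually_lt h4.norm (norm_pos_iff.2 (ha.ne_zero θ))
  filter_upwards [h1, h2, hU self_mem_nhdsWithin] with t h3 h4 h5
  have ht : (t:ℂ) ≠ 0 := by exact_mod_cast (ne_of_gt h5)
  have hcont : Continuous fun θ => v ((t:ℂ) • γ θ) :=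
    hv.comp_continuous (by fun_prop) fun θ => h3 θ trivial
  refine ⟨fun θ => h3 θ trivial, ?_⟩
  have h6 := ha.of_close (c' := fun θ => v ((t:ℂ) • γ θ) / (t:ℂ) ^ m) (hcont.div_const _)
    (fun θ => h4 θ trivial)
  have h7 := h6.const_mul (pow_ne_zero m ht)
  convert h7 using 1
  funext θ
  rw [mul_div_cancel₀ _ (pow_ne_zero m ht)]

lemma ev_disc_scale {𝒰 : Filter ℝ} (hU : 𝒰 ≤ 𝓝[>] 0) (hO : IsOpen O) (h0 : (0:E) ∈ O) (x e : E)
    (r : ℝ) : ∀ᶠ t : ℝ in 𝒰, ∀ s ∈ Metric.closedBall (0:ℂ) r, (t:ℂ) • (x + s • e) ∈ O := by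
  refine compact_ev (isCompact_closedBall 0 r) fun s _ => ?_
  have hp : Filter.Tendsto (fun z : ℝ × ℂ => (z.1, x + z.2 • e)) (𝒰 ×ˢ 𝓝 s)
      (𝒰 ×ˢ 𝓝 (x + s • e)) := by
    have : ContinuousAt (fun s : ℂ => x + s • e) s := by fun_prop
    exact Filter.tendsto_fst.prodMk (this.tendsto.comp Filter.tendsto_snd)
  exact hp.eventually ((Filter.prod_mono_left _ hU) (ev_scale (hO.mem_nhds h0) _))

lemma cone_zero {𝒰 : Filter ℝ} [𝒰.NeBot] (hU : 𝒰 ≤ 𝓝[>] 0) {Φ : E → E} (hΦc : Continuous Φ)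
    (h : GP f g φ ψ O O' K) (hΦ : BlowLim 𝒰 φ Φ) {P P' : E → ℂ} {m m' : ℕ}
    (hP : ConeLim f P m) (hP' : ConeLim g P' m') (hPa : AnalyticOnNhd ℂ P Set.univ)
    (hPa' : Continuous P') (hP0 : ∃ y, P y ≠ 0) {x : E} (hx : P x = 0) : P' (Φ x) = 0 := by
  by_contra hcon
  obtain ⟨y, hy⟩ := hP0
  set e := y - x with he
  have hla : ∀ s, AnalyticAt ℂ (fun s : ℂ => P (x + s • e)) s := fun s =>
    analytic_line (hPa _ trivial)
  obtain ⟨k, hk1, hk, -⟩ := Ind1.of_analytic (hla 0) (by simpa using hx) (fun h0 => by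
    have := AnalyticOnNhd.eqOn_zero_of_preconnected_of_eventuallyEq_zero
      (f := fun s : ℂ => P (x + s • e)) (U := Set.univ) (fun s _ => hla s) isPreconnected_univ
      (Set.mem_univ 0) h0 (Set.mem_univ 1)
    apply hy
    simpa [he] using this)
  have hne : {z | P' (Φ z) ≠ 0} ∈ 𝓝 x :=
    (hPa'.comp hΦc).continuousAt.eventually_ne hcon
  obtain ⟨r, ⟨hr1, hr2⟩, hr3⟩ := ((hk.and (ev_line x e hne)).and self_mem_nhdsWithin).exists
  have hr0 : 0 < r := hr3
  simp only [zero_add] at hr1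
  have h1 := wind_lim hU h.hO h.h0 h.fa.continuousOn (fun x => (hP x).mono_left
    (Filter.prod_mono_left _ hU)) (γ := fun θ : Circle => x + ((r:ℂ) * θ) • e) (by fun_prop) hr1
  have h2 : ∀ᶠ t : ℝ in 𝒰, ∀ s ∈ Metric.closedBall (0:ℂ) r, g (φ ((t:ℂ) • (x + s • e))) ≠ 0 := by
    refine compact_ev (isCompact_closedBall 0 r) fun s hs => ?_
    have hp : Filter.Tendsto (fun z : ℝ × ℂ => (z.1, x + z.2 • e)) (𝒰 ×ˢ 𝓝 s)
        (𝒰 ×ˢ 𝓝 (x + s • e)) := by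
      have : ContinuousAt (fun s : ℂ => x + s • e) s := by fun_prop
      exact Filter.tendsto_fst.prodMk (this.tendsto.comp Filter.tendsto_snd)
    have h3 := (ConeLim.comp hU hΦ hP' (x + s • e)).comp hp
    filter_upwards [h3.eventually_ne (hr2 s hs)] with z hz h4
    apply hz
    simp only [Function.comp]
    rw [h4, zero_div]
  obtain ⟨t, ⟨⟨ht1, ht2⟩, ht3⟩, ht4⟩ := ((h1.and h2).and (ev_disc_scale hU h.hO h.h0 x e r)).exists
  have h5 := IsWind.zero_of_disc hr0.le (u := fun s => f ((t:ℂ) • (x + s • e)))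
    (h.fa.continuousOn.comp (by fun_prop) ht4)
    (fun s hs h6 => ht3 s hs ((h.zero _ (ht4 s hs)).1 h6))
  have := ht2.unique h5
  omega

lemma cone_ineq [CompleteSpace E] {𝒰 : Filter ℝ} [𝒰.NeBot] (hU : 𝒰 ≤ 𝓝[>] 0) {Φ : E → E}
    (h : GP f g φ ψ O O' K) (hΦ : BlowLim 𝒰 φ Φ) {P P' : E → ℂ} {m m' : ℕ}
    (hP : ConeLim f P m) (hP' : ConeLim g P' m') {q e : E} {k w : ℤ}
    (hk : IndAt P q e k) (hw : IndAt (fun x => P' (Φ x)) q e w) : |w| ≤ k := by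
  rw [IndAt.iff] at hk hw
  obtain ⟨r, ⟨hr1, hr2⟩, hr3⟩ := ((hk.and hw).and self_mem_nhdsWithin).exists
  have hr0 : 0 < r := hr3
  have huc : ContinuousOn (fun x => g (φ x)) O :=
    h.ga.continuousOn.comp h.Lφ.continuousOn h.m
  have h1 := wind_lim hU h.hO h.h0 h.fa.continuousOn (fun x => (hP x).mono_left
    (Filter.prod_mono_left _ hU)) (γ := fun θ : Circle => q + ((r:ℂ) * θ) • e) (by fun_prop) hr1
  have h2 := wind_lim hU h.hO h.h0 huc (ConeLim.comp hU hΦ hP')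
    (γ := fun θ : Circle => q + ((r:ℂ) * θ) • e) (by fun_prop) hr2
  obtain ⟨t, ⟨ht1, ht2⟩, ht3⟩ := ((h1.and h2).and (ev_disc_scale hU h.hO h.h0 q e r)).exists
  have hrw : ∀ s : ℂ, (t:ℂ) • (q + s • e) = (t:ℂ) • q + s • ((t:ℂ) • e) := by
    intro s; rw [smul_add, smul_comm]
  simp only [hrw] at ht1 ht2 ht3
  exact wind_ineq h.hO h.fa huc (fun x hx => (h.zero x hx).symm) hr0 ht3 ht1.2 ht2.2
    (fun x hx ζ δ hC => h.star hx hC)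

end germs



lemma diag_poly {n m : ℕ} (q : ContinuousMultilinearMap ℂ (fun _ : Fin m => En n) ℂ) :
    ∃ P : MvPolynomial (Fin n) ℂ, P.IsHomogeneous m ∧
      ∀ x : En n, MvPolynomial.eval (x : Fin n → ℂ) P = q fun _ => x := by
  classical
  set b : Fin n → En n := fun i => EuclideanSpace.single i 1 with hb
  refine ⟨∑ r : Fin m → Fin n, MvPolynomial.C (q fun i => b (r i)) * ∏ i, MvPolynomial.X (r i), ?_, ?_⟩
  · refine MvPolynomial.IsHomogeneous.sum _ _ _ fun r _ => ?_
    have h1 : (∏ i, (MvPolynomial.X (r i) : MvPolynomial (Fin n) ℂ)).IsHomogeneous (∑ i : Fin m, 1) :=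
      MvPolynomial.IsHomogeneous.prod _ _ _ fun i _ => MvPolynomial.isHomogeneous_X _ _
    have h2 := (MvPolynomial.isHomogeneous_C (Fin n) (q fun i => b (r i))).mul h1
    simpa using h2
  · intro x
    have hx : x = ∑ i, (x i) • b i := by
      ext j
      simp [hb, Finset.sum_apply, Pi.single_apply]
    have h1 : (q fun _ => x) = q fun _ => ∑ i, (x i) • b i := by rw [← hx]
    rw [h1, q.map_sum]
    simp only [map_sum, map_mul, MvPolynomial.eval_C, map_prod, MvPolynomial.eval_X]
    refine Finset.sum_congr rfl fun r _ => ?_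
    rw [q.map_smul_univ, smul_eq_mul, mul_comm]

lemma taylor {n : ℕ} {f : En n → ℂ} (hf : AnalyticAt ℂ f 0) (hne : ¬ ∀ᶠ x in 𝓝 (0 : En n), f x = 0) :
    ∃ P : MvPolynomial (Fin n) ℂ, P ≠ 0 ∧ P.IsHomogeneous (vanishingOrder f) ∧
      ConeLim f (fun x : En n => MvPolynomial.eval (x : Fin n → ℂ) P) (vanishingOrder f) := by
  classical
  obtain ⟨p, r, hp⟩ := hf
  have hex : ∃ k, ∃ x : En n, (p k fun _ => x) ≠ 0 := by
    by_contra hcon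
    push Not at hcon
    apply hne
    filter_upwards [Metric.eball_mem_nhds (0 : En n) hp.r_pos] with x hx
    have := hp.hasSum (y := x) (by simpa using hx)
    simp only [hcon, zero_add] at this
    exact this.unique hasSum_zero
  set m := Nat.find hex with hm
  have hmin : ∀ k < m, ∀ x : En n, (p k fun _ => x) = 0 := by
    intro k hk x
    by_contra h
    exact Nat.find_min hex hk ⟨x, h⟩
  obtain ⟨x1, hx1⟩ := Nat.find_spec hex
  let p' : FormalMultilinearSeries ℂ (En n) ℂ := fun k => if k < m then 0 else p k
  have hdiag : ∀ k (x : En n), (p' k fun _ => x) = p k fun _ => x := by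
    intro k x
    simp only [p']
    split_ifs with h
    · simp [hmin k h]
    · rfl
  have hp' : HasFPowerSeriesOnBall f p' 0 r := by
    refine ⟨?_, hp.r_pos, fun {y} hy => ?_⟩
    · refine hp.r_le.trans ?_
      refine ENNReal.le_of_forall_nnreal_lt fun s hs => ?_
      obtain ⟨C, hC, h⟩ := p.norm_mul_pow_le_of_lt_radius hs
      refine p'.le_radius_of_bound C fun k => ?_
      simp only [p']
      split_ifs with hk
      · simpa using hC.le
      · exact h k
    · simpa only [hdiag] using hp.hasSum hy
  have hvo : vanishingOrder f = m := by
    have hzero : ∀ k < m, iteratedFDeriv ℂ k f 0 = 0 := by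
      intro k hk
      ext v
      rw [hp'.iteratedFDeriv_eq_sum_of_completeSpace]
      simp [p', hk]
    have hmne : iteratedFDeriv ℂ m f 0 ≠ 0 := by
      intro h
      have h1 := hp.factorial_smul x1 m
      rw [h] at h1
      simp only [zero_apply, nsmul_eq_mul, mul_eq_zero, Nat.cast_eq_zero] at h1
      rcases h1 with h1 | h1
      · exact Nat.factorial_ne_zero _ h1
      · exact hx1 h1
    refine le_antisymm (Nat.sInf_le hmne) ?_
    refine le_csInf ⟨m, hmne⟩ fun k hk => ?_
    by_contra hlt
    exact hk (hzero k (not_le.1 hlt))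
  rw [hvo]
  obtain ⟨P, hPh, hPe⟩ := diag_poly (p m)
  refine ⟨P, ?_, hPh, ?_⟩
  · rintro rfl
    exact hx1 (by rw [← hPe x1]; simp)
  · intro x
    simp only [hPe]
    have hO := hp'.hasFPowerSeriesAt.isBigO_sub_partialSum_pow (m + 1)
    have hps : ∀ y : En n, p'.partialSum (m+1) y = p m fun _ => y := by
      intro y
      rw [FormalMultilinearSeries.partialSum, Finset.sum_range_succ, Finset.sum_eq_zero, zero_add, hdiag]
      intro k hk
      rw [hdiag, hmin k (Finset.mem_range.1 hk)]
    obtain ⟨C, hC⟩ := hO.bound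
    simp only [zero_add, hps] at hC
    have hcont : Continuous fun y : En n => p m fun _ => y := by
      exact (p m).cont.comp (by fun_prop)
    have h1 : Filter.Tendsto (fun z : ℝ × En n => f ((z.1:ℂ) • z.2) / (z.1:ℂ)^m - p m fun _ => z.2)
        (𝓝[>] 0 ×ˢ 𝓝 x) (𝓝 0) := by
      have h2 : Filter.Tendsto (fun z : ℝ × En n => C * (z.1 * ‖z.2‖ ^ (m+1))) (𝓝[>] 0 ×ˢ 𝓝 x) (𝓝 0) := by
        have h3 : ContinuousAt (fun z : ℝ × En n => C * (z.1 * ‖z.2‖ ^ (m+1))) (0, x) := by fun_prop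
        rw [ContinuousAt, nhds_prod_eq] at h3
        simp only [zero_mul, mul_zero] at h3
        exact h3.mono_left (Filter.prod_mono_left _ nhdsWithin_le_nhds)
      refine squeeze_zero_norm' ?_ h2
      filter_upwards [ev_scale hC x, ev_pos x] with z hz hz0
      have hz1 : (z.1:ℂ) ≠ 0 := by exact_mod_cast hz0.ne'
      have h4 : (p m fun _ => (z.1:ℂ) • z.2) = (z.1:ℂ)^m * p m fun _ => z.2 := by
        rw [(p m).map_smul_univ]; simp
      rw [h4] at hz
      have h5 : f ((z.1:ℂ) • z.2) / (z.1:ℂ)^m - (p m fun _ => z.2) =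
          (f ((z.1:ℂ) • z.2) - (z.1:ℂ)^m * p m fun _ => z.2) / (z.1:ℂ)^m := by
        field_simp
      rw [h5, norm_div, norm_pow, Complex.norm_real, Real.norm_of_nonneg hz0.le,
        div_le_iff₀ (by positivity)]
      refine hz.trans (le_of_eq ?_)
      rw [norm_smul, Complex.norm_real, Real.norm_of_nonneg hz0.le, norm_pow, norm_mul, norm_norm,
        Real.norm_of_nonneg hz0.le]
      ring
    have h6 : Filter.Tendsto (fun z : ℝ × En n => p m fun _ => z.2) (𝓝[>] 0 ×ˢ 𝓝 x)
        (𝓝 (p m fun _ => x)) := (hcont.tendsto x).comp Filter.tendsto_snd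
    have := h1.add h6
    simpa using this


/-- scaling map -/
def Tsc (n : ℕ) : MvPolynomial (Fin n) ℂ →ₐ[ℂ] Polynomial (MvPolynomial (Fin n) ℂ) :=
  MvPolynomial.aeval fun i => Polynomial.C (MvPolynomial.X i) * Polynomial.X

lemma Tsc_hom {n k : ℕ} {p : MvPolynomial (Fin n) ℂ} (hp : p.IsHomogeneous k) :
    Tsc n p = Polynomial.C p * Polynomial.X ^ k := by
  conv_rhs => rw [p.as_sum]
  rw [Tsc, MvPolynomial.aeval_def, MvPolynomial.eval₂_eq', map_sum, Finset.sum_mul]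
  refine Finset.sum_congr rfl fun d hd => ?_
  have h1 : ∑ i, d i = k := by
    rw [hp.degree_eq_sum_deg_support hd]
    exact (Finset.sum_subset (Finset.subset_univ _) (by simp)).symm
  simp only [mul_pow, Finset.prod_mul_distrib, Finset.prod_pow_eq_pow_sum, h1]
  rw [MvPolynomial.monomial_eq, Finsupp.prod_fintype _ _ (by simp)]
  simp only [map_mul, map_prod, map_pow, mul_assoc]
  congr 1

lemma Tsc_coeff {n k : ℕ} (p : MvPolynomial (Fin n) ℂ) :
    (Tsc n p).coeff k = MvPolynomial.homogeneousComponent k p := by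
  conv_lhs => rw [← MvPolynomial.sum_homogeneousComponent p]
  rw [map_sum, Polynomial.finset_sum_coeff]
  simp only [Tsc_hom (MvPolynomial.homogeneousComponent_isHomogeneous _ p), Polynomial.coeff_C_mul,
    Polynomial.coeff_X_pow, mul_ite, mul_one, mul_zero]
  rw [Finset.sum_ite_eq]
  split_ifs with h
  · rfl
  · rw [MvPolynomial.homogeneousComponent_eq_zero]
    simp at h; omega

lemma hom_factor {n m : ℕ} {P a b : MvPolynomial (Fin n) ℂ} (hP : P.IsHomogeneous m) (h0 : P ≠ 0)
    (hab : P = a * b) : a.IsHomogeneous a.totalDegree := by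
  have ha : a ≠ 0 := by rintro rfl; simp at hab; exact h0 hab
  have hb : b ≠ 0 := by rintro rfl; simp at hab; exact h0 hab
  have hinj : ∀ p, p ≠ 0 → Tsc n p ≠ 0 := by
    intro p hp h
    apply hp
    rw [← MvPolynomial.sum_homogeneousComponent p]
    refine Finset.sum_eq_zero fun k _ => ?_
    rw [← Tsc_coeff, h, Polynomial.coeff_zero]
  have h1 : Polynomial.C P * Polynomial.X ^ m = Tsc n a * Tsc n b := by
    rw [← Tsc_hom hP, hab, map_mul]
  have h2 := congrArg Polynomial.natDegree h1
  have h3 := congrArg Polynomial.natTrailingDegree h1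
  rw [Polynomial.natDegree_mul (hinj a ha) (hinj b hb), Polynomial.natDegree_C_mul_X_pow _ _ h0] at h2
  rw [Polynomial.natTrailingDegree_mul (hinj a ha) (hinj b hb), 
    Polynomial.C_mul_X_pow_eq_monomial, Polynomial.natTrailingDegree_monomial h0] at h3
  have h4 := Polynomial.natTrailingDegree_le_natDegree (Tsc n a)
  have h5 := Polynomial.natTrailingDegree_le_natDegree (Tsc n b)
  have h6 : (Tsc n a).natTrailingDegree = (Tsc n a).natDegree := by omega
  have h7 : a.IsHomogeneous (Tsc n a).natDegree := by
    have : a = MvPolynomial.homogeneousComponent (Tsc n a).natDegree a := by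
      conv_lhs => rw [← MvPolynomial.sum_homogeneousComponent a]
      rw [Finset.sum_eq_single (Tsc n a).natDegree]
      · intro k _ hk
        rw [← Tsc_coeff]
        rcases lt_or_gt_of_ne hk with h | h
        · exact Polynomial.coeff_eq_zero_of_lt_natTrailingDegree (h6 ▸ h)
        · exact Polynomial.coeff_eq_zero_of_natDegree_lt h
      · intro h
        rw [MvPolynomial.homogeneousComponent_eq_zero]
        simp at h; omega
    rw [this]
    convert MvPolynomial.homogeneousComponent_isHomogeneous _ a using 1
    rw [← this]
  rwa [h7.totalDegree ha]

/-- evaluation -/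
def pe {n : ℕ} (p : MvPolynomial (Fin n) ℂ) (x : En n) : ℂ := MvPolynomial.eval (x : Fin n → ℂ) p

lemma factor_hom {n m : ℕ} {P : MvPolynomial (Fin n) ℂ} (hP : P.IsHomogeneous m) {e : En n}
    (he : pe P e ≠ 0) : ∃ (I : Finset (MvPolynomial (Fin n) ℂ)) (k : MvPolynomial (Fin n) ℂ → ℕ) (c : ℂ),
      c ≠ 0 ∧ P = MvPolynomial.C c * ∏ p ∈ I, p ^ k p ∧
      (∀ p ∈ I, Irreducible p ∧ p.IsHomogeneous p.totalDegree ∧ pe p e = 1 ∧ 1 ≤ k p) ∧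
      m = ∑ p ∈ I, p.totalDegree * k p := by
  classical
  have h0 : P ≠ 0 := by rintro rfl; simp [pe] at he
  set s := UniqueFactorizationMonoid.factors P with hs
  have hsp : Associated s.prod P := UniqueFactorizationMonoid.factors_prod h0
  let g : MvPolynomial (Fin n) ℂ → MvPolynomial (Fin n) ℂ := fun q => MvPolynomial.C (pe q e)⁻¹ * q
  have hev : ∀ q ∈ s, pe q e ≠ 0 := by
    intro q hq h
    obtain ⟨r, hr⟩ := UniqueFactorizationMonoid.dvd_of_mem_factors hq
    apply he
    rw [hr]; simp only [pe, map_mul] at h ⊢; rw [h, zero_mul]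
  have hass : ∀ q ∈ s, Associated q (g q) := by
    intro q hq
    refine Associated.symm (associated_unit_mul_left _ _ ?_)
    exact (IsUnit.mk0 _ (inv_ne_zero (hev q hq))).map MvPolynomial.C
  have hprod : Associated (s.map g).prod P := by
    refine Associated.trans ?_ hsp
    have key : ∀ t : Multiset (MvPolynomial (Fin n) ℂ), t ≤ s → Associated (t.map g).prod t.prod := by
      intro t
      induction t using Multiset.induction_on with
      | empty => intro _; simp
      | cons q t ih =>
        intro ht
        rw [Multiset.map_cons, Multiset.prod_cons, Multiset.prod_cons]
        exact (hass q (Multiset.mem_of_le ht (Multiset.mem_cons_self _ _))).symm.mul_mul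
          (ih ((Multiset.le_cons_self _ _).trans ht))
    exact key s le_rfl
  obtain ⟨u, hu⟩ := hprod
  obtain ⟨c, hc⟩ : ∃ c : ℂ, MvPolynomial.C c = (u : MvPolynomial (Fin n) ℂ) := by
    obtain ⟨c, -, hc⟩ := MvPolynomial.isUnit_iff_eq_C_of_isReduced.1 u.isUnit
    exact ⟨c, hc.symm⟩
  have hI : ∀ p ∈ (s.map g).toFinset, Irreducible p ∧ p.IsHomogeneous p.totalDegree ∧ pe p e = 1 ∧ 1 ≤ (s.map g).count p := by
    intro p hp
    rw [Multiset.mem_toFinset] at hp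
    have hp1 := hp
    rw [Multiset.mem_map] at hp
    obtain ⟨q, hq, rfl⟩ := hp
    refine ⟨(hass q hq).irreducible (UniqueFactorizationMonoid.irreducible_of_factor q hq), ?_, ?_, Multiset.one_le_count_iff_mem.2 hp1⟩
    · obtain ⟨r, hr⟩ := (hass q hq).symm.dvd.trans (UniqueFactorizationMonoid.dvd_of_mem_factors hq)
      exact hom_factor hP h0 hr
    · simp only [g, pe, map_mul, MvPolynomial.eval_C]
      exact inv_mul_cancel₀ (hev q hq)
  have hPe : P = MvPolynomial.C c * ∏ p ∈ (s.map g).toFinset, p ^ (s.map g).count p := by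
    rw [← Finset.prod_multiset_count, hc, mul_comm, hu]
  have hc0 : c ≠ 0 := by
    rintro rfl
    rw [map_zero, zero_mul] at hPe
    exact h0 hPe
  refine ⟨(s.map g).toFinset, fun p => (s.map g).count p, c, hc0, hPe, hI, ?_⟩
  have h1 : (MvPolynomial.C c * ∏ p ∈ (s.map g).toFinset, p ^ (s.map g).count p).IsHomogeneous
      (0 + ∑ p ∈ (s.map g).toFinset, p.totalDegree * (s.map g).count p) :=
    (MvPolynomial.isHomogeneous_C _ c).mul (MvPolynomial.IsHomogeneous.prod _ _ _ fun p hp => (hI p hp).2.1.pow _)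
  rw [← hPe, zero_add] at h1
  exact hP.inj_right h1 h0


lemma pe_mul {n : ℕ} (p q : MvPolynomial (Fin n) ℂ) (x : En n) : pe (p * q) x = pe p x * pe q x := by
  simp [pe]

lemma pe_smul {n m : ℕ} {p : MvPolynomial (Fin n) ℂ} (hp : p.IsHomogeneous m) (c : ℂ) (x : En n) :
    pe p (c • x) = c ^ m * pe p x := by
  simp only [pe, MvPolynomial.eval_eq', Finset.mul_sum]
  refine Finset.sum_congr rfl fun d hd => ?_
  have h1 : ∑ i, d i = m := by
    rw [hp.degree_eq_sum_deg_support hd]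
    exact (Finset.sum_subset (Finset.subset_univ _) (by simp)).symm
  simp only [PiLp.smul_apply, smul_eq_mul, mul_pow, Finset.prod_mul_distrib, Finset.prod_pow_eq_pow_sum, h1]
  ring

lemma pe_an {n : ℕ} (p : MvPolynomial (Fin n) ℂ) : AnalyticOnNhd ℂ (pe p) Set.univ := by
  intro x _
  have h : pe p = fun x : En n => ∑ d ∈ p.support, p.coeff d * ∏ i, x i ^ d i := by
    funext x; simp [pe, MvPolynomial.eval_eq']
  rw [h]
  refine Finset.analyticAt_fun_sum _ fun d _ => analyticAt_const.mul ?_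
  refine Finset.analyticAt_fun_prod _ fun i _ => AnalyticAt.pow ?_ _
  exact (EuclideanSpace.proj (𝕜 := ℂ) i : En n →L[ℂ] ℂ).analyticAt x

lemma pe_cont {n : ℕ} (p : MvPolynomial (Fin n) ℂ) : Continuous (pe p) := by
  rw [continuous_iff_continuousAt]
  exact fun x => (pe_an p x trivial).continuousAt

/-- translation map -/
def th {n : ℕ} (e : En n) : MvPolynomial (Fin n) ℂ →ₐ[ℂ] Polynomial (MvPolynomial (Fin n) ℂ) :=
  MvPolynomial.aeval fun i => Polynomial.C (MvPolynomial.X i) + Polynomial.C (MvPolynomial.C (e i)) * Polynomial.X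

/-- the restriction of p to the line x + s e -/
def lpo {n : ℕ} (e : En n) (p : MvPolynomial (Fin n) ℂ) (x : En n) : Polynomial ℂ :=
  (th e p).map (MvPolynomial.eval (x : Fin n → ℂ))

lemma lpo_eval {n : ℕ} (e : En n) (p : MvPolynomial (Fin n) ℂ) (x : En n) (s : ℂ) :
    (lpo e p x).eval s = pe p (x + s • e) := by
  have : ((Polynomial.evalRingHom s).comp ((Polynomial.mapRingHom (MvPolynomial.eval (x : Fin n → ℂ))).comp
      (th e : MvPolynomial (Fin n) ℂ →+* _))) = MvPolynomial.eval ((x + s • e : En n) : Fin n → ℂ) := by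
    apply MvPolynomial.ringHom_ext
    · intro r
      simp [th, MvPolynomial.algebraMap_eq, Polynomial.algebraMap_apply]
    · intro i
      simp [th]
      exact mul_comm _ _
  exact congrArg (fun f => f p) this

lemma lpo_deriv {n : ℕ} (e : En n) (p : MvPolynomial (Fin n) ℂ) (x : En n) (s : ℂ) :
    deriv (fun s : ℂ => pe p (x + s • e)) s = (lpo e p x).derivative.eval s := by
  have : (fun s : ℂ => pe p (x + s • e)) = fun s => (lpo e p x).eval s := by
    funext s; rw [lpo_eval]
  rw [this, Polynomial.deriv]

lemma th_monic {n : ℕ} {e : En n} {p : MvPolynomial (Fin n) ℂ} (hp : p.IsHomogeneous p.totalDegree)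
    (he : pe p e = 1) : (th e p).Monic ∧ (th e p).natDegree = p.totalDegree := by
  have hexp : th e p = ∑ d ∈ p.support, Polynomial.C (MvPolynomial.C (p.coeff d)) *
      ((Finsupp.toMultiset d).map fun i => Polynomial.C (MvPolynomial.X i : MvPolynomial (Fin n) ℂ) + 
        Polynomial.C (MvPolynomial.C (e i)) * Polynomial.X).prod := by
    rw [th, MvPolynomial.aeval_def, MvPolynomial.eval₂_eq]
    refine Finset.sum_congr rfl fun d _ => ?_
    congr 1
    rw [Finsupp.toMultiset_map, Finsupp.prod_toMultiset, Finsupp.prod_mapDomain_index (by simp) (by intros; rw [pow_add])]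
    rfl
  have hcard : ∀ d ∈ p.support, (Finsupp.toMultiset d).card = p.totalDegree := by
    intro d hd
    rw [Finsupp.card_toMultiset]
    rw [hp.degree_eq_sum_deg_support hd]; rfl
  have hle1 : ∀ i, (Polynomial.C (MvPolynomial.X i : MvPolynomial (Fin n) ℂ) + 
        Polynomial.C (MvPolynomial.C (e i)) * Polynomial.X).natDegree ≤ 1 := by
    intro i; compute_degree
  have hle : (th e p).natDegree ≤ p.totalDegree := by
    rw [hexp]
    refine Polynomial.natDegree_sum_le_of_forall_le _ _ fun d hd => ?_
    refine (Polynomial.natDegree_C_mul_le _ _).trans ?_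
    refine (Polynomial.natDegree_multiset_prod_le _).trans ?_
    rw [Multiset.map_map]
    refine (Multiset.sum_le_card_nsmul _ 1 ?_).trans ?_
    · intro x hx
      simp only [Multiset.mem_map] at hx
      obtain ⟨i, _, rfl⟩ := hx
      exact hle1 i
    · rw [Multiset.card_map, hcard d hd]; simp
  have hco : (th e p).coeff p.totalDegree = 1 := by
    rw [hexp, Polynomial.finset_sum_coeff]
    have : ∀ d ∈ p.support, (Polynomial.C (MvPolynomial.C (p.coeff d)) *
      ((Finsupp.toMultiset d).map fun i => Polynomial.C (MvPolynomial.X i : MvPolynomial (Fin n) ℂ) + 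
        Polynomial.C (MvPolynomial.C (e i)) * Polynomial.X).prod).coeff p.totalDegree = 
        MvPolynomial.C (p.coeff d * ∏ i, e i ^ d i) := by
      intro d hd
      rw [Polynomial.coeff_C_mul, map_mul]
      congr 1
      have h2 := Polynomial.coeff_multiset_prod_of_natDegree_le ((Finsupp.toMultiset d).map fun i => Polynomial.C (MvPolynomial.X i : MvPolynomial (Fin n) ℂ) + 
        Polynomial.C (MvPolynomial.C (e i)) * Polynomial.X) 1 (by
          intro x hx
          simp only [Multiset.mem_map] at hx
          obtain ⟨i, _, rfl⟩ := hx
          exact hle1 i)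
      rw [Multiset.card_map, hcard d hd, mul_one] at h2
      rw [h2, Multiset.map_map]
      have h3 : ((fun p : Polynomial (MvPolynomial (Fin n) ℂ) => p.coeff 1) ∘ fun i => Polynomial.C (MvPolynomial.X i : MvPolynomial (Fin n) ℂ) + 
        Polynomial.C (MvPolynomial.C (e i)) * Polynomial.X) = fun i => MvPolynomial.C (e i) := by
        funext i; simp [Polynomial.coeff_C]
      rw [h3, Finsupp.toMultiset_map, Finsupp.prod_toMultiset, Finsupp.prod_mapDomain_index (by simp) (by intros; rw [pow_add]),
        Finsupp.prod_fintype _ _ (by simp)]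
      simp
    rw [Finset.sum_congr rfl this, ← map_sum]
    have h4 : ∑ d ∈ p.support, p.coeff d * ∏ i, e i ^ d i = 1 := by
      rw [← he, pe, MvPolynomial.eval_eq']
    rw [h4, map_one]
  have hm := Polynomial.monic_of_natDegree_le_of_coeff_eq_one _ hle hco
  refine ⟨hm, le_antisymm hle (Polynomial.le_natDegree_of_ne_zero (by rw [hco]; exact one_ne_zero))⟩

lemma lpo_monic {n : ℕ} {e : En n} {p : MvPolynomial (Fin n) ℂ} (hp : p.IsHomogeneous p.totalDegree)
    (he : pe p e = 1) (x : En n) : (lpo e p x).Monic ∧ (lpo e p x).natDegree = p.totalDegree :=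
  ⟨(th_monic hp he).1.map _, by rw [lpo, (th_monic hp he).1.natDegree_map, (th_monic hp he).2]⟩

/-- translation automorphism -/
def Th {n : ℕ} (e : En n) : Polynomial (MvPolynomial (Fin n) ℂ) →+* Polynomial (MvPolynomial (Fin n) ℂ) :=
  Polynomial.eval₂RingHom (th e : MvPolynomial (Fin n) ℂ →+* _) Polynomial.X

lemma Th_C {n : ℕ} (e : En n) (p) : Th e (Polynomial.C p) = th e p := by simp [Th]

lemma Th_neg {n : ℕ} (e : En n) : (Th (-e)).comp (Th e) = RingHom.id _ := by
  apply Polynomial.ringHom_ext'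
  · apply MvPolynomial.ringHom_ext
    · intro r
      simp [Th, th, MvPolynomial.algebraMap_eq, Polynomial.algebraMap_apply]
    · intro i
      simp [Th, th, MvPolynomial.algebraMap_eq, Polynomial.algebraMap_apply]
      ring
  · simp [Th]

lemma th_irr {n : ℕ} (e : En n) {p : MvPolynomial (Fin n) ℂ} (hp : Irreducible p) : Irreducible (th e p) := by
  have h2 := Th_neg (-e)
  rw [neg_neg] at h2
  let Q : Polynomial (MvPolynomial (Fin n) ℂ) ≃+* Polynomial (MvPolynomial (Fin n) ℂ) :=
    RingEquiv.ofRingHom (Th e) (Th (-e)) h2 (Th_neg e)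
  have h : th e p = Q (Polynomial.C p) := (Th_C e p).symm
  rw [h, MulEquiv.irreducible_iff]
  exact (Polynomial.prime_C_iff.2 hp.prime).irreducible

lemma th_inj {n : ℕ} (e : En n) : Function.Injective (th e) := by
  intro p q h
  rw [← Th_C, ← Th_C] at h
  have h1 := congrArg (Th (-e)) h
  have h2 : ∀ r, Th (-e) (Th e r) = r := fun r => congrArg (fun f => f r) (Th_neg e)
  rw [h2, h2] at h1
  exact Polynomial.C_injective h1

lemma coprime_field {K : Type*} [Field K] {f g : Polynomial K} (hf : f.Monic) (hg : g.Monic)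
    (hf' : Irreducible f) (hg' : Irreducible g) (hne : f ≠ g) : IsCoprime f g := by
  rcases hf'.isCoprime_or_dvd g with h | h
  · exact h
  · exact absurd (Polynomial.eq_of_monic_of_associated hf hg (hf'.associated_of_dvd hg' h)) hne

lemma generic {n : ℕ} (e : En n) (I : Finset (MvPolynomial (Fin n) ℂ))
    (hI : ∀ p ∈ I, Irreducible p ∧ p.IsHomogeneous p.totalDegree ∧ pe p e = 1) :
    ∃ Δ : MvPolynomial (Fin n) ℂ, Δ ≠ 0 ∧ ∀ x s, pe Δ x ≠ 0 → pe (∏ p ∈ I, p) (x + s • e) = 0 →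
      deriv (fun s : ℂ => pe (∏ p ∈ I, p) (x + s • e)) s ≠ 0 := by
  classical
  have hinj : Function.Injective (algebraMap (MvPolynomial (Fin n) ℂ) (FractionRing (MvPolynomial (Fin n) ℂ))) := IsFractionRing.injective (MvPolynomial (Fin n) ℂ) (FractionRing (MvPolynomial (Fin n) ℂ))
  have hmon : ∀ p ∈ I, ((th e p).map (algebraMap (MvPolynomial (Fin n) ℂ) (FractionRing (MvPolynomial (Fin n) ℂ)))).Monic := fun p hp => (th_monic (hI p hp).2.1 (hI p hp).2.2).1.map _
  have hirr : ∀ p ∈ I, Irreducible ((th e p).map (algebraMap (MvPolynomial (Fin n) ℂ) (FractionRing (MvPolynomial (Fin n) ℂ)))) := fun p hp =>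
    ((th_monic (hI p hp).2.1 (hI p hp).2.2).1.irreducible_iff_irreducible_map_fraction_map).1 (th_irr e (hI p hp).1)
  haveI : CharZero (FractionRing (MvPolynomial (Fin n) ℂ)) := charZero_of_injective_algebraMap hinj
  have hsep : ((th e (∏ p ∈ I, p)).map (algebraMap (MvPolynomial (Fin n) ℂ) (FractionRing (MvPolynomial (Fin n) ℂ)))).Separable := by
    rw [map_prod, Polynomial.map_prod]
    refine Polynomial.separable_prod' ?_ fun p hp => (hirr p hp).separable
    intro p hp q hq hpq
    exact coprime_field (hmon p hp) (hmon q hq) (hirr p hp) (hirr q hq) fun h =>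
      hpq (th_inj e (Polynomial.map_injective _ hinj h))
  obtain ⟨a, b, hab⟩ := hsep
  obtain ⟨⟨b1, hb1⟩, h1⟩ := IsLocalization.integerNormalization_map_to_map (nonZeroDivisors (MvPolynomial (Fin n) ℂ)) a
  obtain ⟨⟨b2, hb2⟩, h2⟩ := IsLocalization.integerNormalization_map_to_map (nonZeroDivisors (MvPolynomial (Fin n) ℂ)) b
  set a' := IsLocalization.integerNormalization (nonZeroDivisors (MvPolynomial (Fin n) ℂ)) a
  set b' := IsLocalization.integerNormalization (nonZeroDivisors (MvPolynomial (Fin n) ℂ)) b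
  set G := th e (∏ p ∈ I, p) with hG
  have key : Polynomial.C b2 * a' * G + Polynomial.C b1 * b' * G.derivative = Polynomial.C (b1 * b2) := by
    apply Polynomial.map_injective _ hinj
    simp only [Polynomial.map_add, Polynomial.map_mul, h1, h2, Polynomial.map_C, ← Polynomial.derivative_map, map_mul]
    have e1 : ∀ (b : (MvPolynomial (Fin n) ℂ)) (a : Polynomial (FractionRing (MvPolynomial (Fin n) ℂ))), b • a = Polynomial.C (algebraMap (MvPolynomial (Fin n) ℂ) (FractionRing (MvPolynomial (Fin n) ℂ)) b) * a := by
      intro b a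
      ext i; simp [Algebra.smul_def]
    simp only [e1]
    linear_combination (Polynomial.C (algebraMap (MvPolynomial (Fin n) ℂ) (FractionRing (MvPolynomial (Fin n) ℂ)) b1) * Polynomial.C (algebraMap (MvPolynomial (Fin n) ℂ) (FractionRing (MvPolynomial (Fin n) ℂ)) b2)) * hab
  refine ⟨b1 * b2, mul_ne_zero (nonZeroDivisors.ne_zero hb1) (nonZeroDivisors.ne_zero hb2), fun x s hx hF hd => ?_⟩
  rw [lpo_deriv] at hd
  rw [← lpo_eval] at hF
  apply hx
  have h3 := congrArg (fun q => (q.map (MvPolynomial.eval (x : Fin n → ℂ))).eval s) key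
  simp only [Polynomial.map_add, Polynomial.map_mul, Polynomial.eval_add, Polynomial.eval_mul, Polynomial.map_C,
    Polynomial.eval_C, ← Polynomial.derivative_map] at h3
  have hF' : (G.map (MvPolynomial.eval (x : Fin n → ℂ))).eval s = 0 := hF
  have hd' : (G.map (MvPolynomial.eval (x : Fin n → ℂ))).derivative.eval s = 0 := hd
  rw [hF', hd'] at h3
  simp only [pe]
  rw [← h3]; ring


/-- polynomial growth -/
def PG {n : ℕ} (k : En n → ℂ) : Prop := ∃ (C : ℝ) (N : ℕ), 0 ≤ C ∧ ∀ x, ‖k x‖ ≤ C * (1 + ‖x‖) ^ N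

lemma PG.mul {n : ℕ} {k l : En n → ℂ} (hk : PG k) (hl : PG l) : PG fun x => k x * l x := by
  obtain ⟨C, N, h0, h⟩ := hk
  obtain ⟨C', N', h0', h'⟩ := hl
  refine ⟨C * C', N + N', mul_nonneg h0 h0', fun x => ?_⟩
  rw [norm_mul]
  calc _ ≤ (C * (1 + ‖x‖) ^ N) * (C' * (1 + ‖x‖) ^ N') := by
        gcongr
        · exact h x
        · exact h' x
    _ = _ := by ring

lemma PG.add {n : ℕ} {k l : En n → ℂ} (hk : PG k) (hl : PG l) : PG fun x => k x + l x := by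
  obtain ⟨C, N, h0, h⟩ := hk
  obtain ⟨C', N', h0', h'⟩ := hl
  refine ⟨C + C', N + N', add_nonneg h0 h0', fun x => ?_⟩
  have h1 : (1:ℝ) ≤ 1 + ‖x‖ := by linarith [norm_nonneg x]
  have h2 : (1 + ‖x‖) ^ N ≤ (1 + ‖x‖) ^ (N + N') := pow_le_pow_right₀ h1 (by omega)
  have h3 : (1 + ‖x‖) ^ N' ≤ (1 + ‖x‖) ^ (N + N') := pow_le_pow_right₀ h1 (by omega)
  calc _ ≤ ‖k x‖ + ‖l x‖ := norm_add_le _ _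
    _ ≤ C * (1 + ‖x‖) ^ (N + N') + C' * (1 + ‖x‖) ^ (N + N') := 
      add_le_add ((h x).trans (by gcongr)) ((h' x).trans (by gcongr))
    _ = _ := by ring

lemma PG.pe {n : ℕ} (p : MvPolynomial (Fin n) ℂ) : PG (pe p) := by
  induction p using MvPolynomial.induction_on with
  | C a => exact ⟨‖a‖, 0, norm_nonneg _, fun x => by simp [_root_.pe]⟩
  | add p q hp hq => 
    have : _root_.pe (p + q) = fun x => _root_.pe p x + _root_.pe q x := by funext x; simp [_root_.pe]
    rw [this]; exact hp.add hq
  | mul_X p i hp =>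
    have : _root_.pe (p * MvPolynomial.X i) = fun x => _root_.pe p x * x i := by funext x; simp [_root_.pe]
    rw [this]
    refine hp.mul ⟨1, 1, zero_le_one, fun x => ?_⟩
    have := PiLp.norm_apply_le x i
    rw [one_mul, pow_one]; linarith

lemma growth_one {h : ℂ → ℂ} (hd : Differentiable ℂ h) {C a b : ℝ} {N : ℕ} (hC : 0 ≤ C) (ha : 0 ≤ a) (hb : 0 ≤ b)
    (hg : ∀ z, ‖h z‖ ≤ C * (1 + (a + ‖z‖ * b)) ^ N) {j : ℕ} (hj : N < j) : iteratedDeriv j h 0 = 0 := by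
  set M : ℝ := j.factorial * (C * (1 + a + b) ^ N) with hM
  have hM0 : 0 ≤ M := by positivity
  have key : ∀ R : ℝ, 1 ≤ R → ‖iteratedDeriv j h 0‖ ≤ M / R := by
    intro R hR
    have hR0 : 0 < R := by linarith
    have h1 := Complex.norm_iteratedDeriv_le_of_forall_mem_sphere_norm_le (c := 0) (C := C * (1 + a + b) ^ N * R ^ N) j hR0 hd.diffContOnCl (by
      intro z hz
      have hz' : ‖z‖ = R := by simpa using hz
      refine (hg z).trans ?_
      rw [hz', mul_assoc, ← mul_pow]
      gcongr
      nlinarith [mul_nonneg (sub_nonneg.2 hR) ha])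
    refine h1.trans ?_
    rw [div_le_div_iff₀ (by positivity) hR0]
    have : R ^ N * R ≤ R ^ j := by
      rw [← pow_succ]; exact pow_le_pow_right₀ hR hj
    calc _ = M * (R ^ N * R) := by rw [hM]; ring
      _ ≤ M * R ^ j := by gcongr
  by_contra hne
  have hpos : 0 < ‖iteratedDeriv j h 0‖ := norm_pos_iff.2 hne
  have h2 := key (1 + M / ‖iteratedDeriv j h 0‖) (by
    have : 0 ≤ M / ‖iteratedDeriv j h 0‖ := by positivity
    linarith)
  rw [le_div_iff₀ (by positivity), mul_add, mul_div_cancel₀ _ hpos.ne'] at h2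
  linarith

lemma liouville {n : ℕ} {k : En n → ℂ} (hk : Differentiable ℂ k) {x0 : En n} (ha : AnalyticAt ℂ k x0)
    (hg : PG k) : ∃ K : MvPolynomial (Fin n) ℂ, ∀ x, k x = pe K x := by
  obtain ⟨C, N, hC, hg⟩ := hg
  obtain ⟨q, r, hq⟩ := ha
  choose P hP using fun j => diag_poly (q j)
  have hline : ∀ v : En n, k (x0 + v) = ∑ j ∈ Finset.range (N + 1), q j fun _ => v := by
    intro v
    set h : ℂ → ℂ := fun z => k (x0 + z • v) with hh
    have hd : Differentiable ℂ h := hk.comp ((differentiable_const _).add (differentiable_id.smul_const v))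
    have hco : ∀ j, iteratedDeriv j h 0 = j.factorial • (q j fun _ => v) := by
      intro j
      have h1 : HasFPowerSeriesAt (fun y => k (y + x0)) q ((ContinuousLinearMap.toSpanSingleton ℂ v) 0) := by
        have := (hq.hasFPowerSeriesAt).comp_sub (-x0)
        simpa using this
      have h2 := h1.compContinuousLinearMap (u := ContinuousLinearMap.toSpanSingleton ℂ v)
      obtain ⟨r', h3⟩ := h2
      have h4 := h3.factorial_smul (y := 1) j
      rw [iteratedDeriv]
      have h5 : h = (fun y => k (y + x0)) ∘ (ContinuousLinearMap.toSpanSingleton ℂ v) := by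
        funext z; simp [hh, add_comm]
      rw [h5, ← h4]
      rw [FormalMultilinearSeries.compContinuousLinearMap_apply]
      congr 2
      funext i; simp
    have hz : ∀ j, N < j → iteratedDeriv j h 0 = 0 := fun j hj => 
      growth_one hd hC (norm_nonneg x0) (norm_nonneg v) (fun z => (hg _).trans (by
        gcongr
        exact (norm_add_le _ _).trans (by rw [norm_smul]))) hj
    have hs := Complex.hasSum_taylorSeries_of_entire hd 0 1
    have hs2 := hasSum_sum_of_ne_finset_zero (L := SummationFilter.unconditional ℕ) (f := fun n : ℕ ↦ (n.factorial : ℂ)⁻¹ • ((1:ℂ) - 0) ^ n • iteratedDeriv n h 0) (s := Finset.range (N + 1)) (by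
      intro j hj
      rw [hz j (by simpa using hj)]; simp)
    have := hs.unique hs2
    simp only [hh, one_smul] at this
    rw [this]
    refine Finset.sum_congr rfl fun j _ => ?_
    have := hco j
    simp only [hh] at this
    rw [this]
    have hf : (j.factorial : ℂ) ≠ 0 := by exact_mod_cast j.factorial_ne_zero
    simp [hf]
  refine ⟨∑ j ∈ Finset.range (N + 1), MvPolynomial.aeval (fun i => MvPolynomial.X i - MvPolynomial.C (x0 i)) (P j), fun x => ?_⟩
  have := hline (x - x0)
  rw [add_sub_cancel] at this
  rw [this, pe, map_sum]
  refine Finset.sum_congr rfl fun j _ => ?_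
  rw [← (hP j).2 (x - x0)]
  have h6 : ((MvPolynomial.eval (x : Fin n → ℂ)).comp 
      (MvPolynomial.aeval (R := ℂ) (fun i => (MvPolynomial.X i - MvPolynomial.C (x0 i) : MvPolynomial (Fin n) ℂ)) : 
        MvPolynomial (Fin n) ℂ →+* MvPolynomial (Fin n) ℂ)) = MvPolynomial.eval ((x - x0 : En n) : Fin n → ℂ) := by
    apply MvPolynomial.ringHom_ext
    · intro r; simp [MvPolynomial.algebraMap_eq]
    · intro i; simp
  exact (congrArg (fun f => f (P j)) h6).symm


/-- directional derivative polynomial -/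
def De {n : ℕ} (e : En n) (f : MvPolynomial (Fin n) ℂ) : MvPolynomial (Fin n) ℂ := (th e f).coeff 1

lemma De_eq {n : ℕ} (e : En n) (f : MvPolynomial (Fin n) ℂ) (x : En n) :
    pe (De e f) x = deriv (fun s : ℂ => pe f (x + s • e)) 0 := by
  rw [lpo_deriv, ← Polynomial.coeff_zero_eq_eval_zero, Polynomial.coeff_derivative, lpo, Polynomial.coeff_map]
  simp [pe, De]

lemma De_shift {n : ℕ} (e : En n) (f : MvPolynomial (Fin n) ℂ) (x : En n) (t : ℂ) :
    deriv (fun s : ℂ => pe f (x + s • e)) t = pe (De e f) (x + t • e) := by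
  rw [De_eq]
  have : (fun s : ℂ => pe f (x + t • e + s • e)) = fun s => (fun s : ℂ => pe f (x + s • e)) (s + t) := by
    funext s; simp only; congr 1; module
  rw [this, deriv_comp_add_const (f := fun s : ℂ => pe f (x + s • e)), zero_add]

lemma De_mul {n : ℕ} (e : En n) (f g : MvPolynomial (Fin n) ℂ) (x : En n) :
    pe (De e (f * g)) x = pe (De e f) x * pe g x + pe f x * pe (De e g) x := by
  simp only [De_eq, pe_mul]
  have h : ∀ f : MvPolynomial (Fin n) ℂ, DifferentiableAt ℂ (fun s : ℂ => pe f (x + s • e)) 0 := by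
    intro f
    have : (fun s : ℂ => pe f (x + s • e)) = fun s => (lpo e f x).eval s := by
      funext s; rw [lpo_eval]
    rw [this]; exact Polynomial.differentiableAt _
  rw [deriv_fun_mul (h f) (h g)]
  simp

/-- a system of distinct homogeneous irreducible polynomials normalized at e -/
structure Sys {n : ℕ} (e : En n) (I : Finset (MvPolynomial (Fin n) ℂ)) : Prop where
  irr : ∀ p ∈ I, Irreducible p
  hom : ∀ p ∈ I, p.IsHomogeneous p.totalDegree
  one : ∀ p ∈ I, pe p e = 1

lemma Sys.gen {n : ℕ} {e : En n} {I : Finset (MvPolynomial (Fin n) ℂ)} (h : Sys e I) :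
    ∃ Δ : MvPolynomial (Fin n) ℂ, Δ ≠ 0 ∧ (∀ x (s : ℂ), pe Δ (x + s • e) = pe Δ x) ∧ 
      ∀ x, pe Δ x ≠ 0 → pe (∏ p ∈ I, p) x = 0 → pe (De e (∏ p ∈ I, p)) x ≠ 0 := by
  obtain ⟨Δ, h0, hΔ⟩ := generic e I fun p hp => ⟨h.irr p hp, h.hom p hp, h.one p hp⟩
  have hth : th e Δ ≠ 0 := fun hh => h0 (th_inj e (by rw [hh, map_zero]))
  set N := (th e Δ).natDegree with hN
  have hco : ∀ x, pe ((th e Δ).coeff N) x = (lpo e Δ x).coeff N := by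
    intro x; rw [lpo, Polynomial.coeff_map]; rfl
  refine ⟨(th e Δ).coeff N, by simpa [hN] using hth, fun x s => ?_, fun x hx hF => ?_⟩
  · rw [hco, hco]
    have h1 : lpo e Δ (x + s • e) = Polynomial.taylor s (lpo e Δ x) := by
      apply Polynomial.funext
      intro t
      rw [lpo_eval, Polynomial.taylor_eval, lpo_eval]
      congr 1; module
    have h2 : (lpo e Δ x).natDegree ≤ N := Polynomial.natDegree_map_le
    rw [h1]
    rcases h2.lt_or_eq with h3 | h3
    · rw [Polynomial.coeff_eq_zero_of_natDegree_lt h3, Polynomial.coeff_eq_zero_of_natDegree_lt (by rwa [Polynomial.natDegree_taylor])]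
    · rw [← h3, Polynomial.coeff_taylor_natDegree]; rfl
  · rw [hco] at hx
    have h1 : lpo e Δ x ≠ 0 := by
      intro hh; rw [hh] at hx; simp at hx
    obtain ⟨t, ht⟩ : ∃ t, (lpo e Δ x).eval t ≠ 0 := by
      by_contra hcon
      push Not at hcon
      exact h1 (Polynomial.funext (by simpa using hcon))
    rw [lpo_eval] at ht
    have h2 := hΔ (x + t • e) (-t) ht (by
      have : x + t • e + (-t) • e = x := by module
      rwa [this])
    rw [De_shift] at h2
    have : x + t • e + (-t) • e = x := by module
    rwa [this] at h2

lemma ne_dense {n : ℕ} {Δ : MvPolynomial (Fin n) ℂ} (h0 : Δ ≠ 0) (x : En n) : ∃ᶠ y in 𝓝 x, pe Δ y ≠ 0 := by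
  intro h
  apply h0
  have h1 : ∀ᶠ y in 𝓝 x, pe Δ y = 0 := by simpa using h
  have h2 := (pe_an Δ).eqOn_zero_of_preconnected_of_eventuallyEq_zero isPreconnected_univ (Set.mem_univ x) h1
  apply MvPolynomial.funext
  intro y
  simpa [pe] using h2 (Set.mem_univ (WithLp.toLp 2 y))

lemma small_root {n : ℕ} {e : En n} {p : MvPolynomial (Fin n) ℂ} (hp : p.IsHomogeneous p.totalDegree)
    (he : pe p e = 1) {x : En n} (hx : pe p x = 0) {ρ : ℝ} (hρ : 0 < ρ) : 
    ∀ᶠ y in 𝓝 x, ∃ s : ℂ, ‖s‖ < ρ ∧ pe p (y + s • e) = 0 := by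
  have h1 : ∀ᶠ y in 𝓝 x, ‖pe p y‖ < ρ ^ p.totalDegree := by
    have := (pe_cont p).norm.tendsto x
    rw [hx, norm_zero] at this
    exact this.eventually_lt_const (by positivity)
  filter_upwards [h1] with y hy
  by_contra hcon
  push Not at hcon
  have hm := lpo_monic hp he y
  have h2 : pe p y = ((lpo e p y).roots.map fun r => 0 - r).prod := by
    have h3 : (lpo e p y).eval 0 = pe p y := by rw [lpo_eval]; simp
    rw [← h3]
    exact Polynomial.Splits.eval_eq_prod_roots_of_monic (IsAlgClosed.splits _) hm.1 0
  have hcard : (lpo e p y).roots.card = p.totalDegree := by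
    rw [← hm.2]
    exact (Polynomial.splits_iff_card_roots.1 (IsAlgClosed.splits _))
  have h4 : ∀ t : Multiset ℂ, (∀ r ∈ t, ρ ≤ ‖r‖) → ρ ^ t.card ≤ ‖(t.map fun r => 0 - r).prod‖ := by
    intro t
    induction t using Multiset.induction_on with
    | empty => intro _; simp
    | cons a t ih =>
      intro ht
      rw [Multiset.card_cons, Multiset.map_cons, Multiset.prod_cons, norm_mul, pow_succ, mul_comm, zero_sub, norm_neg]
      exact mul_le_mul (ht a (by simp)) (ih fun r hr => ht r (by simp [hr])) (by positivity) (norm_nonneg _)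
  have h5 := h4 (lpo e p y).roots (by
    intro r hr
    by_contra hlt
    push Not at hlt
    refine hcon r hlt ?_
    rw [← lpo_eval]
    exact (Polynomial.mem_roots'.1 hr).2)
  rw [hcard, ← h2] at h5
  linarith

lemma dens {n : ℕ} {e : En n} {p Δ : MvPolynomial (Fin n) ℂ} (hp : p.IsHomogeneous p.totalDegree)
    (he : pe p e = 1) (hΔ : Δ ≠ 0) (hinv : ∀ x (s : ℂ), pe Δ (x + s • e) = pe Δ x)
    {x : En n} (hx : pe p x = 0) : ∃ᶠ q in 𝓝 x, pe p q = 0 ∧ pe Δ q ≠ 0 := by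
  rw [Metric.nhds_basis_ball.frequently_iff]
  intro ε hε
  have hρ : 0 < ε / 2 / (1 + ‖e‖) := by positivity
  obtain ⟨y, hy, ⟨s, hs, hps⟩, hyε⟩ := ((ne_dense hΔ x).and_eventually ((small_root hp he hx hρ).and (Metric.ball_mem_nhds x (half_pos hε)))).exists
  refine ⟨y + s • e, ?_, hps, by rwa [hinv]⟩
  rw [Metric.mem_ball]
  change dist y x < ε / 2 at hyε
  have h1 : ‖s • e‖ ≤ ε / 2 := by
    rw [norm_smul]
    rw [lt_div_iff₀ (by positivity)] at hs
    nlinarith [norm_nonneg s, norm_nonneg e]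
  calc dist (y + s • e) x ≤ dist (y + s • e) y + dist y x := dist_triangle _ _ _
    _ < ε := by rw [dist_eq_norm, add_sub_cancel_left]; linarith

/-- generic points -/
def Sp {n : ℕ} (e : En n) (I : Finset (MvPolynomial (Fin n) ℂ)) (p : MvPolynomial (Fin n) ℂ) : Set (En n) :=
  {q | pe p q = 0 ∧ pe (De e (∏ p ∈ I, p)) q ≠ 0}

lemma pe_prod_zero {n : ℕ} {I : Finset (MvPolynomial (Fin n) ℂ)} {x : En n} :
    pe (∏ p ∈ I, p) x = 0 ↔ ∃ p ∈ I, pe p x = 0 := by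
  simp [pe, map_prod, Finset.prod_eq_zero_iff]

lemma Sp.facts {n : ℕ} {e : En n} {I : Finset (MvPolynomial (Fin n) ℂ)} {p : MvPolynomial (Fin n) ℂ} (hp : p ∈ I)
    {q : En n} (hq : q ∈ Sp e I p) : pe (De e p) q ≠ 0 ∧ ∀ p' ∈ I, p' ≠ p → pe p' q ≠ 0 := by
  classical
  obtain ⟨h0, h1⟩ := hq
  rw [← Finset.mul_prod_erase I _ hp, De_mul, h0, zero_mul, add_zero] at h1
  refine ⟨left_ne_zero_of_mul h1, fun p' hp' hne h => ?_⟩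
  exact right_ne_zero_of_mul h1 (pe_prod_zero.2 ⟨p', Finset.mem_erase.2 ⟨hne, hp'⟩, h⟩)

lemma Sys.dense {n : ℕ} {e : En n} {I : Finset (MvPolynomial (Fin n) ℂ)} (h : Sys e I) 
    {p : MvPolynomial (Fin n) ℂ} (hp : p ∈ I) {x : En n} (hx : pe p x = 0) : ∃ᶠ q in 𝓝 x, q ∈ Sp e I p := by
  obtain ⟨Δ, h0, hinv, hΔ⟩ := h.gen
  refine (dens (h.hom p hp) (h.one p hp) h0 hinv hx).mono fun q hq => ⟨hq.1, ?_⟩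
  exact hΔ q hq.2 (pe_prod_zero.2 ⟨p, hp, hq.1⟩)

lemma Sys.open {n : ℕ} {e : En n} {I : Finset (MvPolynomial (Fin n) ℂ)} {p : MvPolynomial (Fin n) ℂ} 
    {x : En n} (hx : x ∈ Sp e I p) : ∀ᶠ q in 𝓝 x, pe p q = 0 → q ∈ Sp e I p := by
  filter_upwards [(pe_cont (De e (∏ p ∈ I, p))).continuousAt.eventually_ne hx.2] with q hq h
  exact ⟨h, hq⟩

lemma Sys.zero {n : ℕ} {e : En n} {I : Finset (MvPolynomial (Fin n) ℂ)} (h : Sys e I) 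
    {p : MvPolynomial (Fin n) ℂ} (hp : p ∈ I) : pe p 0 = 0 := by
  have hd : p.totalDegree ≠ 0 := by
    intro hd
    obtain hC := MvPolynomial.totalDegree_eq_zero_iff_eq_C.1 hd
    have h1 := h.one p hp
    have h2 : p = 1 := by
      rw [hC] at h1 ⊢
      simp only [pe, MvPolynomial.eval_C] at h1
      rw [h1, map_one]
    exact (h.irr p hp).not_isUnit (h2 ▸ isUnit_one)
  have := pe_smul (h.hom p hp) 0 (0 : En n)
  rw [zero_smul, zero_pow hd, zero_mul] at this
  exact this

lemma Sys.nonempty {n : ℕ} {e : En n} {I : Finset (MvPolynomial (Fin n) ℂ)} (h : Sys e I) 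
    {p : MvPolynomial (Fin n) ℂ} (hp : p ∈ I) : ∃ q, q ∈ Sp e I p := (h.dense hp (h.zero hp)).exists


open Classical in
/-- partial product of roots -/
def QA {n : ℕ} (e : En n) (p : MvPolynomial (Fin n) ℂ) (A : En n → Prop) (x : En n) : ℂ :=
  ∏ s ∈ (lpo e p x).roots.toFinset, if A (x + s • e) then -s else 1

lemma mem_rt {n : ℕ} {e : En n} {p : MvPolynomial (Fin n) ℂ} (hp : p.IsHomogeneous p.totalDegree)
    (he : pe p e = 1) {x : En n} {s : ℂ} : s ∈ (lpo e p x).roots.toFinset ↔ pe p (x + s • e) = 0 := by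
  rw [Multiset.mem_toFinset, Polynomial.mem_roots (lpo_monic hp he x).1.ne_zero, Polynomial.IsRoot.def, lpo_eval]

lemma QA_bound {n : ℕ} {e : En n} {p : MvPolynomial (Fin n) ℂ} (hp : p.IsHomogeneous p.totalDegree)
    (he : pe p e = 1) (A : En n → Prop) : PG (QA e p A) := by
  have h1 : ∀ᶠ y in 𝓝 e, pe p y ≠ 0 := (pe_cont p).continuousAt.eventually_ne (by rw [he]; exact one_ne_zero)
  obtain ⟨η, hη, hball⟩ := Metric.eventually_nhds_iff.1 h1
  have hroot : ∀ (x : En n) (s : ℂ), pe p (x + s • e) = 0 → ‖s‖ ≤ ‖x‖ / η := by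
    intro x s hs
    by_cases h0 : s = 0
    · rw [h0, norm_zero]; positivity
    rw [le_div_iff₀ hη]
    by_contra hlt
    push Not at hlt
    have h2 : pe p (s⁻¹ • (x + s • e)) = 0 := by rw [pe_smul hp, hs, mul_zero]
    refine hball ?_ h2
    have h3 : s⁻¹ • (x + s • e) = s⁻¹ • x + e := by
      rw [smul_add, smul_smul, inv_mul_cancel₀ h0, one_smul]
    rw [h3, dist_eq_norm, add_sub_cancel_right, norm_smul, norm_inv, inv_mul_lt_iff₀ (norm_pos_iff.2 h0)]
    exact hlt
  refine ⟨(1 + 1 / η) ^ p.totalDegree, p.totalDegree, by positivity, fun x => ?_⟩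
  rw [QA, norm_prod]
  have hB : (1:ℝ) ≤ (1 + 1 / η) * (1 + ‖x‖) := by
    have : 0 ≤ 1 / η := by positivity
    nlinarith [norm_nonneg x, mul_nonneg this (norm_nonneg x)]
  have h4 : ∀ s ∈ (lpo e p x).roots.toFinset, ‖@ite ℂ (A (x + s • e)) (Classical.propDecidable _) (-s) 1‖ ≤ (1 + 1 / η) * (1 + ‖x‖) := by
    intro s hs
    split_ifs
    · rw [norm_neg]
      refine (hroot x s ((mem_rt hp he).1 hs)).trans ?_
      have e1 : ‖x‖ / η = 1 / η * ‖x‖ := by ring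
      have : 0 ≤ 1 / η := by positivity
      rw [e1]; nlinarith [norm_nonneg x, mul_nonneg this (norm_nonneg x)]
    · rw [norm_one]; exact hB
  have hcard : (lpo e p x).roots.toFinset.card ≤ p.totalDegree :=
    (Multiset.toFinset_card_le _).trans ((Polynomial.card_roots' _).trans (lpo_monic hp he x).2.le)
  calc _ ≤ ∏ s ∈ (lpo e p x).roots.toFinset, ((1 + 1 / η) * (1 + ‖x‖)) := 
        Finset.prod_le_prod (fun _ _ => norm_nonneg _) h4
    _ = ((1 + 1 / η) * (1 + ‖x‖)) ^ (lpo e p x).roots.toFinset.card := by rw [Finset.prod_const]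
    _ ≤ ((1 + 1 / η) * (1 + ‖x‖)) ^ p.totalDegree := pow_le_pow_right₀ hB hcard
    _ = _ := by rw [mul_pow]

section
variable {n : ℕ} {e : En n} {I : Finset (MvPolynomial (Fin n) ℂ)} {p Δ : MvPolynomial (Fin n) ℂ}

lemma root_Sp (hp : p ∈ I) (hinv : ∀ x (s : ℂ), pe Δ (x + s • e) = pe Δ x)
    (hΔ : ∀ x, pe Δ x ≠ 0 → pe (∏ p ∈ I, p) x = 0 → pe (De e (∏ p ∈ I, p)) x ≠ 0)
    {x : En n} (hx : pe Δ x ≠ 0) {s : ℂ} (hs : pe p (x + s • e) = 0) : x + s • e ∈ Sp e I p :=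
  ⟨hs, hΔ _ (by rwa [hinv]) (pe_prod_zero.2 ⟨p, hp, hs⟩)⟩

lemma nodup_rt (h : Sys e I) (hp : p ∈ I) (hinv : ∀ x (s : ℂ), pe Δ (x + s • e) = pe Δ x)
    (hΔ : ∀ x, pe Δ x ≠ 0 → pe (∏ p ∈ I, p) x = 0 → pe (De e (∏ p ∈ I, p)) x ≠ 0)
    {x : En n} (hx : pe Δ x ≠ 0) : (lpo e p x).roots.Nodup := by
  rw [Multiset.nodup_iff_count_le_one]
  intro s
  rw [Polynomial.count_roots]
  by_contra hcon
  push Not at hcon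
  have hne := (lpo_monic (h.hom p hp) (h.one p hp) x).1.ne_zero
  obtain ⟨h2, h1⟩ := (Polynomial.one_lt_rootMultiplicity_iff_isRoot hne).1 hcon
  rw [Polynomial.IsRoot.def, ← lpo_deriv, De_shift] at h1
  rw [Polynomial.IsRoot.def, lpo_eval] at h2
  exact (Sp.facts hp (root_Sp hp hinv hΔ hx h2)).1 h1

lemma card_rt (h : Sys e I) (hp : p ∈ I) (hinv : ∀ x (s : ℂ), pe Δ (x + s • e) = pe Δ x)
    (hΔ : ∀ x, pe Δ x ≠ 0 → pe (∏ p ∈ I, p) x = 0 → pe (De e (∏ p ∈ I, p)) x ≠ 0)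
    {x : En n} (hx : pe Δ x ≠ 0) : (lpo e p x).roots.toFinset.card = p.totalDegree := by
  rw [Multiset.toFinset_card_of_nodup (nodup_rt h hp hinv hΔ hx), ← (lpo_monic (h.hom p hp) (h.one p hp) x).2]
  exact (Polynomial.splits_iff_card_roots.1 (IsAlgClosed.splits _))

lemma QA_mul (h : Sys e I) (hp : p ∈ I) (hinv : ∀ x (s : ℂ), pe Δ (x + s • e) = pe Δ x)
    (hΔ : ∀ x, pe Δ x ≠ 0 → pe (∏ p ∈ I, p) x = 0 → pe (De e (∏ p ∈ I, p)) x ≠ 0)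
    (A : En n → Prop) {x : En n} (hx : pe Δ x ≠ 0) : QA e p A x * QA e p (fun y => ¬ A y) x = pe p x := by
  classical
  have h3 : (lpo e p x).eval 0 = pe p x := by rw [lpo_eval]; simp
  rw [← h3, Polynomial.Splits.eval_eq_prod_roots_of_monic (IsAlgClosed.splits _) (lpo_monic (h.hom p hp) (h.one p hp) x).1 0,
    QA, QA, ← Finset.prod_mul_distrib]
  have h4 : ((lpo e p x).roots.map fun s : ℂ => 0 - s).prod = ∏ s ∈ (lpo e p x).roots.toFinset, (0 - s) := by
    rw [Finset.prod_eq_multiset_prod, Multiset.toFinset_val, (nodup_rt h hp hinv hΔ hx).dedup]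
  rw [h4]
  refine Finset.prod_congr rfl fun s _ => ?_
  by_cases hA : A (x + s • e) <;> simp [hA]

lemma QA_an (h : Sys e I) (hp : p ∈ I) (hinv : ∀ x (s : ℂ), pe Δ (x + s • e) = pe Δ x)
    (hΔ : ∀ x, pe Δ x ≠ 0 → pe (∏ p ∈ I, p) x = 0 → pe (De e (∏ p ∈ I, p)) x ≠ 0)
    {A : En n → Prop} (hA : ∀ q ∈ Sp e I p, ∀ᶠ q' in 𝓝 q, q' ∈ Sp e I p → (A q' ↔ A q)) 
    {x : En n} (hx : pe Δ x ≠ 0) : AnalyticAt ℂ (QA e p A) x := by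
  classical
  set T := (lpo e p x).roots.toFinset with hT
  have hTm : ∀ {s}, s ∈ T ↔ pe p (x + s • e) = 0 := mem_rt (h.hom p hp) (h.one p hp)
  have himp : ∀ s : ℂ, ∃ σ : En n → ℂ, s ∈ T → AnalyticAt ℂ σ x ∧ σ x = s ∧ ∀ᶠ y in 𝓝 x, pe p (y + σ y • e) = 0 := by
    intro s
    by_cases hs : s ∈ T
    · obtain ⟨σ, h1, h2, h3⟩ := impl_fun (pe_an p (x + s • e) trivial) (hTm.1 hs) (by
        rw [De_shift]; exact (Sp.facts hp (root_Sp hp hinv hΔ hx (hTm.1 hs))).1)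
      refine ⟨σ, fun _ => ⟨h1, h2, ?_⟩⟩
      have ht : Filter.Tendsto (fun y => (y, σ y)) (𝓝 x) (𝓝 (x, s)) := by
        have := (continuousAt_id (x := x)).prodMk h1.continuousAt
        simpa [ContinuousAt, h2] using this
      filter_upwards [ht.eventually h3] with y hy
      exact hy.2 rfl
    · exact ⟨0, fun h => absurd h hs⟩
  choose σ hσ using himp
  have hS : ∀ s ∈ T, x + s • e ∈ Sp e I p := fun s hs => root_Sp hp hinv hΔ hx (hTm.1 hs)
  have e1 : ∀ᶠ y in 𝓝 x, ∀ s ∈ T, pe p (y + σ s y • e) = 0 := 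
    (Finset.eventually_all T).2 fun s hs => (hσ s hs).2.2
  have e2 : ∀ᶠ y in 𝓝 x, ∀ s ∈ T, ∀ t ∈ T, s ≠ t → σ s y ≠ σ t y := by
    refine (Finset.eventually_all T).2 fun s hs => (Finset.eventually_all T).2 fun t ht => ?_
    by_cases hst : s = t
    · exact Filter.Eventually.of_forall fun _ h => absurd hst h
    · have h1 := ((hσ s hs).1.continuousAt.sub (hσ t ht).1.continuousAt).eventually_ne (y := 0) (by
        change σ s x - σ t x ≠ 0
        rw [(hσ s hs).2.1, (hσ t ht).2.1]; exact sub_ne_zero.2 hst)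
      filter_upwards [h1] with y hy _
      exact sub_ne_zero.1 hy
  have e3 : ∀ᶠ y in 𝓝 x, ∀ s ∈ T, (A (y + σ s y • e) ↔ A (x + s • e)) := by
    refine (Finset.eventually_all T).2 fun s hs => ?_
    have ht : Filter.Tendsto (fun y => y + σ s y • e) (𝓝 x) (𝓝 (x + s • e)) := by
      have := (continuousAt_id (x := x)).add ((hσ s hs).1.continuousAt.smul (continuousAt_const (y := e)))
      rw [ContinuousAt] at this
      simp only [Pi.add_apply, Pi.smul_apply', id, (hσ s hs).2.1] at this
      exact this
    filter_upwards [ht.eventually (hA _ (hS s hs)), ht.eventually (Sys.open (hS s hs)), (hσ s hs).2.2] with y h1 h2 h3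
    exact h1 (h2 h3)
  have e4 : ∀ᶠ y in 𝓝 x, pe Δ y ≠ 0 := (pe_cont Δ).continuousAt.eventually_ne hx
  have key : (fun y => ∏ s ∈ T, if A (x + s • e) then - σ s y else 1) =ᶠ[𝓝 x] QA e p A := by
    filter_upwards [e1, e2, e3, e4] with y h1 h2 h3 h4
    have hinj : Set.InjOn (fun s => σ s y) T := by
      intro s hs t ht hst
      by_contra hne
      exact h2 s hs t ht hne hst
    have him : T.image (fun s => σ s y) = (lpo e p y).roots.toFinset := by
      apply Finset.eq_of_subset_of_card_le
      · intro t ht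
        obtain ⟨s, hs, rfl⟩ := Finset.mem_image.1 ht
        exact (mem_rt (h.hom p hp) (h.one p hp)).2 (h1 s hs)
      · rw [Finset.card_image_of_injOn hinj, card_rt h hp hinv hΔ h4, hT, card_rt h hp hinv hΔ hx]
    rw [QA, ← him, Finset.prod_image hinj]
    refine Finset.prod_congr rfl fun s hs => ?_
    simp only [h3 s hs]
  refine AnalyticAt.congr ?_ key
  refine Finset.analyticAt_fun_prod _ fun s hs => ?_
  split_ifs
  · exact (hσ s hs).1.neg
  · exact analyticAt_const

lemma QA_poly (h : Sys e I) (hp : p ∈ I) (h0 : Δ ≠ 0) (hinv : ∀ x (s : ℂ), pe Δ (x + s • e) = pe Δ x)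
    (hΔ : ∀ x, pe Δ x ≠ 0 → pe (∏ p ∈ I, p) x = 0 → pe (De e (∏ p ∈ I, p)) x ≠ 0)
    {A : En n → Prop} (hA : ∀ q ∈ Sp e I p, ∀ᶠ q' in 𝓝 q, q' ∈ Sp e I p → (A q' ↔ A q)) :
    ∃ K : MvPolynomial (Fin n) ℂ, ∀ x, pe Δ x * pe Δ x * QA e p A x = pe K x := by
  obtain ⟨x0, hx0⟩ := (ne_dense h0 0).exists
  have hb := QA_bound (h.hom p hp) (h.one p hp) A
  have han : ∀ x, pe Δ x ≠ 0 → AnalyticAt ℂ (fun x => pe Δ x * pe Δ x * QA e p A x) x := fun x hx =>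
    ((pe_an Δ x trivial).mul (pe_an Δ x trivial)).mul (QA_an h hp hinv hΔ hA hx)
  refine liouville (x0 := x0) (fun x => ?_) (han x0 hx0) (((PG.pe Δ).mul (PG.pe Δ)).mul hb)
  by_cases hx : pe Δ x = 0
  · have : HasFDerivAt (fun x => pe Δ x * pe Δ x * QA e p A x) (0 : En n →L[ℂ] ℂ) x := by
      rw [hasFDerivAt_iff_isLittleO]
      have h1 : (fun y => pe Δ y) =O[𝓝 x] fun y => y - x := by
        have := (pe_an Δ x trivial).differentiableAt.isBigO_sub
        simpa [hx] using this
      have h2 : (fun y => pe Δ y) =o[𝓝 x] fun _ => (1:ℝ) := by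
        rw [Asymptotics.isLittleO_one_iff]
        have := (pe_cont Δ).tendsto x
        rwa [hx] at this
      have h3 : QA e p A =O[𝓝 x] fun _ => (1:ℝ) := by
        obtain ⟨C, N, hC, hb⟩ := hb
        have h4 : (fun y : En n => C * (1 + ‖y‖) ^ N) =O[𝓝 x] fun _ => (1:ℝ) := by
          refine Filter.Tendsto.isBigO_one ℝ (c := C * (1 + ‖x‖) ^ N) ?_
          have : Continuous fun y : En n => C * (1 + ‖y‖) ^ N := by fun_prop
          exact this.tendsto x
        refine Asymptotics.IsBigO.trans ?_ h4
        exact Asymptotics.IsBigO.of_bound 1 (Filter.Eventually.of_forall fun y => by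
          rw [one_mul]; exact (hb y).trans (le_abs_self _))
      have h5 := (h1.norm_right.mul_isLittleO h2).mul_isBigO h3
      simpa [hx] using h5
    exact this.differentiableAt
  · exact (han x hx).differentiableAt

lemma Sys.conn (h : Sys e I) (hp : p ∈ I) 
    {A : En n → Prop} (hA : ∀ q ∈ Sp e I p, ∀ᶠ q' in 𝓝 q, q' ∈ Sp e I p → (A q' ↔ A q))
    {q1 q2 : En n} (hq1 : q1 ∈ Sp e I p) (hq2 : q2 ∈ Sp e I p) (h1 : A q1) : A q2 := by
  by_contra h2
  obtain ⟨Δ, h0, hinv, hΔ⟩ := h.gen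
  have hA' : ∀ q ∈ Sp e I p, ∀ᶠ q' in 𝓝 q, q' ∈ Sp e I p → (¬ A q' ↔ ¬ A q) := fun q hq => 
    (hA q hq).mono fun q' hh hq' => not_congr (hh hq')
  obtain ⟨K, hK⟩ := QA_poly h hp h0 hinv hΔ hA
  obtain ⟨K', hK'⟩ := QA_poly h hp h0 hinv hΔ hA'
  have hm : K * K' = Δ * Δ * (Δ * Δ) * p := by
    apply MvPolynomial.funext
    intro y
    have : pe (K * K') (WithLp.toLp 2 y) = pe (Δ * Δ * (Δ * Δ) * p) (WithLp.toLp 2 y) := by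
      simp only [pe_mul, ← hK, ← hK']
      by_cases hy : pe Δ (WithLp.toLp 2 y) = 0
      · simp [hy]
      · rw [← QA_mul h hp hinv hΔ A hy]; ring
    exact this
  have hstep : ∀ (B : En n → Prop), (∀ q ∈ Sp e I p, ∀ᶠ q' in 𝓝 q, q' ∈ Sp e I p → (B q' ↔ B q)) → 
      ∀ L : MvPolynomial (Fin n) ℂ, (∀ x, pe Δ x * pe Δ x * QA e p B x = pe L x) → 
      ∀ q ∈ Sp e I p, ¬ B q → ¬ p ∣ L := by
    rintro B hB L hL q hq hBq ⟨r, hr⟩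
    obtain ⟨q', ⟨hpq, hΔq⟩, hBq'⟩ := ((dens (h.hom p hp) (h.one p hp) h0 hinv hq.1).and_eventually (hB q hq)).exists
    have hS : q' ∈ Sp e I p := ⟨hpq, hΔ q' hΔq (pe_prod_zero.2 ⟨p, hp, hpq⟩)⟩
    have hnB : ¬ B q' := fun hh => hBq ((hBq' hS).1 hh)
    have h3 := hL q'
    rw [hr, pe_mul, hpq, zero_mul] at h3
    have h4 : QA e p B q' = 0 := (mul_eq_zero.1 h3).resolve_left (mul_ne_zero hΔq hΔq)
    rw [QA, Finset.prod_eq_zero_iff] at h4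
    obtain ⟨s, -, hs⟩ := h4
    split_ifs at hs with hBs
    · have : s = 0 := by simpa using hs
      rw [this, zero_smul, add_zero] at hBs
      exact hnB hBs
    · exact one_ne_zero hs
  have hd : p ∣ K * K' := hm ▸ dvd_mul_left _ _
  rcases (h.irr p hp).prime.dvd_or_dvd hd with h3 | h3
  · exact hstep A hA K hK q2 hq2 h2 h3
  · exact hstep _ hA' K' hK' q1 hq1 (not_not.2 h1) h3


lemma Sys.chart {n : ℕ} {e : En n} {I : Finset (MvPolynomial (Fin n) ℂ)} {p : MvPolynomial (Fin n) ℂ} (hp : p ∈ I)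
    {q : En n} (hq : q ∈ Sp e I p) : ∃ ζ δ, Chart {x | pe (∏ p ∈ I, p) x = 0} q e ζ δ := by
  refine Chart.of_simple (pe_an _ q trivial) (pe_prod_zero.2 ⟨p, hp, hq.1⟩) ?_ (Filter.Eventually.of_forall fun x => Iff.rfl)
  rw [← De_eq]; exact hq.2

lemma ind_self {n : ℕ} {e : En n} {I : Finset (MvPolynomial (Fin n) ℂ)} {p : MvPolynomial (Fin n) ℂ} (hp : p ∈ I)
    {q : En n} (hq : q ∈ Sp e I p) : IndAt (pe p) q e 1 :=
  IndAt.of_simple (pe_an _ q trivial) hq.1 (by rw [← De_eq]; exact (Sp.facts hp hq).1)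

lemma ind_P {n : ℕ} {e : En n} {I : Finset (MvPolynomial (Fin n) ℂ)} {p : MvPolynomial (Fin n) ℂ} (hp : p ∈ I)
    {q : En n} (hq : q ∈ Sp e I p) {c : ℂ} (hc : c ≠ 0) (k : MvPolynomial (Fin n) ℂ → ℕ) :
    IndAt (pe (MvPolynomial.C c * ∏ p ∈ I, p ^ k p)) q e (k p) := by
  classical
  have h1 : ∀ p' ∈ I, Ind1 (fun s : ℂ => pe p' (q + s • e) ^ k p') 0 (k p' * if p' = p then 1 else 0) := by
    intro p' hp'
    refine Ind1.npow ?_ _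
    split_ifs with h
    · subst h; exact ind_self hp hq
    · exact IndAt.of_ne (Filter.Eventually.of_forall fun y => (pe_cont p').continuousAt) ((Sp.facts hp hq).2 p' hp' h)
  have h2 := (Ind1.of_ne (v := fun _ : ℂ => c) (s := 0) (Filter.Eventually.of_forall fun y => continuousAt_const) hc).mul (Ind1.prod I h1)
  simp only [mul_ite, mul_one, mul_zero, Finset.sum_ite_eq', hp, if_true, zero_add] at h2
  have h3 : (fun s : ℂ => pe (MvPolynomial.C c * ∏ p ∈ I, p ^ k p) (q + s • e)) = 
      fun z => c * ∏ i ∈ I, pe i (q + z • e) ^ k i := by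
    funext s; simp [pe, map_prod]
  rw [IndAt, h3]
  exact h2

section
variable {n : ℕ} {e e' : En n} {I I' : Finset (MvPolynomial (Fin n) ℂ)} {Φ Ψ : En n → En n}

lemma ind_comp (hΦ : Continuous Φ) (hΨ : Continuous Ψ)
    (hl : ∀ x, Ψ (Φ x) = x) (hr : ∀ x, Φ (Ψ x) = x)
    (hZ : ∀ x, pe (∏ p ∈ I, p) x = 0 ↔ pe (∏ p ∈ I', p) (Φ x) = 0) {p p' : MvPolynomial (Fin n) ℂ}
    (hp : p ∈ I) (hp' : p' ∈ I') {q : En n} (hq : q ∈ Sp e I p) (hq' : Φ q ∈ Sp e' I' p') {u : En n → ℂ}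
    (hu : Continuous u) (hu0 : ∀ x, u x = 0 → pe (∏ p ∈ I', p) x = 0) {a : ℤ} (ha : IndAt u (Φ q) e' a) :
    ∃ c : ℤ, (c = 1 ∨ c = -1) ∧ IndAt (fun x => u (Φ x)) q e (c * a) := by
  obtain ⟨ζ, δ, hC⟩ := Sys.chart hp hq
  obtain ⟨ζ', δ', hC'⟩ := Sys.chart hp' hq'
  exact hC.inv hC' isOpen_univ isOpen_univ (Set.mem_univ _) (Set.mem_univ _) rfl hΦ.continuousOn hΨ.continuousOn
    (Set.mapsTo_univ _ _) (Set.mapsTo_univ _ _) (fun x _ => hl x) (fun x _ => hr x) (fun x _ => hZ x)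
    Filter.univ_mem hu.continuousOn (fun x hx h => hx.2 (hu0 x h)) ha

lemma match_one (h : Sys e I) (h' : Sys e' I') (hΦ : Continuous Φ) (hΨ : Continuous Ψ)
    (hl : ∀ x, Ψ (Φ x) = x) (hr : ∀ x, Φ (Ψ x) = x)
    (hZ : ∀ x, pe (∏ p ∈ I, p) x = 0 ↔ pe (∏ p ∈ I', p) (Φ x) = 0) {p : MvPolynomial (Fin n) ℂ}
    (hp : p ∈ I) : ∃ p' ∈ I', (∀ x, pe p x = 0 → pe p' (Φ x) = 0) ∧ ∃ q, q ∈ Sp e I p ∧ Φ q ∈ Sp e' I' p' := by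
  obtain ⟨q0, hq0⟩ := h.nonempty hp
  obtain ⟨p', hp', hpq⟩ := pe_prod_zero.1 ((hZ q0).1 (pe_prod_zero.2 ⟨p, hp, hq0.1⟩))
  have e1 : ∀ᶠ x in 𝓝 q0, pe (∏ p ∈ I, p) x = 0 → x ∈ Sp e I p := by
    have h2 : ∀ᶠ x in 𝓝 q0, ∀ p'' ∈ I, p'' ≠ p → pe p'' x ≠ 0 := by
      refine (Finset.eventually_all I).2 fun p'' hp'' => ?_
      by_cases hne : p'' = p
      · exact Filter.Eventually.of_forall fun _ hh => absurd hne hh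
      · filter_upwards [(pe_cont p'').continuousAt.eventually_ne ((Sp.facts hp hq0).2 p'' hp'' hne)] with x hx _ using hx
    filter_upwards [h2, Sys.open hq0] with x h3 h4 h5
    obtain ⟨p'', hp'', h6⟩ := pe_prod_zero.1 h5
    by_cases hne : p'' = p
    · subst hne; exact h4 h6
    · exact absurd h6 (h3 p'' hp'' hne)
  have hΨt : Filter.Tendsto Ψ (𝓝 (Φ q0)) (𝓝 q0) := by
    have := hΨ.tendsto (Φ q0)
    rwa [hl] at this
  obtain ⟨y, hy, hy1⟩ := ((h'.dense hp' hpq).and_eventually (hΨt.eventually e1)).exists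
  have hyS : Ψ y ∈ Sp e I p := hy1 ((hZ _).2 (by rw [hr]; exact pe_prod_zero.2 ⟨p', hp', hy.1⟩))
  have hyS' : Φ (Ψ y) ∈ Sp e' I' p' := by rwa [hr]
  refine ⟨p', hp', ?_, Ψ y, hyS, hyS'⟩
  obtain ⟨c, hc, hi⟩ := ind_comp hΦ hΨ hl hr hZ hp hp' hyS hyS' (pe_cont p') 
    (fun x hx => pe_prod_zero.2 ⟨p', hp', hx⟩) (ind_self hp' hyS')
  rw [mul_one] at hi
  have hA : ∀ q ∈ Sp e I p, IndAt (fun x => pe p' (Φ x)) q e c := by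
    intro q hq
    refine h.conn hp (A := fun q => IndAt (fun x => pe p' (Φ x)) q e c) ?_ hyS hq hi
    intro q hq
    obtain ⟨ζ, δ, hC⟩ := Sys.chart hp hq
    obtain ⟨a, ha⟩ := hC.ind (u := fun x => pe p' (Φ x)) Filter.univ_mem ((pe_cont p').comp hΦ).continuousOn (by
      intro x hx h0
      exact hx.2 ((hZ x).2 (pe_prod_zero.2 ⟨p', hp', h0⟩)))
    have haq := ha.self_of_nhds (pe_prod_zero.2 ⟨p, hp, hq.1⟩)
    filter_upwards [ha] with q' hq' hS
    have haq' := hq' (pe_prod_zero.2 ⟨p, hp, hS.1⟩)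
    constructor
    · intro h1; rw [h1.unique haq']; exact haq
    · intro h1; rw [h1.unique haq]; exact haq'
  have hS0 : ∀ q ∈ Sp e I p, pe p' (Φ q) = 0 := by
    intro q hq
    by_contra hne
    have h1 := IndAt.of_ne (u := fun x => pe p' (Φ x)) (e := e) (Filter.Eventually.of_forall fun y => ((pe_cont p').comp hΦ).continuousAt) hne
    have := h1.unique (hA q hq)
    rcases hc with rfl | rfl <;> omega
  intro x hx
  by_contra hne
  obtain ⟨q, hq, hq2⟩ := ((h.dense hp hx).and_eventually (((pe_cont p').comp hΦ).continuousAt.eventually_ne hne)).exists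
  exact hq2 (hS0 q hq)

lemma Sys.eq_of_sub (h : Sys e I) {p p' : MvPolynomial (Fin n) ℂ} (hp : p ∈ I) (hp' : p' ∈ I) 
    (hs : ∀ x, pe p x = 0 → pe p' x = 0) : p' = p := by
  obtain ⟨q, hq⟩ := h.nonempty hp
  by_contra hne
  exact (Sp.facts hp hq).2 p' hp' hne (hs q hq.1)
end

section
variable {n : ℕ} {f g : En n → ℂ} {φ ψ : En n → En n} {O O' : Set (En n)} {K : NNReal}

/-- half of the comparison -/
lemma half {e e' : En n} {I I' : Finset (MvPolynomial (Fin n) ℂ)} {Φ Ψ : En n → En n} {𝒰 : Filter ℝ} [𝒰.NeBot]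
    (hU : 𝒰 ≤ 𝓝[>] 0) (h : GP f g φ ψ O O' K) (hΦl : BlowLim 𝒰 φ Φ)
    (hs : Sys e I) (hs' : Sys e' I') (hΦ : Continuous Φ) (hΨ : Continuous Ψ)
    (hl : ∀ x, Ψ (Φ x) = x) (hr : ∀ x, Φ (Ψ x) = x)
    (hZ : ∀ x, pe (∏ p ∈ I, p) x = 0 ↔ pe (∏ p ∈ I', p) (Φ x) = 0) 
    {c c' : ℂ} (hc : c ≠ 0) (hc' : c' ≠ 0) {k l : MvPolynomial (Fin n) ℂ → ℕ} {m m' : ℕ}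
    (hP : ConeLim f (pe (MvPolynomial.C c * ∏ p ∈ I, p ^ k p)) m)
    (hP' : ConeLim g (pe (MvPolynomial.C c' * ∏ p ∈ I', p ^ l p)) m') {p : MvPolynomial (Fin n) ℂ}
    (hp : p ∈ I) : ∃ p' ∈ I', (∀ x, pe p x = 0 → pe p' (Φ x) = 0) ∧ l p' ≤ k p := by
  obtain ⟨p', hp', hV, q, hq, hq'⟩ := match_one hs hs' hΦ hΨ hl hr hZ hp
  refine ⟨p', hp', hV, ?_⟩
  obtain ⟨b, hb, hi⟩ := ind_comp hΦ hΨ hl hr hZ hp hp' hq hq' (pe_cont (MvPolynomial.C c' * ∏ p ∈ I', p ^ l p)) (by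
    intro x hx
    simp only [pe, map_mul, MvPolynomial.eval_C, mul_eq_zero, hc', false_or, map_prod, map_pow, Finset.prod_eq_zero_iff] at hx
    obtain ⟨p1, hp1, h1⟩ := hx
    exact pe_prod_zero.2 ⟨p1, hp1, eq_zero_of_pow_eq_zero h1⟩) (ind_P hp' hq' hc' l)
  have := cone_ineq hU h hΦl hP hP' (ind_P hp hq hc k) hi
  rcases hb with rfl | rfl
  · simp at this; exact_mod_cast this
  · simp at this; exact_mod_cast this

lemma P_zero {I : Finset (MvPolynomial (Fin n) ℂ)} {c : ℂ} (hc : c ≠ 0) {k : MvPolynomial (Fin n) ℂ → ℕ}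
    (hk : ∀ p ∈ I, 1 ≤ k p) (x : En n) : pe (MvPolynomial.C c * ∏ p ∈ I, p ^ k p) x = 0 ↔ pe (∏ p ∈ I, p) x = 0 := by
  rw [pe_prod_zero]
  simp only [pe, map_mul, MvPolynomial.eval_C, mul_eq_zero, hc, false_or, map_prod, map_pow, Finset.prod_eq_zero_iff]
  constructor
  · rintro ⟨p, hp, h⟩; exact ⟨p, hp, eq_zero_of_pow_eq_zero h⟩
  · rintro ⟨p, hp, h⟩; exact ⟨p, hp, by rw [h, zero_pow (by have := hk p hp; omega)]⟩

lemma final (H : ∀ f g : MvPolynomial (Fin n) ℂ, Irreducible f → Irreducible g →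
      f.IsHomogeneous f.totalDegree → g.IsHomogeneous g.totalDegree →
      (∃ (Φ Ψ : En n → En n), Φ 0 = 0 ∧ (∀ x, Ψ (Φ x) = x) ∧ (∀ x, Φ (Ψ x) = x) ∧ LipschitzWith K Φ ∧ LipschitzWith K Ψ ∧
        ∀ x, pe f x = 0 ↔ pe g (Φ x) = 0) → f.totalDegree = g.totalDegree)
    (h : GP f g φ ψ O O' K) (hf : ¬ ∀ᶠ x in 𝓝 (0 : En n), f x = 0) (hg : ¬ ∀ᶠ x in 𝓝 (0 : En n), g x = 0) :
    vanishingOrder f = vanishingOrder g := by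
  classical
  obtain ⟨P, hP0, hPh, hP⟩ := taylor (h.fa 0 h.h0) hf
  obtain ⟨P', hP0', hPh', hP'⟩ := taylor (h.ga 0 h.h0') hg
  change ConeLim f (pe P) _ at hP
  change ConeLim g (pe P') _ at hP'
  obtain ⟨e, he⟩ := (ne_dense hP0 0).exists
  obtain ⟨e', he'⟩ := (ne_dense hP0' 0).exists
  obtain ⟨I, k, c, hc, hPe, hI, hm⟩ := factor_hom hPh he
  obtain ⟨I', l, c', hc', hPe', hI', hm'⟩ := factor_hom hPh' he'
  have hs : Sys e I := ⟨fun p hp => (hI p hp).1, fun p hp => (hI p hp).2.1, fun p hp => (hI p hp).2.2.1⟩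
  have hs' : Sys e' I' := ⟨fun p hp => (hI' p hp).1, fun p hp => (hI' p hp).2.1, fun p hp => (hI' p hp).2.2.1⟩
  have hz : ∀ x, pe P x = 0 ↔ pe (∏ p ∈ I, p) x = 0 := fun x => by
    rw [hPe]; exact P_zero hc (fun p hp => (hI p hp).2.2.2) x
  have hz' : ∀ x, pe P' x = 0 ↔ pe (∏ p ∈ I', p) x = 0 := fun x => by
    rw [hPe']; exact P_zero hc' (fun p hp => (hI' p hp).2.2.2) x
  obtain ⟨𝒰, hU⟩ := Ultrafilter.exists_le (𝓝[>] (0:ℝ))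
  obtain ⟨Φ, hΦL, hΦl⟩ := blow (h.hO.mem_nhds h.h0) h.Lφ h.φ0 𝒰 hU
  obtain ⟨Ψ, hΨL, hΨl⟩ := blow (h.hO'.mem_nhds h.h0') h.Lψ h.symm.φ0 𝒰 hU
  have hl : ∀ x, Ψ (Φ x) = x := BlowLim.comp hU h hΦl hΨl
  have hr : ∀ x, Φ (Ψ x) = x := BlowLim.comp hU h.symm hΨl hΦl
  have hZ1 : ∀ x, pe P x = 0 → pe P' (Φ x) = 0 := fun x hx =>
    cone_zero hU hΦL.continuous h hΦl hP hP' (pe_an P) (pe_cont P') ⟨e, he⟩ hx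
  have hZ2 : ∀ x, pe P' x = 0 → pe P (Ψ x) = 0 := fun x hx =>
    cone_zero hU hΨL.continuous h.symm hΨl hP' hP (pe_an P') (pe_cont P) ⟨e', he'⟩ hx
  have hZ : ∀ x, pe (∏ p ∈ I, p) x = 0 ↔ pe (∏ p ∈ I', p) (Φ x) = 0 := fun x => by
    rw [← hz, ← hz']
    exact ⟨hZ1 x, fun hh => by have := hZ2 _ hh; rwa [hl] at this⟩
  have hZ' : ∀ x, pe (∏ p ∈ I', p) x = 0 ↔ pe (∏ p ∈ I, p) (Ψ x) = 0 := fun x => by rw [hZ, hr]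
  have hΦ0 : Φ 0 = 0 := by
    have h1 : Filter.Tendsto (fun t : ℝ => (t, (0 : En n))) 𝒰 (𝒰 ×ˢ 𝓝 0) := Filter.tendsto_id.prodMk tendsto_const_nhds
    have h2 := (hΦl 0).comp h1
    have h3 : ((fun z : ℝ × En n => (z.1:ℂ)⁻¹ • φ ((z.1:ℂ) • z.2)) ∘ fun t : ℝ => (t, (0 : En n))) = fun _ => 0 := by
      funext t; simp [h.φ0]
    rw [h3] at h2
    exact tendsto_nhds_unique h2 tendsto_const_nhds
  rw [hPe] at hP
  rw [hPe'] at hP'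
  have hh1 : ∀ p, ∃ p', p ∈ I → p' ∈ I' ∧ (∀ x, pe p x = 0 → pe p' (Φ x) = 0) ∧ l p' ≤ k p := by
    intro p
    by_cases hp : p ∈ I
    · obtain ⟨p', h1, h2⟩ := half hU h hΦl hs hs' hΦL.continuous hΨL.continuous hl hr hZ hc hc' hP hP' hp
      exact ⟨p', fun _ => ⟨h1, h2⟩⟩
    · exact ⟨0, fun hh => absurd hh hp⟩
  have hh2 : ∀ p, ∃ p', p ∈ I' → p' ∈ I ∧ (∀ x, pe p x = 0 → pe p' (Ψ x) = 0) ∧ k p' ≤ l p := by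
    intro p
    by_cases hp : p ∈ I'
    · obtain ⟨p', h1, h2⟩ := half hU h.symm hΨl hs' hs hΨL.continuous hΦL.continuous hr hl hZ' hc' hc hP' hP hp
      exact ⟨p', fun _ => ⟨h1, h2⟩⟩
    · exact ⟨0, fun hh => absurd hh hp⟩
  choose σ hσ using hh1
  choose τ hτ using hh2
  have hτσ : ∀ p ∈ I, τ (σ p) = p := fun p hp => hs.eq_of_sub hp (hτ _ (hσ p hp).1).1 fun x hx => by
    have := (hτ _ (hσ p hp).1).2.1 _ ((hσ p hp).2.1 x hx)
    rwa [hl] at this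
  have hστ : ∀ p ∈ I', σ (τ p) = p := fun p hp => hs'.eq_of_sub hp (hσ _ (hτ p hp).1).1 fun x hx => by
    have := (hσ _ (hτ p hp).1).2.1 _ ((hτ p hp).2.1 x hx)
    rwa [hr] at this
  rw [hm, hm']
  refine Finset.sum_nbij' σ τ (fun p hp => (hσ p hp).1) (fun p hp => (hτ p hp).1) hτσ hστ fun p hp => ?_
  have hk : k p = l (σ p) := by
    refine le_antisymm ?_ (hσ p hp).2.2
    have := (hτ _ (hσ p hp).1).2.2
    rwa [hτσ p hp] at this
  have hd : p.totalDegree = (σ p).totalDegree := by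
    refine H p (σ p) (hs.irr p hp) (hs'.irr _ (hσ p hp).1) (hs.hom p hp) (hs'.hom _ (hσ p hp).1) 
      ⟨Φ, Ψ, hΦ0, hl, hr, hΦL, hΨL, fun x => ⟨(hσ p hp).2.1 x, fun hx => ?_⟩⟩
    have := (hτ _ (hσ p hp).1).2.1 _ hx
    rwa [hτσ p hp, hl] at this
  rw [hk, hd]

/-- Theorem (Questions Ã2 ⟹ Ã1): if for all `n ≥ 1` and all irreducible homogeneous
polynomials `f, g` a bi-Lipschitz homeomorphism `(ℂⁿ, V(f), 0) → (ℂⁿ, V(g), 0)` forces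
`deg f = deg g`, then for all `n ≥ 1` and all reduced analytic hypersurface germs
a bi-Lipschitz homeomorphism of germs forces equality of multiplicities. -/
theorem question_A2_implies_question_A1
    (H : ∀ (n : ℕ), 1 ≤ n → ∀ f g : MvPolynomial (Fin n) ℂ,
      Irreducible f → Irreducible g →
      f.IsHomogeneous f.totalDegree → g.IsHomogeneous g.totalDegree →
      BiLipGermHomeo (pV f) (pV g) → f.totalDegree = g.totalDegree) :
    ∀ (n : ℕ), 1 ≤ n → ∀ (f g : En n → ℂ) (W W' : Set (En n)),
      IsOpen W → (0 : En n) ∈ W → IsOpen W' → (0 : En n) ∈ W' →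
      AnalyticOnNhd ℂ f W → AnalyticOnNhd ℂ g W' →
      f 0 = 0 → g 0 = 0 →
      -- f and g are not identically zero near 0
      ¬ (∀ᶠ x in 𝓝 (0 : En n), f x = 0) →
      ¬ (∀ᶠ x in 𝓝 (0 : En n), g x = 0) →
      -- f is reduced at 0: the smooth points of V(f) are dense in V(f) near 0
      (∃ Wf ∈ 𝓝 (0 : En n), {x ∈ W | f x = 0} ∩ Wf ⊆
          closure {x | x ∈ W ∧ f x = 0 ∧ fderiv ℂ f x ≠ 0}) →
      -- g is reduced at 0
      (∃ Wg ∈ 𝓝 (0 : En n), {x ∈ W' | g x = 0} ∩ Wg ⊆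
          closure {x | x ∈ W' ∧ g x = 0 ∧ fderiv ℂ g x ≠ 0}) →
      BiLipGermHomeo {x ∈ W | f x = 0} {x ∈ W' | g x = 0} →
      vanishingOrder f = vanishingOrder g := by
  intro n hn f g W W' hW h0W hW' h0W' fa ga f0 g0 hf hg ⟨Wf, hWf, hWfc⟩ ⟨Wg, hWg, hWgc⟩
    ⟨U, U', φ, ψ, K, hU, hU', h0U, h0U', φ0, m, m', l, r, Lφ, Lψ, him⟩
  have ψ0 : ψ 0 = 0 := by have := l h0U; rwa [φ0] at this
  set B : Set (En n) := U' ∩ W' ∩ interior Wg with hB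
  have hBo : IsOpen B := (hU'.inter hW').inter isOpen_interior
  set O : Set (En n) := (U ∩ φ ⁻¹' B) ∩ (W ∩ interior Wf) with hO
  have hOo : IsOpen O :=
    (Lφ.continuousOn.isOpen_inter_preimage hU hBo).inter (hW.inter isOpen_interior)
  set O' : Set (En n) := U' ∩ ψ ⁻¹' O with hO'
  have hOo' : IsOpen O' := Lψ.continuousOn.isOpen_inter_preimage hU' hOo
  have h0O : (0 : En n) ∈ O := by
    refine ⟨⟨h0U, ?_⟩, h0W, mem_interior_iff_mem_nhds.2 hWf⟩
    show φ 0 ∈ B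
    rw [φ0]; exact ⟨⟨h0U', h0W'⟩, mem_interior_iff_mem_nhds.2 hWg⟩
  have hOU : O ⊆ U := fun x hx => hx.1.1
  have hOU' : O' ⊆ U' := fun x hx => hx.1
  have hO'B : O' ⊆ B := by
    intro y hy
    have h1 : φ (ψ y) ∈ B := hy.2.1.2
    rwa [r hy.1] at h1
  have gp : GP f g φ ψ O O' K :=
    { hO := hOo
      hO' := hOo'
      h0 := h0O
      h0' := ⟨h0U', by show ψ 0 ∈ O; rw [ψ0]; exact h0O⟩
      φ0 := φ0
      m := fun x hx => ⟨m (hOU hx), by show ψ (φ x) ∈ O; rw [l (hOU hx)]; exact hx⟩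
      m' := fun y hy => hy.2
      l := fun x hx => l (hOU hx)
      r := fun y hy => r (hOU' hy)
      Lφ := Lφ.mono hOU
      Lψ := Lψ.mono hOU'
      fa := fun x hx => fa x hx.2.1
      ga := fun x hx => ga x (hO'B hx).1.2
      zero := by
        intro x hx
        constructor
        · intro h
          have h1 : φ x ∈ φ '' ({x ∈ W | f x = 0} ∩ U) := ⟨x, ⟨⟨hx.2.1, h⟩, hOU hx⟩, rfl⟩
          rw [him] at h1
          exact h1.1.2
        · intro h
          have h1 : φ x ∈ {x ∈ W' | g x = 0} ∩ U' := ⟨⟨hx.1.2.1.2, h⟩, m (hOU hx)⟩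
          rw [← him] at h1
          obtain ⟨y, hy, hyx⟩ := h1
          have h2 : y = x := by rw [← l hy.2, hyx, l (hOU hx)]
          rw [← h2]; exact hy.1.2
      regf := by
        intro x hx h N hN
        have h1 := hWfc ⟨⟨hx.2.1, h⟩, interior_subset hx.2.2⟩
        obtain ⟨y, hy, hy2⟩ := mem_closure_iff_nhds.1 h1 _ (Filter.inter_mem hN (hOo.mem_nhds hx))
        exact ⟨y, hy.1, hy.2, hy2.2⟩
      regg := by
        intro x hx h N hN
        have h1 := hWgc ⟨⟨(hO'B hx).1.2, h⟩, interior_subset (hO'B hx).2⟩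
        obtain ⟨y, hy, hy2⟩ := mem_closure_iff_nhds.1 h1 _ (Filter.inter_mem hN (hOo'.mem_nhds hx))
        exact ⟨y, hy.1, hy.2, hy2.2⟩ }
  refine final ?_ gp hf hg
  rintro p q hp hq hhp hhq ⟨Φ, Ψ, h0, hl, hr, hL, hL', hz⟩
  refine H n hn p q hp hq hhp hhq ⟨Set.univ, Set.univ, Φ, Ψ, K, isOpen_univ, isOpen_univ, trivial,
    trivial, h0, fun _ _ => trivial, fun _ _ => trivial, fun x _ => hl x, fun x _ => hr x,
    hL.lipschitzOnWith, hL'.lipschitzOnWith, ?_⟩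
  ext y
  constructor
  · rintro ⟨x, hx, rfl⟩
    exact ⟨(hz x).1 hx.1, trivial⟩
  · intro hy
    refine ⟨Ψ y, ⟨(hz (Ψ y)).2 ?_, trivial⟩, hr y⟩
    rw [hr]; exact hy.1
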